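/- Let L be an even positive-definite lattice such that M = 2U ⊕ L(−1) is 2-reflective. If L contains at least one vector r with (r,r) = 2, then the set of 2-roots {r ∈ L : (r,r) = 2} spans the real vector space L ⊗ ℝ; equivalently, the sublattice of L generated by its 2-roots has the same rank as L. -/

import Mathlib

open Matrix

namespace Refl

noncomputable section

variable {n : ℕ}

/-- ℂ-bilinear extension of the Gram pairing. -/
def cpair (B : Matrix (Fin n) (Fin n) ℤ) (Z W : Fin n → ℂ) : ℂ :=
  ∑ i, ∑ j, (B i j : ℂ) * Z i * W j

/-- ℚ-bilinear extension of the Gram pairing. -/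
def qpair (B : Matrix (Fin n) (Fin n) ℤ) (x y : Fin n → ℚ) : ℚ :=
  ∑ i, ∑ j, (B i j : ℚ) * x i * y j

/-- ℝ-bilinear extension of the Gram pairing. -/
def rpair (B : Matrix (Fin n) (Fin n) ℤ) (x y : Fin n → ℝ) : ℝ :=
  ∑ i, ∑ j, (B i j : ℝ) * x i * y j

def intQ (v : Fin n → ℤ) : Fin n → ℚ := fun i => (v i : ℚ)

def intR (v : Fin n → ℤ) : Fin n → ℝ := fun i => (v i : ℝ)

def intC (v : Fin n → ℤ) : Fin n → ℂ := fun i => (v i : ℂ)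

def ratR (v : Fin n → ℚ) : Fin n → ℝ := fun i => (v i : ℝ)

def ratC (v : Fin n → ℚ) : Fin n → ℂ := fun i => (v i : ℂ)

/-- (v, v) for an integral vector. -/
def qnorm (B : Matrix (Fin n) (Fin n) ℤ) (v : Fin n → ℤ) : ℤ := v ⬝ᵥ B.mulVec v

/-- Membership in the dual lattice (a vector of ℚ^n pairing integrally with the lattice). -/
def InDual (B : Matrix (Fin n) (Fin n) ℤ) (x : Fin n → ℚ) : Prop :=
  ∀ y : Fin n → ℤ, ∃ m : ℤ, qpair B x (intQ y) = (m : ℚ)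

/-- A rational vector lies in the lattice ℤ^n itself. -/
def InLat (x : Fin n → ℚ) : Prop := ∃ w : Fin n → ℤ, x = intQ w

/-- `B` is the Gram matrix of an even nondegenerate lattice of signature (p,q). -/
def IsEvenLatticeOfSignature (B : Matrix (Fin n) (Fin n) ℤ) (p q : ℕ) : Prop :=
  n = p + q ∧ B.IsSymm ∧ (∀ x : Fin n → ℤ, 2 ∣ qnorm B x) ∧ B.det ≠ 0 ∧
    ∃ P : Matrix (Fin n) (Fin n) ℝ, IsUnit P.det ∧
      Pᵀ * B.map (Int.cast : ℤ → ℝ) * P =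
        Matrix.diagonal (fun i : Fin n => if (i : ℕ) < p then (1 : ℝ) else -1)

/-- `B` is the Gram matrix of an even positive-definite lattice. -/
def IsEvenPosDef (B : Matrix (Fin n) (Fin n) ℤ) : Prop :=
  B.IsSymm ∧ (∀ x : Fin n → ℤ, 2 ∣ qnorm B x) ∧ (B.map (Int.cast : ℤ → ℝ)).PosDef

/-- The cone {Z | (Z,Z) = 0, (Z,conj Z) > 0}. -/
def Cone (B : Matrix (Fin n) (Fin n) ℤ) : Set (Fin n → ℂ) :=
  {Z | cpair B Z Z = 0 ∧ 0 < (cpair B Z (fun i => (starRingEnd ℂ) (Z i))).re}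

/-- `D` is one of the connected components of the cone (the affine cone `D•(M)`). -/
def IsComponent (B : Matrix (Fin n) (Fin n) ℤ) (D : Set (Fin n → ℂ)) : Prop :=
  ∃ Z ∈ Cone B, D = connectedComponentIn (Cone B) Z

/-- The action of an integral matrix on ℂ^n. -/
def actC (g : Matrix (Fin n) (Fin n) ℤ) (Z : Fin n → ℂ) : Fin n → ℂ :=
  (g.map (Int.cast : ℤ → ℂ)).mulVec Z

/-- The group O⁺(M): integral isometries preserving the chosen component. -/
def OPlus (B : Matrix (Fin n) (Fin n) ℤ) (D : Set (Fin n → ℂ)) :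
    Set (Matrix (Fin n) (Fin n) ℤ) :=
  {g | gᵀ * B * g = B ∧ actC g '' D = D}

/-- The stable orthogonal group Õ⁺(M): elements of O⁺(M) acting trivially on M^∨/M. -/
def StableOPlus (B : Matrix (Fin n) (Fin n) ℤ) (D : Set (Fin n → ℂ)) :
    Set (Matrix (Fin n) (Fin n) ℤ) :=
  {g | g ∈ OPlus B D ∧ ∀ x : Fin n → ℚ, InDual B x →
        ∃ w : Fin n → ℤ, (g.map (Int.cast : ℤ → ℚ)).mulVec x - x = intQ w}

/-- `Γ` is a finite-index subgroup of O⁺(M). -/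
structure IsFiniteIndexSubgroup (B : Matrix (Fin n) (Fin n) ℤ) (D : Set (Fin n → ℂ))
    (Γ : Set (Matrix (Fin n) (Fin n) ℤ)) : Prop where
  subset : Γ ⊆ OPlus B D
  one_mem : (1 : Matrix (Fin n) (Fin n) ℤ) ∈ Γ
  mul_mem : ∀ g ∈ Γ, ∀ h ∈ Γ, g * h ∈ Γ
  inv_mem : ∀ g ∈ Γ, ∃ h ∈ Γ, g * h = 1 ∧ h * g = 1
  finite_index : ∃ S : Finset (Matrix (Fin n) (Fin n) ℤ),
    ∀ g ∈ OPlus B D, ∃ s ∈ S, ∃ γ ∈ Γ, g = s * γ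

/-- `χ` is a character Γ → ℂ× with finite image (equivalently, of finite order). -/
structure IsCharacter (Γ : Set (Matrix (Fin n) (Fin n) ℤ))
    (χ : Matrix (Fin n) (Fin n) ℤ → ℂ) : Prop where
  ne_zero : ∀ g ∈ Γ, χ g ≠ 0
  map_mul : ∀ g ∈ Γ, ∀ h ∈ Γ, χ (g * h) = χ g * χ h
  finite_image : (χ '' Γ).Finite

/-- `F` is a modular form of weight `k` and character `χ` for `Γ` on the component `D`. -/
structure IsModularForm (B : Matrix (Fin n) (Fin n) ℤ) (D : Set (Fin n → ℂ))
    (Γ : Set (Matrix (Fin n) (Fin n) ℤ)) (χ : Matrix (Fin n) (Fin n) ℤ → ℂ)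
    (k : ℤ) (F : (Fin n → ℂ) → ℂ) : Prop where
  holo : DifferentiableOn ℂ F D
  homogeneous : ∀ t : ℂ, t ≠ 0 → ∀ Z ∈ D, F (t • Z) = t ^ (-k) * F Z
  equivariant : ∀ g ∈ Γ, ∀ Z ∈ D, F (actC g Z) = χ g * F Z

def NonConstantOn (D : Set (Fin n → ℂ)) (F : (Fin n → ℂ) → ℂ) : Prop :=
  ¬ ∃ c : ℂ, ∀ Z ∈ D, F Z = c

/-- `Z` lies on the rational quadratic divisor of the integral vector `v`. -/
def OrthZ (B : Matrix (Fin n) (Fin n) ℤ) (Z : Fin n → ℂ) (v : Fin n → ℤ) : Prop :=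
  cpair B Z (intC v) = 0

/-- `F` is nonconstant and its zero set is contained in hyperplanes of (-2)-vectors. -/
def Is2ReflectiveForm (B : Matrix (Fin n) (Fin n) ℤ) (D : Set (Fin n → ℂ))
    (F : (Fin n → ℂ) → ℂ) : Prop :=
  NonConstantOn D F ∧
    ∀ Z ∈ D, F Z = 0 → ∃ v : Fin n → ℤ, qnorm B v = -2 ∧ OrthZ B Z v

/-- The lattice is 2-reflective. -/
def Is2Reflective (B : Matrix (Fin n) (Fin n) ℤ) : Prop :=
  ∃ D : Set (Fin n → ℂ), IsComponent B D ∧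
    ∃ (Γ : Set (Matrix (Fin n) (Fin n) ℤ)) (χ : Matrix (Fin n) (Fin n) ℤ → ℂ)
      (k : ℤ) (F : (Fin n → ℂ) → ℂ),
      IsFiniteIndexSubgroup B D Γ ∧ IsCharacter Γ χ ∧
      IsModularForm B D Γ χ k F ∧ Is2ReflectiveForm B D F

/-- Primitivity of an integral vector : ℚv ∩ ℤ^n = ℤv. -/
def IsPrimitive (v : Fin n → ℤ) : Prop :=
  v ≠ 0 ∧ ∀ (a : ℚ) (w : Fin n → ℤ), (∀ i, a * (v i : ℚ) = (w i : ℚ)) →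
    ∃ m : ℤ, w = m • v

/-- The reflection σ_v maps the lattice into itself. -/
def ReflPreservesLat (B : Matrix (Fin n) (Fin n) ℤ) (v : Fin n → ℤ) : Prop :=
  ∀ x : Fin n → ℤ, ∃ y : Fin n → ℤ, ∀ i,
    (x i : ℚ) - (2 * ((x ⬝ᵥ B.mulVec v : ℤ) : ℚ) / (qnorm B v : ℚ)) * (v i : ℚ) = (y i : ℚ)

/-- The ℂ-linear extension of the reflection σ_v. -/
def reflC (B : Matrix (Fin n) (Fin n) ℤ) (v : Fin n → ℤ) (Z : Fin n → ℂ) : Fin n → ℂ :=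
  fun i => Z i - (2 * cpair B Z (intC v) / (qnorm B v : ℂ)) * (v i : ℂ)

/-- `v` is a reflective vector of the lattice `M` (w.r.t. the component `D`). -/
def IsReflectiveVector (B : Matrix (Fin n) (Fin n) ℤ) (D : Set (Fin n → ℂ))
    (v : Fin n → ℤ) : Prop :=
  IsPrimitive v ∧ qnorm B v < 0 ∧ ReflPreservesLat B v ∧ reflC B v '' D = D

/-- `F` is nonconstant and its zero set is contained in hyperplanes of reflective vectors. -/
def IsReflectiveForm (B : Matrix (Fin n) (Fin n) ℤ) (D : Set (Fin n → ℂ))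
    (F : (Fin n → ℂ) → ℂ) : Prop :=
  NonConstantOn D F ∧
    ∀ Z ∈ D, F Z = 0 → ∃ v : Fin n → ℤ, IsReflectiveVector B D v ∧ OrthZ B Z v

/-- The lattice is reflective. -/
def IsReflective (B : Matrix (Fin n) (Fin n) ℤ) : Prop :=
  ∃ D : Set (Fin n → ℂ), IsComponent B D ∧
    ∃ (Γ : Set (Matrix (Fin n) (Fin n) ℤ)) (χ : Matrix (Fin n) (Fin n) ℤ → ℂ)
      (k : ℤ) (F : (Fin n → ℂ) → ℂ),
      IsFiniteIndexSubgroup B D Γ ∧ IsCharacter Γ χ ∧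
      IsModularForm B D Γ χ k F ∧ IsReflectiveForm B D F

/-- Isomorphism of lattices given by Gram matrices. -/
def LatIso {m n : ℕ} (A : Matrix (Fin m) (Fin m) ℤ) (B : Matrix (Fin n) (Fin n) ℤ) : Prop :=
  ∃ e : (Fin m → ℤ) ≃ₗ[ℤ] (Fin n → ℤ), ∀ x y : Fin m → ℤ,
    e x ⬝ᵥ B.mulVec (e y) = x ⬝ᵥ A.mulVec y

/-- Orthogonal direct sum of lattices. -/
def dsum {m n : ℕ} (A : Matrix (Fin m) (Fin m) ℤ) (B : Matrix (Fin n) (Fin n) ℤ) :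
    Matrix (Fin (m + n)) (Fin (m + n)) ℤ :=
  Matrix.reindex finSumFinEquiv finSumFinEquiv (Matrix.fromBlocks A 0 0 B)

/-- The hyperbolic plane U. -/
def U : Matrix (Fin 2) (Fin 2) ℤ := !![0, 1; 1, 0]

/-- Gram matrix of the root lattice A_m. -/
def gramA (m : ℕ) : Matrix (Fin m) (Fin m) ℤ :=
  Matrix.of fun i j =>
    if i = j then 2 else if i.val + 1 = j.val ∨ j.val + 1 = i.val then -1 else 0

/-- Gram matrix of the root lattice D_m. -/
def gramD (m : ℕ) : Matrix (Fin m) (Fin m) ℤ :=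
  Matrix.of fun i j =>
    if i = j then 2
    else if (i.val + 1 = j.val ∧ j.val + 1 ≠ m) ∨ (j.val + 1 = i.val ∧ i.val + 1 ≠ m) then -1
    else if (i.val + 3 = m ∧ j.val + 1 = m) ∨ (j.val + 3 = m ∧ i.val + 1 = m) then -1
    else 0

/-- Gram matrix of the root lattice E_6. -/
def gramE6 : Matrix (Fin 6) (Fin 6) ℤ :=
  !![2, -1, 0, 0, 0, 0;
     -1, 2, -1, 0, 0, 0;
     0, -1, 2, -1, 0, -1;
     0, 0, -1, 2, -1, 0;
     0, 0, 0, -1, 2, 0;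
     0, 0, -1, 0, 0, 2]

/-- Gram matrix of the root lattice E_7. -/
def gramE7 : Matrix (Fin 7) (Fin 7) ℤ :=
  !![2, -1, 0, 0, 0, 0, 0;
     -1, 2, -1, 0, 0, 0, 0;
     0, -1, 2, -1, 0, 0, -1;
     0, 0, -1, 2, -1, 0, 0;
     0, 0, 0, -1, 2, -1, 0;
     0, 0, 0, 0, -1, 2, 0;
     0, 0, -1, 0, 0, 0, 2]

/-- Gram matrix of the root lattice E_8. -/
def gramE8 : Matrix (Fin 8) (Fin 8) ℤ :=
  !![2, -1, 0, 0, 0, 0, 0, 0;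
     -1, 2, -1, 0, 0, 0, 0, 0;
     0, -1, 2, -1, 0, 0, 0, -1;
     0, 0, -1, 2, -1, 0, 0, 0;
     0, 0, 0, -1, 2, -1, 0, 0;
     0, 0, 0, 0, -1, 2, -1, 0;
     0, 0, 0, 0, 0, -1, 2, 0;
     0, 0, -1, 0, 0, 0, 0, 2]

/-- Gram matrix of the Nikulin lattice N_8 (basis a_1,…,a_7,h with h=(a_1+⋯+a_8)/2). -/
def gramN8 : Matrix (Fin 8) (Fin 8) ℤ :=
  Matrix.of fun i j =>
    if i = j then (if i.val = 7 then 4 else 2)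
    else if i.val = 7 ∨ j.val = 7 then 1 else 0

/-- The lattice M = 2U ⊕ L(−1). -/
def M2U {r : ℕ} (L : Matrix (Fin r) (Fin r) ℤ) :
    Matrix (Fin (2 + (2 + r))) (Fin (2 + (2 + r))) ℤ :=
  dsum U (dsum U (-L))

/-- div(v) = d : the ideal (v, M) of ℤ is generated by d. -/
def DivEq (B : Matrix (Fin n) (Fin n) ℤ) (v : Fin n → ℤ) (d : ℤ) : Prop :=
  Ideal.span {a : ℤ | ∃ x : Fin n → ℤ, a = v ⬝ᵥ B.mulVec x} = Ideal.span {d}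

/-- Sum-of-divisors function σ₁ (on nonnegative integers). -/
def sigma1 (m : ℤ) : ℤ := ∑ d ∈ m.toNat.divisors, (d : ℤ)

end

end Refl

namespace Refl

section Pairings
variable {n : ℕ} (B : Matrix (Fin n) (Fin n) ℤ)

lemma cpair_add_left (x y z : Fin n → ℂ) : cpair B (x + y) z = cpair B x z + cpair B y z := by
  simp only [cpair, ← Finset.sum_add_distrib, Pi.add_apply]
  exact Finset.sum_congr rfl fun i _ => Finset.sum_congr rfl fun j _ => by ring

lemma cpair_add_right (x y z : Fin n → ℂ) : cpair B x (y + z) = cpair B x y + cpair B x z := by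
  simp only [cpair, ← Finset.sum_add_distrib, Pi.add_apply]
  exact Finset.sum_congr rfl fun i _ => Finset.sum_congr rfl fun j _ => by ring

lemma cpair_smul_left (t : ℂ) (x y : Fin n → ℂ) : cpair B (t • x) y = t * cpair B x y := by
  simp only [cpair, Finset.mul_sum, Pi.smul_apply, smul_eq_mul]
  exact Finset.sum_congr rfl fun i _ => Finset.sum_congr rfl fun j _ => by ring

lemma cpair_smul_right (t : ℂ) (x y : Fin n → ℂ) : cpair B x (t • y) = t * cpair B x y := by
  simp only [cpair, Finset.mul_sum, Pi.smul_apply, smul_eq_mul]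
  exact Finset.sum_congr rfl fun i _ => Finset.sum_congr rfl fun j _ => by ring

lemma cpair_zero_left (x : Fin n → ℂ) : cpair B 0 x = 0 := by simp [cpair]

variable {B} in
lemma cpair_comm (hB : B.IsSymm) (x y : Fin n → ℂ) : cpair B x y = cpair B y x := by
  simp only [cpair]
  rw [Finset.sum_comm]
  refine Finset.sum_congr rfl fun i _ => Finset.sum_congr rfl fun j _ => ?_
  rw [hB.apply i j]; ring

lemma rpair_add_left (x y z : Fin n → ℝ) : rpair B (x + y) z = rpair B x z + rpair B y z := by
  simp only [rpair, ← Finset.sum_add_distrib, Pi.add_apply]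
  exact Finset.sum_congr rfl fun i _ => Finset.sum_congr rfl fun j _ => by ring

lemma rpair_add_right (x y z : Fin n → ℝ) : rpair B x (y + z) = rpair B x y + rpair B x z := by
  simp only [rpair, ← Finset.sum_add_distrib, Pi.add_apply]
  exact Finset.sum_congr rfl fun i _ => Finset.sum_congr rfl fun j _ => by ring

lemma rpair_smul_left (t : ℝ) (x y : Fin n → ℝ) : rpair B (t • x) y = t * rpair B x y := by
  simp only [rpair, Finset.mul_sum, Pi.smul_apply, smul_eq_mul]
  exact Finset.sum_congr rfl fun i _ => Finset.sum_congr rfl fun j _ => by ring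

lemma rpair_smul_right (t : ℝ) (x y : Fin n → ℝ) : rpair B x (t • y) = t * rpair B x y := by
  simp only [rpair, Finset.mul_sum, Pi.smul_apply, smul_eq_mul]
  exact Finset.sum_congr rfl fun i _ => Finset.sum_congr rfl fun j _ => by ring

lemma rpair_sub_left (x y z : Fin n → ℝ) : rpair B (x - y) z = rpair B x z - rpair B y z := by
  rw [sub_eq_add_neg, ← neg_one_smul ℝ y, rpair_add_left, rpair_smul_left]; ring

lemma rpair_sub_right (x y z : Fin n → ℝ) : rpair B x (y - z) = rpair B x y - rpair B x z := by
  rw [sub_eq_add_neg, ← neg_one_smul ℝ z, rpair_add_right, rpair_smul_right]; ring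

lemma rpair_zero_left (x : Fin n → ℝ) : rpair B 0 x = 0 := by simp [rpair]

variable {B} in
lemma rpair_comm (hB : B.IsSymm) (x y : Fin n → ℝ) : rpair B x y = rpair B y x := by
  simp only [rpair]
  rw [Finset.sum_comm]
  refine Finset.sum_congr rfl fun i _ => Finset.sum_congr rfl fun j _ => ?_
  rw [hB.apply i j]; ring

lemma rpair_eq_dotProduct (x y : Fin n → ℝ) :
    rpair B x y = x ⬝ᵥ (B.map (Int.cast : ℤ → ℝ)).mulVec y := by
  simp only [rpair, dotProduct, mulVec, Finset.mul_sum, Matrix.map_apply]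
  exact Finset.sum_congr rfl fun i _ => Finset.sum_congr rfl fun j _ => by ring

lemma cpair_eq_dotProduct (x y : Fin n → ℂ) :
    cpair B x y = x ⬝ᵥ (B.map (Int.cast : ℤ → ℂ)).mulVec y := by
  simp only [cpair, dotProduct, mulVec, Finset.mul_sum, Matrix.map_apply]
  exact Finset.sum_congr rfl fun i _ => Finset.sum_congr rfl fun j _ => by ring

/-- Integral pairing. -/
def zpair (B : Matrix (Fin n) (Fin n) ℤ) (x y : Fin n → ℤ) : ℤ := x ⬝ᵥ B.mulVec y

lemma zpair_self (x : Fin n → ℤ) : zpair B x x = qnorm B x := rfl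

lemma rpair_intR (x y : Fin n → ℤ) : rpair B (intR x) (intR y) = (zpair B x y : ℝ) := by
  simp only [rpair, intR, zpair, dotProduct, mulVec, Finset.mul_sum, Int.cast_sum, Int.cast_mul]
  exact Finset.sum_congr rfl fun i _ => Finset.sum_congr rfl fun j _ => by ring

lemma cpair_intC (x y : Fin n → ℤ) : cpair B (intC x) (intC y) = (zpair B x y : ℂ) := by
  simp only [cpair, intC, zpair, dotProduct, mulVec, Finset.mul_sum, Int.cast_sum, Int.cast_mul]
  exact Finset.sum_congr rfl fun i _ => Finset.sum_congr rfl fun j _ => by ring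

lemma rpair_intR_self (x : Fin n → ℤ) : rpair B (intR x) (intR x) = (qnorm B x : ℝ) :=
  rpair_intR B x x

lemma cpair_intC_self (x : Fin n → ℤ) : cpair B (intC x) (intC x) = (qnorm B x : ℂ) :=
  cpair_intC B x x

/-- Componentwise imaginary part. -/
def vim (z : Fin n → ℂ) : Fin n → ℝ := fun i => (z i).im

/-- Componentwise real part. -/
def vre (z : Fin n → ℂ) : Fin n → ℝ := fun i => (z i).re

/-- Real vectors as complex vectors. -/
def ofR (x : Fin n → ℝ) : Fin n → ℂ := fun i => (x i : ℂ)

lemma vim_add (z w : Fin n → ℂ) : vim (z + w) = vim z + vim w := by ext i; simp [vim]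
lemma vim_ofR (x : Fin n → ℝ) : vim (ofR x) = 0 := by ext i; simp [vim, ofR]
lemma vim_intC (x : Fin n → ℤ) : vim (intC x) = 0 := by ext i; simp [vim, intC]
lemma vim_smul_intC (s : ℂ) (x : Fin n → ℤ) : vim (s • intC x) = s.im • intR x := by
  ext i; simp [vim, intC, intR]
lemma vim_smul_ofR (s : ℂ) (x : Fin n → ℝ) : vim (s • ofR x) = s.im • x := by
  ext i; simp [vim, ofR]
lemma vim_zero : vim (0 : Fin n → ℂ) = 0 := by ext i; simp [vim]
lemma ofR_intR (x : Fin n → ℤ) : ofR (intR x) = intC x := by ext i; simp [ofR, intR, intC]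

lemma cpair_intC_im (x : Fin n → ℤ) (z : Fin n → ℂ) :
    (cpair B (intC x) z).im = rpair B (intR x) (vim z) := by
  simp only [cpair, rpair, Complex.im_sum, intC, intR, vim]
  refine Finset.sum_congr rfl fun i _ => Finset.sum_congr rfl fun j _ => ?_
  rw [show ((B i j : ℤ) : ℂ) * ((x i : ℤ) : ℂ) = (((B i j : ℝ) * (x i : ℝ) : ℝ) : ℂ) by
    push_cast; rfl]
  rw [Complex.im_ofReal_mul]

lemma cpair_ofR (x y : Fin n → ℝ) : cpair B (ofR x) (ofR y) = (rpair B x y : ℂ) := by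
  simp [cpair, rpair, ofR]

lemma cpair_intC_ofR (x : Fin n → ℤ) (y : Fin n → ℝ) :
    cpair B (intC x) (ofR y) = (rpair B (intR x) y : ℂ) := by
  rw [← ofR_intR, cpair_ofR]

end Pairings

section PosDef
variable {r : ℕ} {L : Matrix (Fin r) (Fin r) ℤ} (hL : IsEvenPosDef L)
include hL

lemma rpair_self_pos {x : Fin r → ℝ} (hx : x ≠ 0) : 0 < rpair L x x := by
  rw [rpair_eq_dotProduct]
  have := hL.2.2.dotProduct_mulVec_pos hx
  simpa using this

lemma rpair_self_nonneg (x : Fin r → ℝ) : 0 ≤ rpair L x x := by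
  by_cases hx : x = 0
  · simp [hx, rpair_zero_left]
  · exact (rpair_self_pos hL hx).le

end PosDef

section TubeSec
variable {r : ℕ} (L : Matrix (Fin r) (Fin r) ℤ)

/-- Half the Hermitian norm of the vector with tube coordinates `p = (τ, z, ω)`. -/
noncomputable def rho (p : ℂ × (Fin r → ℂ) × ℂ) : ℝ :=
  2 * p.1.im * p.2.2.im - rpair L (vim p.2.1) (vim p.2.1)

/-- The tube domain. -/
def Tube : Set (ℂ × (Fin r → ℂ) × ℂ) := {p | 0 < p.1.im ∧ 0 < rho L p}

/-- `f` is the restriction to the tube domain of a modular form of weight `k` which is invariant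
under the translations, the Heisenberg group, the swap of the two hyperbolic planes and the
standard unipotent of one copy of the modular group. -/
structure Jac (k : ℤ) (f : ℂ × (Fin r → ℂ) × ℂ → ℂ) : Prop where
  holo : DifferentiableOn ℂ f (Tube L)
  zero_off : ∀ p ∉ Tube L, f p = 0
  shift : ∀ τ z ω, f (τ + 1, z, ω) = f (τ, z, ω)
  trans : ∀ τ z ω (μ : Fin r → ℤ), f (τ, z + intC μ, ω) = f (τ, z, ω)
  swap : ∀ τ z ω, f (ω, z, τ) = f (τ, z, ω)
  heis : ∀ τ z ω (l : Fin r → ℤ),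
    f (τ, z + τ • intC l, ω + cpair L (intC l) z + (qnorm L l : ℂ) / 2 * τ) = f (τ, z, ω)
  unip : ∀ τ ω : ℂ, 0 < τ.im → 0 < ω.im →
    f (τ / (1 - τ), 0, ω) = (1 - τ) ^ k * f (τ, 0, ω)

/-- Zeros lie on hyperplanes orthogonal to vectors of norm `-2`. -/
def ZerosNormTwo (f : ℂ × (Fin r → ℂ) × ℂ → ℂ) : Prop :=
  ∀ τ z ω, (τ, z, ω) ∈ Tube L → f (τ, z, ω) = 0 → ∃ (a b c d : ℤ) (l : Fin r → ℤ),
    2 * a * b + 2 * c * d - qnorm L l = -2 ∧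
    (a : ℂ) + b * (-τ * ω + cpair L z z / 2) + c * ω + d * τ - cpair L (intC l) z = 0

variable {L}

lemma continuous_rho : Continuous (rho L) := by
  unfold rho rpair vim; fun_prop

lemma isOpen_tube : IsOpen (Tube L) :=
  (isOpen_lt continuous_const (Complex.continuous_im.comp continuous_fst)).inter
    (isOpen_lt continuous_const continuous_rho)

lemma rho_ofR (τ ω : ℂ) (x : Fin r → ℝ) : rho L (τ, ofR x, ω) = 2 * τ.im * ω.im := by
  simp [rho, vim_ofR, rpair_zero_left]

lemma rho_zero (τ ω : ℂ) : rho L (τ, 0, ω) = 2 * τ.im * ω.im := by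
  simp [rho, vim_zero, rpair_zero_left]

lemma mem_tube_zero {τ ω : ℂ} (h1 : 0 < τ.im) (h2 : 0 < ω.im) : (τ, 0, ω) ∈ Tube L :=
  ⟨h1, by rw [rho_zero]; positivity⟩

lemma mem_tube_ofR {τ ω : ℂ} (x : Fin r → ℝ) (h1 : 0 < τ.im) (h2 : 0 < ω.im) :
    (τ, ofR x, ω) ∈ Tube L :=
  ⟨h1, by rw [rho_ofR]; positivity⟩

lemma rho_swap (τ ω : ℂ) (z : Fin r → ℂ) : rho L (ω, z, τ) = rho L (τ, z, ω) := by
  simp [rho]; ring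

lemma Jac.shift' {k : ℤ} {f : ℂ × (Fin r → ℂ) × ℂ → ℂ} (hf : Jac L k f) (τ z ω) :
    f (τ, z, ω + 1) = f (τ, z, ω) := by
  rw [hf.swap, hf.shift, hf.swap]

lemma Jac.shift_int' {k : ℤ} {f : ℂ × (Fin r → ℂ) × ℂ → ℂ} (hf : Jac L k f) (τ z ω) (m : ℤ) :
    f (τ, z, ω + m) = f (τ, z, ω) := by
  have hp : Function.Periodic (fun w => f (τ, z, w)) (1 : ℂ) := fun w => hf.shift' τ z w
  simpa using hp.int_mul m ω

lemma Jac.swap_heis {k : ℤ} {f : ℂ × (Fin r → ℂ) × ℂ → ℂ} (hf : Jac L k f)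
    (τ z ω) (l : Fin r → ℤ) :
    f (τ + cpair L (intC l) z + (qnorm L l : ℂ) / 2 * ω, z + ω • intC l, ω) = f (τ, z, ω) := by
  rw [hf.swap, hf.heis, hf.swap]

section zeros
variable (hL : IsEvenPosDef L)
include hL

lemma qnorm_nonneg (l : Fin r → ℤ) : 0 ≤ qnorm L l := by
  have := rpair_self_nonneg hL (intR l)
  rw [rpair_intR_self] at this
  exact_mod_cast this

lemma qnorm_eq_zero {l : Fin r → ℤ} (h : qnorm L l = 0) : l = 0 := by
  by_contra hne
  have h0 : intR l ≠ 0 := fun h0 => hne <| by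
    ext i
    have := congrFun h0 i
    simpa [intR] using this
  have := rpair_self_pos hL h0
  rw [rpair_intR_self, h] at this
  simp at this

lemma rho_heis (τ z ω) (l : Fin r → ℤ) :
    rho L (τ, z + τ • intC l, ω + cpair L (intC l) z + (qnorm L l : ℂ) / 2 * τ)
      = rho L (τ, z, ω) := by
  have h1 : ((qnorm L l : ℂ) / 2 * τ).im = (qnorm L l : ℝ) / 2 * τ.im := by
    rw [show (qnorm L l : ℂ) / 2 = (((qnorm L l : ℝ) / 2 : ℝ) : ℂ) by push_cast; rfl]
    rw [Complex.im_ofReal_mul]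
  simp only [rho, vim_add, vim_smul_intC, Complex.add_im, h1, cpair_intC_im, rpair_add_left,
    rpair_add_right, rpair_smul_left, rpair_smul_right, rpair_intR_self]
  rw [rpair_comm hL.1 (vim z) (intR l)]
  ring

lemma tube_im_pos {τ z ω} (h : (τ, z, ω) ∈ Tube L) : 0 < ω.im := by
  obtain ⟨h1, h2⟩ := h
  simp only [rho] at h1 h2
  have := rpair_self_nonneg hL (vim z)
  by_contra hn
  push Not at hn
  nlinarith

lemma zero_ineq {τ z ω} {a b c d : ℤ} {l : Fin r → ℤ}
    (hn : 2 * a * b + 2 * c * d - qnorm L l = -2)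
    (he : (a : ℂ) + b * (-τ * ω + cpair L z z / 2) + c * ω + d * τ - cpair L (intC l) z = 0) :
    ((c : ℝ) - b * τ.re) ^ 2 * rho L (τ, z, ω) ≤ τ.im ^ 2 * (2 - b ^ 2 * rho L (τ, z, ω)) := by
  set x := vre z
  set y := vim z
  have hz : z = ofR x + Complex.I • ofR y := by
    ext i
    simp only [x, y, ofR, vre, vim, Pi.add_apply, Pi.smul_apply, smul_eq_mul]
    rw [mul_comm, Complex.re_add_im]
  have hzz : cpair L z z =
      ((rpair L x x - rpair L y y : ℝ) : ℂ) + (2 * rpair L x y : ℝ) * Complex.I := by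
    rw [hz]
    simp only [cpair_add_left, cpair_add_right, cpair_smul_left, cpair_smul_right, cpair_ofR]
    rw [rpair_comm hL.1 y x]
    push_cast
    linear_combination (rpair L y y : ℂ) * Complex.I_sq
  have hlz : cpair L (intC l) z =
      (rpair L (intR l) x : ℝ) + (rpair L (intR l) y : ℝ) * Complex.I := by
    rw [hz]
    simp only [cpair_add_right, cpair_smul_right, cpair_intC_ofR]
    ring
  rw [hzz, hlz] at he
  have hre := congrArg Complex.re he
  have him := congrArg Complex.im he
  simp at hre him
  have hn' : (2 * a * b + 2 * c * d - rpair L (intR l) (intR l) : ℝ) = -2 := by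
    rw [rpair_intR_self]; exact_mod_cast hn
  have hpos := rpair_self_nonneg hL
    (τ.im • (intR l - (b : ℝ) • x) - ((c : ℝ) - b * τ.re) • y)
  simp only [rpair_sub_left, rpair_sub_right, rpair_smul_left, rpair_smul_right] at hpos
  rw [rpair_comm hL.1 x (intR l), rpair_comm hL.1 y (intR l), rpair_comm hL.1 y x] at hpos
  change _ * (2 * τ.im * ω.im - rpair L y y) ≤ _ * (2 - _ * (2 * τ.im * ω.im - rpair L y y))
  linear_combination hpos - τ.im ^ 2 * hn' + 2 * b * τ.im ^ 2 * hre
    + 2 * τ.im * (c - b * τ.re) * him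

lemma zero_near_cusp {τ z ω} (hp : (τ, z, ω) ∈ Tube L) (h2 : 2 < rho L (τ, z, ω))
    (h3 : 2 * τ.im ^ 2 < rho L (τ, z, ω)) {a b c d : ℤ} {l : Fin r → ℤ}
    (hn : 2 * a * b + 2 * c * d - qnorm L l = -2)
    (he : (a : ℂ) + b * (-τ * ω + cpair L z z / 2) + c * ω + d * τ - cpair L (intC l) z = 0) :
    qnorm L l = 2 ∧ cpair L (intC l) z = a + d * τ := by
  have hi := zero_ineq hL hn he
  have hb : b = 0 := by
    by_contra hb
    have : (1 : ℝ) ≤ (b : ℝ) ^ 2 := by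
      exact_mod_cast (pow_pos (abs_pos.2 hb) 2 |>.trans_eq (sq_abs b))
    have h0 : 0 < τ.im ^ 2 := pow_pos hp.1 2
    have h4 : 2 < (b : ℝ) ^ 2 * rho L (τ, z, ω) := by nlinarith
    nlinarith [mul_nonneg (sq_nonneg ((c : ℝ) - b * τ.re)) hp.2.le]
  subst hb
  have hc : c = 0 := by
    by_contra hc
    have : (1 : ℝ) ≤ (c : ℝ) ^ 2 := by
      exact_mod_cast (pow_pos (abs_pos.2 hc) 2 |>.trans_eq (sq_abs c))
    simp at hi
    nlinarith [hp.2]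
  subst hc
  refine ⟨by linarith, ?_⟩
  simp at he
  linear_combination -he

lemma zero_real {τ ω} {x : Fin r → ℝ} (h1 : 0 < τ.im) (h1' : 0 < ω.im)
    (h2 : 2 < rho L (τ, ofR x, ω)) {a b c d : ℤ} {l : Fin r → ℤ}
    (hn : 2 * a * b + 2 * c * d - qnorm L l = -2)
    (he : (a : ℂ) + b * (-τ * ω + cpair L (ofR x) (ofR x) / 2) + c * ω + d * τ
      - cpair L (intC l) (ofR x) = 0) :
    (qnorm L l = 2 ∧ rpair L (intR l) x = a) ∨ ∃ m : ℤ, τ = ω + m := by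
  have hi := zero_ineq hL hn he
  have hb : b = 0 := by
    by_contra hb
    have : (1 : ℝ) ≤ (b : ℝ) ^ 2 := by
      exact_mod_cast (pow_pos (abs_pos.2 hb) 2 |>.trans_eq (sq_abs b))
    have h0 : 0 < τ.im ^ 2 := pow_pos h1 2
    have h4 : 2 < (b : ℝ) ^ 2 * rho L (τ, ofR x, ω) := by nlinarith
    nlinarith [mul_nonneg (sq_nonneg ((c : ℝ) - b * τ.re)) (by linarith : 0 ≤ rho L (τ, ofR x, ω))]
  subst hb
  rw [cpair_intC_ofR] at he
  have him := congrArg Complex.im he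
  have hre := congrArg Complex.re he
  simp at him hre hn
  have hq := qnorm_nonneg hL l
  have hcd : c * d ≤ 0 := by
    have : (c * d : ℝ) ≤ 0 := by
      have h : (c * d : ℝ) * ω.im = - (d ^ 2 * τ.im) := by linear_combination d * him
      by_contra hh
      push Not at hh
      nlinarith [mul_pos hh h1', mul_nonneg (sq_nonneg (d : ℝ)) h1.le]
    exact_mod_cast this
  have hev : 2 ∣ qnorm L l := hL.2.1 l
  have hn' : 2 * (c * d) - qnorm L l = -2 := by linarith
  rcases (by omega : c * d = 0 ∨ c * d = -1) with h | h
  · left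
    have hz : c = 0 ∧ d = 0 := by
      rcases mul_eq_zero.1 h with h | h <;> subst h <;> simp [h1.ne', h1'.ne'] at him ⊢ <;>
        exact him
    obtain ⟨rfl, rfl⟩ := hz
    refine ⟨by linarith, ?_⟩
    simp at hre; linarith
  · right
    have hl : l = 0 := qnorm_eq_zero hL (by linarith [mul_assoc 2 c d])
    subst hl
    have h0 : rpair L (intR 0) x = 0 := by
      rw [show (intR (0 : Fin r → ℤ)) = 0 by ext i; simp [intR], rpair_zero_left]
    rw [h0] at he
    rcases Int.eq_one_or_neg_one_of_mul_eq_neg_one h with h' | h' <;> subst h'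
    · have : d = -1 := by linarith
      subst this
      refine ⟨a, ?_⟩
      push_cast at he
      linear_combination -he
    · have : d = 1 := by linarith
      subst this
      refine ⟨-a, ?_⟩
      push_cast at he ⊢
      linear_combination he

end zeros
end TubeSec

section Koecher
variable {r : ℕ} {L : Matrix (Fin r) (Fin r) ℤ} {k : ℤ} {f : ℂ × (Fin r → ℂ) × ℂ → ℂ}

lemma Jac.trans_mul (hf : Jac L k f) (τ z ω) (l : Fin r → ℤ) (m : ℤ) :
    f (τ, z + (m : ℂ) • intC l, ω) = f (τ, z, ω) := by
  rw [← hf.trans τ z ω (m • l)]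
  congr 3
  ext i; simp [intC]

lemma intC_smul {n : ℕ} (m : ℤ) (l : Fin n → ℤ) : intC (m • l) = (m : ℂ) • intC l := by
  ext i; simp [intC]

lemma rho_trans (τ ω : ℂ) (z : Fin r → ℂ) (l : Fin r → ℤ) (m : ℤ) :
    rho L (τ, z + (m : ℂ) • intC l, ω) = rho L (τ, z, ω) := by
  rw [← intC_smul]
  simp [rho, vim_add, vim_intC]

lemma rho_add_int (τ ω : ℂ) (z : Fin r → ℂ) (m : ℤ) :
    rho L (τ, z, ω + m) = rho L (τ, z, ω) := by
  simp [rho]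

variable (hL : IsEvenPosDef L) (hf : Jac L k f)
include hL hf

lemma exists_reduced (τ : ℂ) (hτ : 0 < τ.im) (z : Fin r → ℂ) (s ω : ℂ) (l : Fin r → ℤ) :
    ∃ (α β : ℝ) (ω' : ℂ), α ∈ Set.Icc (0 : ℝ) 1 ∧ β ∈ Set.Icc (0 : ℝ) 1 ∧
      ω'.re ∈ Set.Icc (0 : ℝ) 1 ∧
      f (τ, z + s • intC l, ω) = f (τ, z + ((α : ℂ) + β * τ) • intC l, ω') ∧
      rho L (τ, z + s • intC l, ω) = rho L (τ, z + ((α : ℂ) + β * τ) • intC l, ω') := by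
  obtain ⟨a, b, hab⟩ : ∃ a b : ℝ, s = a + b * τ := by
    refine ⟨s.re - s.im / τ.im * τ.re, s.im / τ.im, ?_⟩
    apply Complex.ext <;> simp
    field_simp
  set l' : Fin r → ℤ := (-⌊b⌋) • l
  set ω1 := ω + cpair L (intC l') (z + s • intC l) + (qnorm L l' : ℂ) / 2 * τ
  have hicc : ∀ x : ℝ, Int.fract x ∈ Set.Icc (0 : ℝ) 1 := fun x =>
    ⟨Int.fract_nonneg x, (Int.fract_lt_one x).le⟩
  have e1 : z + (((Int.fract a : ℝ) : ℂ) + (Int.fract b : ℝ) * τ) • intC l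
      = z + s • intC l + τ • intC l' + ((-⌊a⌋ : ℤ) : ℂ) • intC l := by
    rw [intC_smul, hab]
    simp only [Int.fract]
    push_cast
    module
  refine ⟨Int.fract a, Int.fract b, ω1 + ((-⌊ω1.re⌋ : ℤ) : ℂ), hicc _, hicc _, ?_, ?_, ?_⟩
  · have : (ω1 + ((-⌊ω1.re⌋ : ℤ) : ℂ)).re = Int.fract ω1.re := by
      rw [Complex.add_re, Complex.intCast_re, Int.fract]; push_cast; ring
    rw [this]; exact hicc _
  · rw [e1, hf.shift_int', hf.trans_mul, hf.heis]
  · rw [e1, rho_add_int, rho_trans, rho_heis hL]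

lemma level_bound {K : Set (ℂ × (Fin r → ℂ))} (hK : IsCompact K) (hKp : ∀ p ∈ K, 0 < p.1.im)
    (l : Fin r → ℤ) {c : ℝ} (hc : 0 < c) :
    ∃ C : ℝ, ∀ p ∈ K, ∀ s ω : ℂ, rho L (p.1, p.2 + s • intC l, ω) = c →
      ‖f (p.1, p.2 + s • intC l, ω)‖ ≤ C := by
  let P : (ℂ × (Fin r → ℂ)) × ℝ × ℝ × ℝ → ℂ × (Fin r → ℂ) × ℂ := fun q =>
    (q.1.1, q.1.2 + ((q.2.1 : ℂ) + q.2.2.1 * q.1.1) • intC l,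
      (q.2.2.2 : ℂ) + (((c + rpair L (vim (q.1.2 + ((q.2.1 : ℂ) + q.2.2.1 * q.1.1) • intC l))
        (vim (q.1.2 + ((q.2.1 : ℂ) + q.2.2.1 * q.1.1) • intC l))) / (2 * q.1.1.im) : ℝ) : ℂ)
          * Complex.I)
  let A : Set ((ℂ × (Fin r → ℂ)) × ℝ × ℝ × ℝ) :=
    K ×ˢ (Set.Icc 0 1 ×ˢ (Set.Icc 0 1 ×ˢ Set.Icc 0 1))
  have hA : IsCompact A := hK.prod (isCompact_Icc.prod (isCompact_Icc.prod isCompact_Icc))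
  have hrho : ∀ q ∈ A, rho L (P q) = c := by
    intro q hq
    have := hKp _ hq.1
    simp only [rho, P]
    simp only [Complex.add_im, Complex.ofReal_im, Complex.im_ofReal_mul, Complex.I_im, mul_one,
      zero_add]
    field_simp
    ring
  have hPT : Set.MapsTo P A (Tube L) := fun q hq =>
    ⟨hKp _ hq.1, by rw [hrho q hq]; exact hc⟩
  have hPc : ContinuousOn P A := by
    have h0 : ∀ q ∈ A, 2 * q.1.1.im ≠ 0 := fun q hq => by have := hKp _ hq.1; positivity
    have h1 : Continuous fun q : (ℂ × (Fin r → ℂ)) × ℝ × ℝ × ℝ =>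
        q.1.2 + ((q.2.1 : ℂ) + q.2.2.1 * q.1.1) • intC l := by fun_prop
    have h2 : Continuous fun v : Fin r → ℂ => rpair L (vim v) (vim v) := by
      unfold rpair vim; fun_prop
    have h3 := h2.comp h1
    refine ContinuousOn.prodMk (by fun_prop) (ContinuousOn.prodMk (by fun_prop) ?_)
    refine ContinuousOn.add (by fun_prop) (ContinuousOn.mul ?_ continuousOn_const)
    refine Complex.continuous_ofReal.comp_continuousOn ?_
    exact ContinuousOn.div (continuous_const.add h3).continuousOn (by fun_prop) h0
  obtain ⟨C, hC⟩ := hA.exists_bound_of_continuousOn (hf.holo.continuousOn.comp hPc hPT)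
  refine ⟨C, fun p hp s ω hr => ?_⟩
  have hp0 := hKp p hp
  obtain ⟨α, β, ω', hα, hβ, hω, h1, h2⟩ := exists_reduced hL hf p.1 hp0 p.2 s ω l
  rw [h1]
  have h3 := hC (p, α, β, ω'.re) ⟨hp, hα, hβ, hω⟩
  suffices h : P (p, α, β, ω'.re) = (p.1, p.2 + ((α : ℂ) + β * p.1) • intC l, ω') by
    rwa [Function.comp, h] at h3
  simp only [P]
  congr 2
  rw [h2] at hr
  simp only [rho] at hr
  rw [← hr]
  apply Complex.ext
  · simp only [Complex.add_re, Complex.ofReal_re, Complex.re_ofReal_mul, Complex.I_re, mul_zero,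
      add_zero]
  · simp only [Complex.add_im, Complex.ofReal_im, Complex.im_ofReal_mul, Complex.I_im, mul_one,
      zero_add]
    field_simp
    ring

lemma koecher {K : Set (ℂ × (Fin r → ℂ))} (hK : IsCompact K) (hKp : ∀ p ∈ K, 0 < p.1.im)
    {l : Fin r → ℤ} (hl : l ≠ 0) {c : ℝ} (hc : 0 < c) :
    ∃ C : ℝ, ∀ p ∈ K, ∀ s ω : ℂ, c ≤ rho L (p.1, p.2 + s • intC l, ω) →
      ‖f (p.1, p.2 + s • intC l, ω)‖ ≤ C := by
  obtain ⟨C, hC⟩ := level_bound hL hf hK hKp l hc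
  refine ⟨C, fun p hp s0 ω0 hr => ?_⟩
  have hv := hKp p hp
  set v := p.1.im
  set z1 := p.2 + s0 • intC l with hz1
  set ρ0 := rho L (p.1, z1, ω0)
  have hq : 0 < qnorm L l := lt_of_le_of_ne (qnorm_nonneg hL l)
    fun h => hl (qnorm_eq_zero hL h.symm)
  set κ : ℝ := (qnorm L l : ℝ)
  have hκ : 0 < κ := Int.cast_pos.2 hq
  set a := rpair L (intR l) (vim z1)
  let γ : ℂ → ℂ × (Fin r → ℂ) × ℂ := fun s =>
    (p.1, z1 + s • intC l, ω0 + s * (a / v : ℝ) - Complex.I * s ^ 2 * (κ / (4 * v) : ℝ))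
  have hγ : ∀ s, rho L (γ s) = ρ0 - κ / 2 * ‖s‖ ^ 2 := by
    intro s
    have him : (ω0 + s * (a / v : ℝ) - Complex.I * s ^ 2 * (κ / (4 * v) : ℝ)).im
        = ω0.im + s.im * (a / v) - (s.re ^ 2 - s.im ^ 2) * (κ / (4 * v)) := by
      rw [Complex.sub_im, Complex.add_im, Complex.im_mul_ofReal, Complex.im_mul_ofReal]
      simp [pow_two]
    simp only [γ, rho, ρ0, vim_add, vim_smul_intC, him, rpair_add_left, rpair_add_right,
      rpair_smul_left, rpair_smul_right, rpair_intR_self]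
    rw [rpair_comm hL.1 (vim z1) (intR l), ← Complex.normSq_eq_norm_sq, Complex.normSq_apply]
    change 2 * v * (ω0.im + s.im * (a / v) - (s.re ^ 2 - s.im ^ 2) * (κ / (4 * v))) -
      (rpair L (vim z1) (vim z1) + s.im * a + s.im * (a + s.im * κ)) =
      2 * v * ω0.im - rpair L (vim z1) (vim z1) - κ / 2 * (s.re * s.re + s.im * s.im)
    field_simp
    ring
  rcases hr.eq_or_lt with h | hlt
  · exact hC p hp s0 ω0 h.symm
  set R := Real.sqrt (2 * (ρ0 - c) / κ)
  have hRpos : 0 < R := Real.sqrt_pos.2 (by have : 0 < ρ0 - c := sub_pos.2 hlt; positivity)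
  have hR2 : κ / 2 * R ^ 2 = ρ0 - c := by
    rw [Real.sq_sqrt (by have : 0 < ρ0 - c := sub_pos.2 hlt; positivity)]
    field_simp
  have hmaps : Set.MapsTo γ (Metric.closedBall 0 R) (Tube L) := by
    intro s hs
    refine ⟨hv, ?_⟩
    rw [hγ]
    have : ‖s‖ ^ 2 ≤ R ^ 2 := by
      have := mem_closedBall_zero_iff.1 hs
      gcongr
    nlinarith
  have hdiff : DifferentiableOn ℂ (f ∘ γ) (Metric.closedBall 0 R) :=
    hf.holo.comp (by fun_prop : Differentiable ℂ γ).differentiableOn hmaps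
  have hdc : DiffContOnCl ℂ (f ∘ γ) (Metric.ball 0 R) := by
    apply DifferentiableOn.diffContOnCl
    rwa [closure_ball _ hRpos.ne']
  have := Complex.norm_le_of_forall_mem_frontier_norm_le (U := Metric.ball (0 : ℂ) R)
    (f := f ∘ γ) (C := C) (z := 0) Metric.isBounded_ball hdc ?_
      (subset_closure (by simpa using hRpos))
  · simpa [γ] using this
  · intro s hs
    rw [frontier_ball _ hRpos.ne', mem_sphere_zero_iff_norm] at hs
    have h1 : rho L (γ s) = c := by rw [hγ, hs, hR2]; ring
    have h2 : γ s = (p.1, p.2 + (s0 + s) • intC l, (γ s).2.2) := by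
      simp only [γ, hz1]
      rw [add_smul, add_assoc]
    simp only [Function.comp]
    rw [h2] at h1 ⊢
    exact hC p hp _ _ h1

end Koecher

open Function.Periodic Filter Topology

section Cusp
variable {h : ℂ → ℂ} (hp : Function.Periodic h ((1 : ℝ) : ℂ))

lemma mem_comap_im_atTop (c : ℝ) : ∀ᶠ w in comap Complex.im atTop, c < w.im :=
  (eventually_gt_atTop c).comap _

instance neBot_comap_im_atTop : NeBot (comap Complex.im atTop) := by
  refine comap_neBot fun s hs => ?_
  obtain ⟨a, ha⟩ := mem_atTop_sets.1 hs
  exact ⟨⟨0, a⟩, ha a le_rfl⟩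

lemma bounded_of_forall {B c : ℝ} (hb : ∀ w : ℂ, c < w.im → ‖h w‖ ≤ B) :
    BoundedAtFilter (comap Complex.im atTop) h := by
  refine Asymptotics.IsBigO.of_bound B ?_
  filter_upwards [mem_comap_im_atTop c] with w hw
  simpa using hb w hw

include hp

lemma cusp_differentiableOn {c : ℝ} (hd : ∀ w : ℂ, c < w.im → DifferentiableAt ℂ h w)
    (hb : BoundedAtFilter (comap Complex.im atTop) h) :
    DifferentiableOn ℂ (cuspFunction 1 h) (Metric.ball 0 (Real.exp (-2 * Real.pi * c))) := by
  intro q hq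
  apply DifferentiableAt.differentiableWithinAt
  by_cases h0 : q = 0
  · rw [h0]
    refine differentiableAt_cuspFunction_zero one_pos hp ?_ hb
    filter_upwards [mem_comap_im_atTop c] with w hw using hd w hw
  · rw [← qParam_right_inv one_ne_zero h0]
    refine differentiableAt_cuspFunction one_ne_zero hp (hd _ ?_)
    rw [← norm_qParam_lt_iff one_pos, qParam_right_inv one_ne_zero h0]
    simpa using hq

lemma cusp_tendsto {c : ℝ} (hd : ∀ w : ℂ, c < w.im → DifferentiableAt ℂ h w)
    (hb : BoundedAtFilter (comap Complex.im atTop) h) :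
    Tendsto h (comap Complex.im atTop) (𝓝 (cuspFunction 1 h 0)) := by
  refine tendsto_at_I_inf one_pos hp ?_ hb
  filter_upwards [mem_comap_im_atTop c] with w hw using hd w hw

lemma cusp_norm_le {B c : ℝ} (hd : ∀ w : ℂ, c < w.im → DifferentiableAt ℂ h w)
    (hb : ∀ w : ℂ, c < w.im → ‖h w‖ ≤ B) : ‖cuspFunction 1 h 0‖ ≤ B := by
  refine le_of_tendsto (cusp_tendsto hp hd (bounded_of_forall hb)).norm ?_
  filter_upwards [mem_comap_im_atTop c] with w hw using hb w hw

lemma cusp_approx {B c : ℝ} (hd : ∀ w : ℂ, c < w.im → DifferentiableAt ℂ h w)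
    (hb : ∀ w : ℂ, c < w.im → ‖h w‖ ≤ B) {w : ℂ} (hw : c < w.im) :
    ‖h w - cuspFunction 1 h 0‖ ≤ 2 * B * Real.exp (-2 * Real.pi * (w.im - c)) := by
  have h0 := cusp_norm_le hp hd hb
  have hmaps : Set.MapsTo (cuspFunction 1 h) (Metric.ball 0 (Real.exp (-2 * Real.pi * c)))
      (Metric.closedBall (cuspFunction 1 h 0) (2 * B)) := by
    intro q hq
    rw [mem_closedBall_iff_norm]
    by_cases hq0 : q = 0
    · subst hq0
      have := (norm_nonneg _).trans h0
      simpa using this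
    · have h1 : c < (invQParam 1 q).im := by
        rw [← norm_qParam_lt_iff one_pos, qParam_right_inv one_ne_zero hq0]
        simpa using hq
      have h2 := hb _ h1
      rw [← cuspFunction_eq_of_nonzero 1 h hq0] at h2
      exact (norm_sub_le _ _).trans (by linarith)
  have hwb : qParam 1 w ∈ Metric.ball (0 : ℂ) (Real.exp (-2 * Real.pi * c)) := by
    have := (norm_qParam_lt_iff one_pos c w).2 hw
    simpa using this
  have := Complex.dist_le_div_mul_dist_of_mapsTo_ball
    (cusp_differentiableOn hp hd (bounded_of_forall hb)) hmaps hwb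
  rw [eq_cuspFunction one_ne_zero hp, dist_eq_norm, dist_zero_right, norm_qParam] at this
  refine this.trans_eq ?_
  rw [div_mul_eq_mul_div, mul_div_assoc, ← Real.exp_sub]
  congr 2; ring

lemma norm_le_of_im_le {B c y : ℝ} (hc : c < y)
    (hd : ∀ w : ℂ, c < w.im → DifferentiableAt ℂ h w)
    (hb : BoundedAtFilter (comap Complex.im atTop) h)
    (hy : ∀ w : ℂ, w.im = y → ‖h w‖ ≤ B) {w : ℂ} (hw : y ≤ w.im) : ‖h w‖ ≤ B := by
  have hpos : Real.exp (-2 * Real.pi * y) ≠ 0 := (Real.exp_pos _).ne'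
  have hsub : Metric.closedBall (0 : ℂ) (Real.exp (-2 * Real.pi * y))
      ⊆ Metric.ball 0 (Real.exp (-2 * Real.pi * c)) :=
    Metric.closedBall_subset_ball (Real.exp_lt_exp.2 (by nlinarith [Real.pi_pos]))
  have hdc : DiffContOnCl ℂ (cuspFunction 1 h) (Metric.ball 0 (Real.exp (-2 * Real.pi * y))) := by
    apply DifferentiableOn.diffContOnCl
    rw [closure_ball _ hpos]
    exact (cusp_differentiableOn hp hd hb).mono hsub
  have hin : qParam 1 w ∈ closure (Metric.ball (0 : ℂ) (Real.exp (-2 * Real.pi * y))) := by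
    rw [closure_ball _ hpos, mem_closedBall_zero_iff, norm_qParam]
    apply Real.exp_le_exp.2
    nlinarith [Real.pi_pos]
  have := Complex.norm_le_of_forall_mem_frontier_norm_le Metric.isBounded_ball hdc (C := B) ?_ hin
  · rwa [eq_cuspFunction one_ne_zero hp] at this
  · intro q hq
    rw [frontier_ball _ hpos, mem_sphere_zero_iff_norm] at hq
    have hq0 : q ≠ 0 := norm_ne_zero_iff.1 (hq ▸ hpos)
    rw [cuspFunction_eq_of_nonzero 1 h hq0]
    apply hy
    have h1 := qParam_right_inv one_ne_zero hq0
    rw [← h1, norm_qParam, Real.exp_eq_exp] at hq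
    have := Real.pi_pos
    have h2 : -2 * Real.pi ≠ 0 := by simp [this.ne']
    exact mul_left_cancel₀ h2 (by simpa using hq)

lemma exists_zero_of_norm_le {δ c y : ℝ} (hc : c < y)
    (hd : ∀ w : ℂ, c < w.im → DifferentiableAt ℂ h w)
    (hb : BoundedAtFilter (comap Complex.im atTop) h)
    (hy : ∀ w : ℂ, w.im = y → δ ≤ ‖h w‖) (h0 : ‖cuspFunction 1 h 0‖ < δ)
    (hne : cuspFunction 1 h 0 ≠ 0) : ∃ w : ℂ, y < w.im ∧ h w = 0 := by
  by_contra hcon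
  push Not at hcon
  have hpos : Real.exp (-2 * Real.pi * y) ≠ 0 := (Real.exp_pos _).ne'
  have hδ : 0 < δ := (norm_nonneg _).trans_lt h0
  have hsub : Metric.closedBall (0 : ℂ) (Real.exp (-2 * Real.pi * y))
      ⊆ Metric.ball 0 (Real.exp (-2 * Real.pi * c)) :=
    Metric.closedBall_subset_ball (Real.exp_lt_exp.2 (by nlinarith [Real.pi_pos]))
  have hbd : ∀ q ∈ Metric.sphere (0 : ℂ) (Real.exp (-2 * Real.pi * y)),
      δ ≤ ‖cuspFunction 1 h q‖ := by
    intro q hq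
    rw [mem_sphere_zero_iff_norm] at hq
    have hq0 : q ≠ 0 := norm_ne_zero_iff.1 (hq ▸ hpos)
    rw [cuspFunction_eq_of_nonzero 1 h hq0]
    apply hy
    have h1 := qParam_right_inv one_ne_zero hq0
    rw [← h1, norm_qParam, Real.exp_eq_exp] at hq
    have := Real.pi_pos
    have h2 : -2 * Real.pi ≠ 0 := by simp [this.ne']
    exact mul_left_cancel₀ h2 (by simpa using hq)
  have hnz : ∀ q ∈ Metric.closedBall (0 : ℂ) (Real.exp (-2 * Real.pi * y)),
      cuspFunction 1 h q ≠ 0 := by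
    intro q hq hq0
    rcases (mem_closedBall_zero_iff.1 hq).lt_or_eq with hlt | heq
    · by_cases hz : q = 0
      · exact hne (hz ▸ hq0)
      · refine hcon (invQParam 1 q) ?_ ?_
        · rw [← norm_qParam_lt_iff one_pos, qParam_right_inv one_ne_zero hz]
          simpa using hlt
        · rw [← cuspFunction_eq_of_nonzero 1 h hz, hq0]
    · have := hbd q (mem_sphere_zero_iff_norm.2 heq)
      rw [hq0, norm_zero] at this
      linarith
  have hdc : DiffContOnCl ℂ (fun q => (cuspFunction 1 h q)⁻¹)
      (Metric.ball 0 (Real.exp (-2 * Real.pi * y))) := by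
    apply DifferentiableOn.diffContOnCl
    rw [closure_ball _ hpos]
    exact ((cusp_differentiableOn hp hd hb).mono hsub).inv hnz
  have := Complex.norm_le_of_forall_mem_frontier_norm_le Metric.isBounded_ball hdc (C := δ⁻¹)
    (z := 0) ?_ (subset_closure (Metric.mem_ball_self (Real.exp_pos _)))
  · rw [norm_inv, inv_le_inv₀ (norm_pos_iff.2 hne) hδ] at this
    linarith
  · intro q hq
    rw [frontier_ball _ hpos] at hq
    have h1 := hbd q hq
    rw [norm_inv]
    exact inv_anti₀ hδ h1

end Cusp

section Fzero
variable {r : ℕ} {L : Matrix (Fin r) (Fin r) ℤ} {k : ℤ} {f : ℂ × (Fin r → ℂ) × ℂ → ℂ}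

/-- The value of `f` at the zero-dimensional cusp `ω → i∞`. -/
noncomputable def fzero (f : ℂ × (Fin r → ℂ) × ℂ → ℂ) (τ : ℂ) (z : Fin r → ℂ) : ℂ :=
  cuspFunction 1 (fun ω => f (τ, z, ω)) 0

lemma Jac.periodic (hf : Jac L k f) (τ : ℂ) (z : Fin r → ℂ) :
    Function.Periodic (fun ω => f (τ, z, ω)) ((1 : ℝ) : ℂ) := by
  intro ω
  simpa using hf.shift' τ z ω

lemma Jac.periodic_fst (hf : Jac L k f) (z : Fin r → ℂ) (ω : ℂ) :
    Function.Periodic (fun τ => f (τ, z, ω)) ((1 : ℝ) : ℂ) := by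
  intro τ
  simpa using hf.shift τ z ω

lemma Jac.differentiableAt (hf : Jac L k f) {γ : ℂ → ℂ × (Fin r → ℂ) × ℂ} {s : ℂ}
    (hγ : DifferentiableAt ℂ γ s) (hs : γ s ∈ Tube L) : DifferentiableAt ℂ (fun t => f (γ t)) s :=
  (hf.holo.differentiableAt (isOpen_tube.mem_nhds hs)).comp s hγ

/-- The imaginary part of `ω` for which `rho` equals `c`. -/
noncomputable def height (L : Matrix (Fin r) (Fin r) ℤ) (c : ℝ) (τ : ℂ) (z : Fin r → ℂ) : ℝ :=
  (c + rpair L (vim z) (vim z)) / (2 * τ.im)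

lemma lt_rho_iff {τ : ℂ} (hτ : 0 < τ.im) {z : Fin r → ℂ} {ω : ℂ} {c : ℝ} :
    c < rho L (τ, z, ω) ↔ height L c τ z < ω.im := by
  rw [height, div_lt_iff₀ (by positivity)]
  simp only [rho]
  constructor <;> intro h <;> linarith

variable (hf : Jac L k f)
include hf

lemma Jac.differentiableAt_snd {τ : ℂ} (hτ : 0 < τ.im) {z : Fin r → ℂ} {c : ℝ} (hc : 0 ≤ c) {ω : ℂ}
    (h : height L c τ z < ω.im) : DifferentiableAt ℂ (fun ω => f (τ, z, ω)) ω :=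
  hf.differentiableAt (by fun_prop) ⟨hτ, hc.trans_lt ((lt_rho_iff hτ).2 h)⟩

variable (hL : IsEvenPosDef L) {l : Fin r → ℤ} (hl : l ≠ 0)
include hL hl

lemma Jac.bounded_line {τ : ℂ} (hτ : 0 < τ.im) (z : Fin r → ℂ) {c : ℝ} (hc : 0 < c) :
    ∃ C, ∀ s ω : ℂ, c ≤ rho L (τ, z + s • intC l, ω) → ‖f (τ, z + s • intC l, ω)‖ ≤ C := by
  obtain ⟨C, hC⟩ := koecher hL hf (K := {(τ, z)}) isCompact_singleton (by simpa) hl hc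
  exact ⟨C, fun s ω h => hC _ rfl s ω h⟩

lemma Jac.bounded_snd {τ : ℂ} (hτ : 0 < τ.im) (z : Fin r → ℂ) :
    BoundedAtFilter (comap Complex.im atTop) (fun ω => f (τ, z, ω)) := by
  obtain ⟨C, hC⟩ := hf.bounded_line hL hl hτ z one_pos
  refine bounded_of_forall (B := C) (c := height L 1 τ z) fun w hw => ?_
  simpa using hC 0 w (by simpa using ((lt_rho_iff hτ).2 hw).le)

lemma fzero_tendsto {τ : ℂ} (hτ : 0 < τ.im) (z : Fin r → ℂ) :
    Tendsto (fun ω => f (τ, z, ω)) (comap Complex.im atTop) (𝓝 (fzero f τ z)) :=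
  cusp_tendsto (hf.periodic τ z) (fun _ hw => hf.differentiableAt_snd hτ zero_le_one hw)
    (hf.bounded_snd hL hl hτ z)

lemma fzero_approx {K : Set (ℂ × (Fin r → ℂ))} (hK : IsCompact K) (hKp : ∀ p ∈ K, 0 < p.1.im) :
    ∃ C J : ℝ, ∀ p ∈ K, ∀ ω : ℂ, J < ω.im → (p.1, p.2, ω) ∈ Tube L ∧
      ‖f (p.1, p.2, ω) - fzero f p.1 p.2‖ ≤ C * Real.exp (-2 * Real.pi * ω.im) := by
  obtain ⟨C, hC⟩ := koecher hL hf hK hKp hl one_pos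
  have hcont : ContinuousOn (fun p : ℂ × (Fin r → ℂ) => height L 1 p.1 p.2) K := by
    have h2 : Continuous fun v : Fin r → ℂ => rpair L (vim v) (vim v) := by
      unfold rpair vim; fun_prop
    have h3 := h2.comp (continuous_snd (X := ℂ))
    unfold height
    refine ContinuousOn.div (continuous_const.add h3).continuousOn (by fun_prop) ?_
    intro p hp
    have := hKp p hp
    positivity
  obtain ⟨J, hJ⟩ := hK.bddAbove_image hcont
  refine ⟨2 * |C| * Real.exp (2 * Real.pi * J), J, fun p hp ω hω => ?_⟩
  have hv := hKp p hp
  have hJp : height L 1 p.1 p.2 ≤ J := hJ ⟨p, hp, rfl⟩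
  have hh : height L 1 p.1 p.2 < ω.im := hJp.trans_lt hω
  refine ⟨⟨hv, one_pos.trans ((lt_rho_iff hv).2 hh)⟩, ?_⟩
  have := cusp_approx (hf.periodic p.1 p.2) (B := |C|) (c := height L 1 p.1 p.2)
    (fun w hw => hf.differentiableAt_snd hv zero_le_one hw)
    (fun w hw => (le_abs_self C).trans' <| by
      simpa using hC p hp 0 w (by simpa using ((lt_rho_iff hv).2 hw).le)) hh
  refine this.trans ?_
  rw [mul_assoc (2 * |C|), ← Real.exp_add]
  gcongr
  nlinarith [Real.pi_pos]

lemma fzero_differentiableAt {γ : ℂ → ℂ × (Fin r → ℂ)} {U : Set ℂ} (hU : IsOpen U)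
    (hγ : DifferentiableOn ℂ γ U) (hpos : ∀ s ∈ U, 0 < (γ s).1.im) {s : ℂ} (hs : s ∈ U) :
    DifferentiableAt ℂ (fun s => fzero f (γ s).1 (γ s).2) s := by
  obtain ⟨ε, hε, hball⟩ := Metric.isOpen_iff.1 hU s hs
  set S := Metric.closedBall s (ε / 2)
  have hSU : S ⊆ U := (Metric.closedBall_subset_ball (by linarith)).trans hball
  obtain ⟨C, J, hCJ⟩ := fzero_approx hf hL hl
    ((isCompact_closedBall s (ε / 2)).image_of_continuousOn (hγ.continuousOn.mono hSU))
    (by rintro _ ⟨t, ht, rfl⟩; exact hpos t (hSU ht))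
  have hev : ∀ᶠ j : ℝ in atTop, J < j := eventually_gt_atTop J
  have hlim : TendstoUniformlyOn (fun (j : ℝ) t => f ((γ t).1, (γ t).2, j * Complex.I))
      (fun t => fzero f (γ t).1 (γ t).2) atTop S := by
    have h0 : Tendsto (fun j : ℝ => C * Real.exp (-2 * Real.pi * j)) atTop (𝓝 0) := by
      rw [← mul_zero C]
      refine Tendsto.const_mul C (Real.tendsto_exp_atBot.comp ?_)
      exact tendsto_id.const_mul_atTop_of_neg (by linarith [Real.pi_pos])
    rw [Metric.tendstoUniformlyOn_iff]
    intro δ hδ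
    filter_upwards [hev, h0.eventually (gt_mem_nhds hδ)] with j hj hj' t ht
    rw [dist_comm, dist_eq_norm]
    have := (hCJ (γ t) ⟨t, ht, rfl⟩ (j * Complex.I) (by simpa using hj)).2
    simp only [Complex.im_ofReal_mul, Complex.I_im, mul_one] at this
    exact this.trans_lt hj'
  have hdiff : DifferentiableOn ℂ (fun t => fzero f (γ t).1 (γ t).2) (Metric.ball s (ε / 2)) := by
    refine (hlim.mono Metric.ball_subset_closedBall).tendstoLocallyUniformlyOn.differentiableOn
      ?_ Metric.isOpen_ball
    filter_upwards [hev] with j hj t ht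
    have htS := Metric.ball_subset_closedBall ht
    have hg := hγ.differentiableAt (hU.mem_nhds (hSU htS))
    refine (hf.differentiableAt (γ := fun t => ((γ t).1, (γ t).2, (j : ℂ) * Complex.I)) ?_
      (hCJ (γ t) ⟨t, htS, rfl⟩ _ (by simpa using hj)).1).differentiableWithinAt
    exact hg.fst.prodMk (hg.snd.prodMk (differentiableAt_const _))
  exact hdiff.differentiableAt (Metric.ball_mem_nhds s (by linarith))

lemma fzero_line {τ : ℂ} (hτ : 0 < τ.im) (z : Fin r → ℂ) (s : ℂ) :
    fzero f τ (z + s • intC l) = fzero f τ z := by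
  obtain ⟨C, hC⟩ := hf.bounded_line hL hl hτ z one_pos
  have hd : Differentiable ℂ (fun s : ℂ => fzero f τ (z + s • intC l)) := fun s =>
    fzero_differentiableAt hf hL hl (γ := fun s => (τ, z + s • intC l)) isOpen_univ
      (by fun_prop) (fun _ _ => hτ) (Set.mem_univ s)
  have hb : Bornology.IsBounded (Set.range fun s : ℂ => fzero f τ (z + s • intC l)) := by
    refine (Metric.isBounded_closedBall (x := (0 : ℂ)) (r := C)).subset ?_
    rintro _ ⟨s, rfl⟩
    rw [mem_closedBall_zero_iff]
    exact cusp_norm_le (hf.periodic _ _) (c := height L 1 τ (z + s • intC l))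
      (fun w hw => hf.differentiableAt_snd hτ zero_le_one hw)
      (fun w hw => hC s w ((lt_rho_iff hτ).2 hw).le)
  simpa using hd.apply_eq_apply_of_bounded hb s 0

omit hl in
lemma fzero_eq {τ : ℂ} (hτ : 0 < τ.im) (z : Fin r → ℂ) : fzero f τ z = fzero f τ 0 := by
  have hz : ∀ S : Finset (Fin r),
      fzero f τ (∑ i ∈ S, z i • intC (Pi.single i 1)) = fzero f τ 0 := by
    intro S
    induction S using Finset.induction_on with
    | empty => simp
    | insert i S hi ih =>
      rw [Finset.sum_insert hi, add_comm, fzero_line hf hL (by simp) hτ, ih]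
  rw [← hz Finset.univ]
  congr 1
  ext j
  simp [intC, Pi.single_apply]

lemma fzero_zero_differentiableAt {τ : ℂ} (hτ : 0 < τ.im) :
    DifferentiableAt ℂ (fun τ => fzero f τ 0) τ :=
  fzero_differentiableAt hf hL hl (γ := fun τ => (τ, 0)) (U := {τ | 0 < τ.im})
    (isOpen_lt continuous_const Complex.continuous_im) (by fun_prop) (fun _ h => h) hτ

omit hL hl in
lemma fzero_add_one (τ : ℂ) (z : Fin r → ℂ) : fzero f (τ + 1) z = fzero f τ z := by
  simp only [fzero, hf.shift]

omit hL hl in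
lemma Jac.inversion {τ ω : ℂ} (hτ : 0 < τ.im) (hω : 0 < ω.im) :
    f (-1 / τ, 0, ω) = (-τ) ^ k * f (τ, 0, ω) := by
  have h0 : τ ≠ 0 := by rintro rfl; simp at hτ
  have := hf.unip (τ + 1) ω (by simpa using hτ) hω
  rw [hf.shift] at this
  rw [show (1 : ℂ) - (τ + 1) = -τ by ring] at this
  rw [← this, ← hf.shift ((τ + 1) / -τ)]
  congr 2
  field_simp
  ring

lemma fzero_inversion {τ : ℂ} (hτ : 0 < τ.im) :
    fzero f (-1 / τ) 0 = (-τ) ^ k * fzero f τ 0 := by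
  have hτ' : 0 < (-1 / τ).im := by
    rw [neg_div, one_div, Complex.neg_im, Complex.inv_im, neg_div, neg_neg]
    exact div_pos hτ (Complex.normSq_pos.2 (by rintro rfl; simp at hτ))
  refine tendsto_nhds_unique (fzero_tendsto hf hL hl hτ' 0) ?_
  refine ((fzero_tendsto hf hL hl hτ 0).const_mul _).congr' ?_
  filter_upwards [mem_comap_im_atTop 0] with ω hω
  rw [hf.inversion hτ hω]

omit hL hl in
lemma Jac.differentiableAt_fst {τ ω : ℂ} (hτ : 0 < τ.im) (hω : 0 < ω.im) :
    DifferentiableAt ℂ (fun τ => f (τ, 0, ω)) τ :=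
  hf.differentiableAt (by fun_prop) (mem_tube_zero hτ hω)

lemma Jac.bounded_fst {ω : ℂ} (hω : 0 < ω.im) (z : Fin r → ℂ) :
    BoundedAtFilter (comap Complex.im atTop) (fun τ => f (τ, z, ω)) := by
  simpa only [hf.swap _ _ ω] using hf.bounded_snd hL hl hω z

lemma Jac.bounded_slice : ∃ C, ∀ τ ω : ℂ, 1 ≤ τ.im → 1 ≤ ω.im → ‖f (τ, 0, ω)‖ ≤ C := by
  obtain ⟨C, hC⟩ := koecher hL hf
    (K := (fun x : ℝ => ((x : ℂ) + Complex.I, (0 : Fin r → ℂ))) '' Set.Icc 0 1)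
    (isCompact_Icc.image (by fun_prop)) (by rintro _ ⟨x, -, rfl⟩; simp) hl one_pos
  refine ⟨C, fun τ ω hτ hω => ?_⟩
  have hω0 : 0 < ω.im := by linarith
  refine norm_le_of_im_le (hf.periodic_fst 0 ω) (c := 1 / 2) (y := 1) (by norm_num)
    (fun w hw => hf.differentiableAt_fst (by linarith) hω0) (hf.bounded_fst hL hl hω0 0) ?_ hτ
  intro w hw
  have hper : f (w, 0, ω) = f (((Int.fract w.re : ℝ) : ℂ) + Complex.I, 0, ω) := by
    have h1 := (hf.periodic_fst 0 ω).int_mul (-⌊w.re⌋) w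
    rw [← h1]
    congr 2
    apply Complex.ext
    · simp [Int.fract, -Int.self_sub_floor]; ring
    · simp [hw]
  rw [hper]
  have := hC (((Int.fract w.re : ℝ) : ℂ) + Complex.I, 0)
    ⟨Int.fract w.re, ⟨Int.fract_nonneg _, (Int.fract_lt_one _).le⟩, rfl⟩ 0 ω ?_
  · simpa using this
  · simp only [zero_smul, add_zero, rho_zero]
    simp
    linarith

lemma fzero_bounded : ∃ C, ∀ τ : ℂ, 1 ≤ τ.im → ‖fzero f τ 0‖ ≤ C := by
  obtain ⟨C, hC⟩ := hf.bounded_slice hL hl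
  refine ⟨C, fun τ hτ => ?_⟩
  refine le_of_tendsto (fzero_tendsto hf hL hl (by linarith) 0).norm ?_
  filter_upwards [mem_comap_im_atTop 1] with ω hω using hC τ ω hτ hω.le

end Fzero

section Lift
variable {A : Type*} [TopologicalSpace A] [SimplyConnectedSpace A] [LocallyPathConnectedSpace A]

lemma existsUnique_log {g : A → ℂ} (hg : Continuous g) (hne : ∀ a, g a ≠ 0) (a₀ : A) {e₀ : ℂ}
    (he : Complex.exp e₀ = g a₀) :
    ∃! F : C(A, ℂ), F a₀ = e₀ ∧ Complex.exp ∘ F = g :=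
  Complex.isCoveringMapOn_exp.existsUnique_continuousMap_lifts (f := ⟨g, hg⟩) he
    (fun a => by simpa using hne a)

lemma log_unique {F G : A → ℂ} (hF : Continuous F) (hG : Continuous G)
    (h : ∀ a, Complex.exp (F a) = Complex.exp (G a)) (a₀ : A) (a : A) :
    F a = G a + (F a₀ - G a₀) := by
  have h1 : Complex.exp (F a₀ - G a₀) = 1 := by
    rw [Complex.exp_sub, h, div_self (Complex.exp_ne_zero _)]
  have hu := existsUnique_log (Complex.continuous_exp.comp hF)
    (fun a => Complex.exp_ne_zero (F a)) a₀ rfl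
  have e := hu.unique (y₁ := ⟨F, hF⟩) (y₂ := ⟨fun a => G a + (F a₀ - G a₀), by fun_prop⟩)
    ⟨rfl, rfl⟩ ⟨by simp, by ext a; simp [Complex.exp_add, h1, h]⟩
  exact congrArg (fun K : C(A, ℂ) => K a) e

lemma log_translate {g G : A → ℂ} (hG : Continuous G) (h : ∀ a, Complex.exp (G a) = g a)
    {T : A → A} (hT : Continuous T) (hgT : ∀ a, g (T a) = g a) :
    ∃ c, ∀ a, G (T a) = G a + c := by
  obtain ⟨a₀⟩ : Nonempty A := inferInstance
  exact ⟨_, fun a => log_unique (hG.comp hT) hG (fun a => by simp [h, hgT]) a₀ a⟩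

lemma exists_log_invariant {g : A → ℂ} (hg : Continuous g) (hne : ∀ a, g a ≠ 0)
    {T₁ T₂ T₃ : A → A} (h₁ : Continuous T₁) (h₂ : Continuous T₂) (h₃ : Continuous T₃)
    (e₁ : ∀ a, g (T₁ a) = g a) (e₂ : ∀ a, g (T₂ a) = g a) (e₃ : ∀ a, g (T₃ a) = g a)
    {κ : ℕ} (hκ : κ ≠ 0) (hcomm : ∀ a, T₂ (T₁ a) = T₃^[κ] (T₁ (T₂ a))) :
    ∃ G : A → ℂ, Continuous G ∧ (∀ a, Complex.exp (G a) = g a) ∧ ∀ a, G (T₃ a) = G a := by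
  obtain ⟨a₀⟩ : Nonempty A := inferInstance
  obtain ⟨G, hG, -⟩ := existsUnique_log hg hne a₀ (Complex.exp_log (hne a₀))
  have hGe : ∀ a, Complex.exp (G a) = g a := fun a => congrFun hG.2 a
  obtain ⟨c₁, hc₁⟩ := log_translate G.continuous hGe h₁ e₁
  obtain ⟨c₂, hc₂⟩ := log_translate G.continuous hGe h₂ e₂
  obtain ⟨c₃, hc₃⟩ := log_translate G.continuous hGe h₃ e₃
  have hit : ∀ (m : ℕ) a, G (T₃^[m] a) = G a + m * c₃ := by
    intro m
    induction m with
    | zero => simp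
    | succ m ih => intro a; rw [Function.iterate_succ_apply, ih, hc₃]; push_cast; ring
  have hk := congrArg G (hcomm a₀)
  rw [hit, hc₂, hc₁, hc₁, hc₂] at hk
  have h0 : (κ : ℂ) * c₃ = 0 := by linear_combination -hk
  rcases mul_eq_zero.1 h0 with h | h
  · exact absurd (by exact_mod_cast h) hκ
  · exact ⟨G, G.continuous, hGe, fun a => by rw [hc₃, h, add_zero]⟩

end Lift

lemma cusp_ne_zero_of_log {h : ℂ → ℂ} (hp : Function.Periodic h ((1 : ℝ) : ℂ)) {c : ℝ}
    (hd : ∀ w : ℂ, c < w.im → DifferentiableAt ℂ h w)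
    (hb : BoundedAtFilter (comap Complex.im atTop) h)
    (hlog : ∀ y : ℝ, c < y → ∃ G : ℝ → ℂ, Continuous G ∧
      (∀ x, Complex.exp (G x) = h (x + y * Complex.I)) ∧ G 1 = G 0) :
    cuspFunction 1 h 0 ≠ 0 := by
  intro h0
  have han : AnalyticAt ℂ (cuspFunction 1 h) 0 :=
    (cusp_differentiableOn hp hd hb).analyticAt (Metric.ball_mem_nhds _ (Real.exp_pos _))
  have hnz : ∀ w : ℂ, c < w.im → h w ≠ 0 := by
    intro w hw
    obtain ⟨G, -, hG, -⟩ := hlog _ hw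
    have := hG w.re
    rw [Complex.re_add_im] at this
    rw [← this]
    exact Complex.exp_ne_zero _
  have hq : Tendsto (qParam 1) (comap Complex.im atTop) (𝓝 0) :=
    tendsto_nhds_of_tendsto_nhdsWithin (qParam_tendsto one_pos)
  have hnev : ¬ ∀ᶠ q in 𝓝 0, cuspFunction 1 h q = 0 := by
    intro hev
    obtain ⟨w, hw, hw'⟩ := ((hq.eventually hev).and (mem_comap_im_atTop c)).exists
    rw [eq_cuspFunction one_ne_zero hp] at hw
    exact hnz w hw' hw
  obtain ⟨m, g, hg, hg0, hev⟩ := han.exists_eventuallyEq_pow_smul_nonzero_iff.2 hnev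
  have hslit : ∀ᶠ q in 𝓝 0, g q / g 0 ∈ Complex.slitPlane := by
    have : Tendsto (fun q => g q / g 0) (𝓝 0) (𝓝 1) := by
      rw [← div_self hg0]
      exact hg.continuousAt.tendsto.div_const _
    exact this.eventually (Complex.isOpen_slitPlane.mem_nhds Complex.one_mem_slitPlane)
  obtain ⟨ε, hε, hball⟩ := Metric.eventually_nhds_iff_ball.1
    (hev.and (hslit.and hg.eventually_continuousAt))
  obtain ⟨w, hwε, hwc⟩ := ((hq.eventually (Metric.ball_mem_nhds _ hε)).and
    (mem_comap_im_atTop c)).exists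
  obtain ⟨G, hGc, hGe, hG1⟩ := hlog w.im hwc
  let p : ℝ → ℂ := fun x => x + w.im * Complex.I
  have hpim : ∀ x, (p x).im = w.im := fun x => by simp [p]
  have hpq : ∀ x, qParam 1 (p x) ∈ Metric.ball (0 : ℂ) ε := by
    intro x
    have : ‖qParam 1 (p x)‖ = ‖qParam 1 w‖ := by rw [norm_qParam, norm_qParam, hpim]
    rw [mem_ball_zero_iff, this]
    simpa using hwε
  have hp1 : qParam 1 (p 1) = qParam 1 (p 0) := by
    have h1 : p 1 = p 0 + 1 := by simp [p]; ring
    have : Function.Periodic (qParam 1) 1 := by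
      intro z
      simp only [qParam]
      rw [show 2 * (Real.pi : ℂ) * Complex.I * (z + 1) / ((1 : ℝ) : ℂ)
        = 2 * Real.pi * Complex.I * z / ((1 : ℝ) : ℂ) + 2 * Real.pi * Complex.I by
          push_cast; ring]
      exact Complex.exp_periodic _
    rw [h1, this]
  let K : ℝ → ℂ := fun x => G x - m * (2 * Real.pi * Complex.I * p x)
    - Complex.log (g (qParam 1 (p x)) / g 0)
  have hpc : Continuous fun x => qParam 1 (p x) := by
    have : Continuous p := by fun_prop
    exact continuous_qParam.comp this
  have hKc : Continuous K := by
    refine (hGc.sub (by fun_prop)).sub ?_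
    rw [continuous_iff_continuousAt]
    intro x
    refine ContinuousAt.clog ?_ (hball _ (hpq x)).2.1
    exact (ContinuousAt.comp (f := fun x => qParam 1 (p x)) (hball _ (hpq x)).2.2
      hpc.continuousAt).div_const _
  have hKe : ∀ x, Complex.exp (K x) = g 0 := by
    intro x
    have h1 := (hball _ (hpq x)).1
    rw [eq_cuspFunction one_ne_zero hp, sub_zero, smul_eq_mul] at h1
    have hgx : g (qParam 1 (p x)) ≠ 0 := by
      intro h2
      rw [h2, mul_zero] at h1
      exact hnz _ (by rw [hpim]; exact hwc) h1
    have h3 : Complex.exp (m * (2 * Real.pi * Complex.I * p x)) = qParam 1 (p x) ^ m := by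
      rw [Complex.exp_nat_mul, qParam]; simp
    simp only [K]
    rw [Complex.exp_sub, Complex.exp_sub, hGe, h3, Complex.exp_log (div_ne_zero hgx hg0)]
    change h (p x) / _ / _ = _
    rw [h1]
    have := qParam_ne_zero (h := 1) (p x)
    field_simp
  have hK : K 1 = K 0 := by
    simpa using log_unique hKc (continuous_const (y := K 0)) (fun a => by simp [hKe]) 0 1
  simp only [K, hG1, hp1] at hK
  have hm : (m : ℂ) * (2 * Real.pi * Complex.I) = 0 := by
    simp only [p] at hK
    push_cast at hK
    linear_combination -hK
  rcases mul_eq_zero.1 hm with hm | hm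
  · have hm0 : m = 0 := by exact_mod_cast hm
    have := hev.self_of_nhds
    rw [h0, hm0] at this
    simp at this
    exact hg0 this.symm
  · exact Complex.two_pi_I_ne_zero hm

section Nonvanishing
variable {r : ℕ} {L : Matrix (Fin r) (Fin r) ℤ} {k : ℤ} {f : ℂ × (Fin r → ℂ) × ℂ → ℂ}

lemma height_heis (hL : IsEvenPosDef L) {τ : ℂ} (hτ : 0 < τ.im) (z : Fin r → ℂ) (l : Fin r → ℤ)
    (c : ℝ) : height L c τ (z + τ • intC l)
      = height L c τ z + (cpair L (intC l) z + (qnorm L l : ℂ) / 2 * τ).im := by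
  have := rho_heis hL τ z 0 l
  simp only [rho, Complex.zero_im, zero_add] at this
  simp only [height]
  generalize (cpair L (intC l) z + (qnorm L l : ℂ) / 2 * τ).im = D at this ⊢
  field_simp
  linear_combination -this

lemma fzero_ne_zero_of_line (hL : IsEvenPosDef L) (hf : Jac L k f) {w : Fin r → ℤ} (hw : w ≠ 0)
    {τ : ℂ} (hτ : 0 < τ.im) (x : Fin r → ℂ) {c : ℝ} (hc : 0 ≤ c)
    (hnz : ∀ s ω : ℂ, c < rho L (τ, x + s • intC w, ω) → f (τ, x + s • intC w, ω) ≠ 0) :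
    fzero f τ x ≠ 0 := by
  have hq : 0 < qnorm L w := lt_of_le_of_ne (qnorm_nonneg hL w)
    fun h => hw (qnorm_eq_zero hL h.symm)
  obtain ⟨κ, hκ⟩ := Int.eq_ofNat_of_zero_le hq.le
  have hκ0 : κ ≠ 0 := by rintro rfl; simp [hκ] at hq
  let P : ℂ × ℝ × ℝ → ℂ × (Fin r → ℂ) × ℂ := fun a => (τ, x + a.1 • intC w,
    a.2.1 + ((height L c τ (x + a.1 • intC w) + Real.exp a.2.2 : ℝ) : ℂ) * Complex.I)
  have hPc : Continuous P := by
    have h1 : Continuous fun v : Fin r → ℂ => height L c τ v := by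
      unfold height rpair vim; fun_prop
    have h2 := h1.comp (by fun_prop : Continuous fun a : ℂ × ℝ × ℝ => x + a.1 • intC w)
    refine continuous_const.prodMk (Continuous.prodMk (by fun_prop) ?_)
    refine Continuous.add (by fun_prop) (Continuous.mul ?_ continuous_const)
    exact Complex.continuous_ofReal.comp (h2.add (by fun_prop))
  have hPr : ∀ a, c < rho L (P a) := by
    intro a
    refine (lt_rho_iff hτ).2 ?_
    rw [Complex.add_im, Complex.ofReal_im, zero_add, Complex.im_ofReal_mul, Complex.I_im, mul_one]
    exact lt_add_of_pos_right _ (Real.exp_pos _)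
  have hgc : Continuous (fun a => f (P a)) :=
    hf.holo.continuousOn.comp_continuous hPc fun a => ⟨hτ, hc.trans_lt (hPr a)⟩
  let T₁ : ℂ × ℝ × ℝ → ℂ × ℝ × ℝ := fun a => (a.1 + 1, a.2.1, a.2.2)
  let T₂ : ℂ × ℝ × ℝ → ℂ × ℝ × ℝ := fun a => (a.1 + τ, a.2.1 +
      (cpair L (intC w) (x + a.1 • intC w) + (qnorm L w : ℂ) / 2 * τ).re, a.2.2)
  let T₃ : ℂ × ℝ × ℝ → ℂ × ℝ × ℝ := fun a => (a.1, a.2.1 + 1, a.2.2)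
  have key : ∃ G : ℂ × ℝ × ℝ → ℂ, Continuous G ∧ (∀ a, Complex.exp (G a) = f (P a)) ∧
      ∀ a, G (T₃ a) = G a := by
    refine exists_log_invariant hgc (fun a => hnz _ _ (hPr a)) (T₁ := T₁) (T₂ := T₂) (T₃ := T₃)
      (by fun_prop) (by unfold T₂ cpair; fun_prop) (by fun_prop) ?_ ?_ ?_ hκ0 ?_
    · intro a
      have hh : height L c τ (x + (a.1 + 1) • intC w) = height L c τ (x + a.1 • intC w) := by
        simp [height, vim_add, vim_smul_intC]
      simp only [P, T₁, hh]
      have := hf.trans_mul τ (x + a.1 • intC w)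
        (a.2.1 + ((height L c τ (x + a.1 • intC w) + Real.exp a.2.2 : ℝ) : ℂ) * Complex.I) w 1
      rw [← this]
      congr 3
      push_cast
      module
    · intro a
      simp only [P, T₂]
      rw [add_smul, ← add_assoc, height_heis hL hτ]
      rw [← hf.heis τ (x + a.1 • intC w) _ w]
      congr 3
      set C := cpair L (intC w) (x + a.1 • intC w) + (qnorm L w : ℂ) / 2 * τ with hC
      rw [add_assoc _ (cpair L (intC w) (x + a.1 • intC w)), ← hC]
      push_cast
      linear_combination Complex.re_add_im C
    · intro a
      simp only [P, T₃]
      refine Eq.trans ?_ (hf.shift' τ (x + a.1 • intC w) _)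
      congr 3
      push_cast; ring
    · intro a
      have hit : ∀ (m : ℕ) (a : ℂ × ℝ × ℝ), T₃^[m] a
          = (a.1, a.2.1 + m, a.2.2) := by
        intro m
        induction m with
        | zero => simp
        | succ m ih => intro a; rw [Function.iterate_succ_apply, ih]; push_cast; simp [T₃]; ring
      rw [hit]
      have hk : (qnorm L w : ℂ) = κ := by rw [hκ]; simp
      simp only [T₁, T₂, Prod.mk.injEq, and_true]
      refine ⟨by ring, ?_⟩
      rw [add_smul, ← add_assoc, cpair_add_right, one_smul, cpair_intC_self, hk]
      simp only [Complex.add_re, Complex.natCast_re]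
      ring
  obtain ⟨G, hGc, hGe, hG3⟩ := key
  refine cusp_ne_zero_of_log (hf.periodic τ x) (c := height L c τ x)
    (fun w hw => hf.differentiableAt_snd hτ hc hw) (hf.bounded_snd hL hw hτ x) ?_
  intro y hy
  refine ⟨fun t => G (0, t, Real.log (y - height L c τ x)), by fun_prop, fun t => ?_, ?_⟩
  · rw [hGe]
    simp only [P, zero_smul, add_zero]
    rw [Real.exp_log (sub_pos.2 hy)]
    congr 3
    push_cast; ring
  · have := hG3 (0, 0, Real.log (y - height L c τ x))
    simpa [T₃] using this

end Nonvanishing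

section Generic
variable {r : ℕ} {L : Matrix (Fin r) (Fin r) ℤ}

/-- `x` lies on no hyperplane `(l, x) = m` with `l` a 2-root and `m` an integer. -/
def Generic (L : Matrix (Fin r) (Fin r) ℤ) (x : Fin r → ℝ) : Prop :=
  ∀ l : Fin r → ℤ, qnorm L l = 2 → ∀ m : ℤ, rpair L (intR l) x ≠ m

lemma exists_generic : ∃ x, Generic L x := by
  have ht := transcendental_liouvilleNumber (m := 2) le_rfl
  set t : ℝ := liouvilleNumber 2
  refine ⟨fun j => t ^ ((j : ℕ) + 1), fun l hl m hm => ?_⟩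
  let u : Fin r → ℤ := fun j => ∑ i, L i j * l i
  let p : Polynomial ℤ := (∑ j, Polynomial.C (u j) * Polynomial.X ^ ((j : ℕ) + 1)) - Polynomial.C m
  have hp : Polynomial.aeval t p = 0 := by
    simp only [p, map_sub, map_sum, map_mul, map_pow, Polynomial.aeval_X, Polynomial.aeval_C]
    rw [sub_eq_zero]
    simp only [rpair] at hm
    rw [Finset.sum_comm] at hm
    simp only [u, algebraMap_int_eq, eq_intCast]
    rw [← hm]
    refine Finset.sum_congr rfl fun j _ => ?_
    push_cast
    rw [Finset.sum_mul]
    rfl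
  have hp0 : p = 0 := by
    by_contra h
    exact ht ⟨p, h, hp⟩
  have hu : u = 0 := by
    ext j
    have := congrArg (fun q => Polynomial.coeff q ((j : ℕ) + 1)) hp0
    simp only [p, Polynomial.coeff_sub, Polynomial.finsetSum_coeff, Polynomial.coeff_C_mul,
      Polynomial.coeff_X_pow, Polynomial.coeff_C, Polynomial.coeff_zero] at this
    simpa [Fin.val_inj] using this
  have hq : qnorm L l = 0 := by
    have : qnorm L l = ∑ j, u j * l j := by
      simp only [qnorm, dotProduct, Matrix.mulVec, u, Finset.sum_mul, Finset.mul_sum]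
      rw [Finset.sum_comm]
      exact Finset.sum_congr rfl fun i _ => Finset.sum_congr rfl fun j _ => by ring
    simp [this, hu]
  omega

lemma Generic.countable_compl {x : Fin r → ℝ} (hx : Generic L x) (l₀ : Fin r → ℤ) :
    {s : ℝ | ¬ Generic L (x + s • intR l₀)}.Countable := by
  have : {s : ℝ | ¬ Generic L (x + s • intR l₀)} ⊆
      ⋃ p : (Fin r → ℤ) × ℤ, {((p.2 : ℝ) - rpair L (intR p.1) x) / (zpair L p.1 l₀ : ℝ)} := by
    intro s hs
    simp only [Set.mem_ofPred_eq, Generic] at hs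
    push Not at hs
    obtain ⟨l, hl, m, hm⟩ := hs
    rw [rpair_add_right, rpair_smul_right, rpair_intR] at hm
    refine Set.mem_iUnion.2 ⟨(l, m), ?_⟩
    have h0 : (zpair L l l₀ : ℝ) ≠ 0 := by
      intro h0
      rw [h0, mul_zero, add_zero] at hm
      exact hx l hl m hm
    simp only [Set.mem_singleton_iff]
    rw [eq_div_iff h0]
    linarith
  exact (Set.countable_iUnion fun _ => Set.countable_singleton _).mono this

variable {k : ℤ} {f : ℂ × (Fin r → ℂ) × ℂ → ℂ} (hL : IsEvenPosDef L) (hf : Jac L k f)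
  (hZ : ZerosNormTwo L f) {w : Fin r → ℤ} (hw : w ≠ 0)
  (hort : ∀ l : Fin r → ℤ, qnorm L l = 2 → zpair L l w = 0)
include hL hf hZ hw hort

lemma fzero_ne_zero {τ : ℂ} (hτ : 0 < τ.im) : fzero f τ 0 ≠ 0 := by
  obtain ⟨x, hx⟩ := exists_generic (L := L)
  rw [← fzero_eq hf hL hτ (ofR x)]
  refine fzero_ne_zero_of_line hL hf hw hτ (ofR x) (c := max 2 (2 * τ.im ^ 2)) (by positivity) ?_
  intro s ω hρ hzero
  obtain ⟨h2, h3⟩ := max_lt_iff.1 hρ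
  have hp : (τ, ofR x + s • intC w, ω) ∈ Tube L := ⟨hτ, by linarith⟩
  obtain ⟨a, b, c, d, l, hn, he⟩ := hZ _ _ _ hp hzero
  obtain ⟨hl, hh⟩ := zero_near_cusp hL hp h2 h3 hn he
  rw [cpair_add_right, cpair_smul_right, cpair_intC, hort l hl, cpair_intC_ofR] at hh
  have him := congrArg Complex.im hh
  have hre := congrArg Complex.re hh
  simp at him hre
  rcases him with hd | hd
  · rw [hd] at hre
    simp at hre
    exact hx l hl a hre
  · exact hτ.ne' hd

/-- If the zeroth coefficient vanishes at the cusp then `f` vanishes on the diagonal above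
generic real points, close to the cusp. -/
lemma diag_zero_near (h0 : cuspFunction 1 (fun τ => fzero f τ 0) 0 = 0) {x : Fin r → ℝ}
    (hx : Generic L x) : ∃ J : ℝ, ∀ ω : ℂ, J < ω.im → f (ω, ofR x, ω) = 0 := by
  have hper : Function.Periodic (fun τ => fzero f τ 0) ((1 : ℝ) : ℂ) := fun τ => by
    rw [Complex.ofReal_one]; exact fzero_add_one hf τ 0
  obtain ⟨C₁, hC₁⟩ := fzero_bounded hf hL hw
  have hd : ∀ τ : ℂ, 1 < τ.im → DifferentiableAt ℂ (fun τ => fzero f τ 0) τ :=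
    fun τ h => fzero_zero_differentiableAt hf hL hw (by linarith)
  have hlim := cusp_tendsto hper hd (bounded_of_forall fun τ h => hC₁ τ h.le)
  rw [h0] at hlim
  let κ : ℝ → ℂ := fun t => t + 2 * Complex.I
  have hκ : ∀ t, (κ t).im = 2 := fun t => by simp [κ]
  have hred : ∀ v : ℂ, v.im = 2 → ∃ t ∈ Set.Icc (0 : ℝ) 1, ∃ m : ℤ, v = κ t + m := by
    intro v hv
    refine ⟨Int.fract v.re, ⟨Int.fract_nonneg _, (Int.fract_lt_one _).le⟩, ⌊v.re⌋, ?_⟩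
    apply Complex.ext
    · simp [κ]
    · simp [κ, hv]
  obtain ⟨C, J, hCJ⟩ := fzero_approx hf hL hw
    (K := (fun t : ℝ => (κ t, (ofR x : Fin r → ℂ))) '' Set.Icc 0 1)
    (isCompact_Icc.image (by fun_prop)) (by rintro _ ⟨t, -, rfl⟩; simp [hκ])
  have hcont : ContinuousOn (fun t => ‖fzero f (κ t) 0‖) (Set.Icc (0 : ℝ) 1) := by
    intro t _
    have h1 := (fzero_zero_differentiableAt hf hL hw (τ := κ t) (by simp [hκ])).continuousAt
    exact (ContinuousAt.comp (f := κ) h1 (by fun_prop)).norm.continuousWithinAt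
  obtain ⟨t₀, -, ht₀⟩ := isCompact_Icc.exists_isMinOn ⟨0, by simp⟩ hcont
  set δ := ‖fzero f (κ t₀) 0‖ with hδ
  have hδ0 : 0 < δ := norm_pos_iff.2 (fzero_ne_zero hL hf hZ hw hort (by simp [hκ]))
  have he1 : ∀ᶠ ω : ℂ in comap Complex.im atTop, C * Real.exp (-2 * Real.pi * ω.im) < δ / 2 := by
    have h1 : Tendsto (fun y : ℝ => C * Real.exp (-2 * Real.pi * y)) atTop (𝓝 (C * 0)) := by
      refine (Real.tendsto_exp_atBot.comp ?_).const_mul C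
      exact tendsto_id.const_mul_atTop_of_neg (by linarith [Real.pi_pos])
    rw [mul_zero] at h1
    exact (h1.eventually (gt_mem_nhds (half_pos hδ0))).comap _
  have he2 : ∀ᶠ ω in comap Complex.im atTop, ‖fzero f ω 0‖ < δ / 2 := by
    have := hlim.norm
    rw [norm_zero] at this
    exact this.eventually (gt_mem_nhds (half_pos hδ0))
  have hall := (he1.and he2).and ((mem_comap_im_atTop J).and (mem_comap_im_atTop 1))
  obtain ⟨s, hs, hs'⟩ := eventually_comap.1 hall |>.exists_mem
  obtain ⟨J', hJ'⟩ := mem_atTop_sets.1 hs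
  refine ⟨J', fun ω hω => ?_⟩
  obtain ⟨⟨hω1, hω2⟩, hω3, hω4⟩ := hs' ω.im (hJ' _ hω.le) ω rfl
  have hω0 : 0 < ω.im := by linarith
  have hcusp : cuspFunction 1 (fun τ => f (τ, ofR x, ω)) 0 = fzero f ω 0 := by
    rw [← fzero_eq hf hL hω0 (ofR x), fzero]
    simp only [hf.swap]
  have hlow : ∀ v : ℂ, v.im = 2 → δ / 2 ≤ ‖f (v, ofR x, ω)‖ := by
    intro v hv
    obtain ⟨t, ht, m, rfl⟩ := hred v hv
    have h1 := (hf.periodic_fst (ofR x) ω).int_mul m (κ t)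
    rw [Complex.ofReal_one, mul_one] at h1
    rw [h1]
    obtain ⟨-, h2⟩ := hCJ _ ⟨t, ht, rfl⟩ ω hω3
    simp only at h2
    rw [fzero_eq hf hL (by simp [hκ])] at h2
    have h3 : δ ≤ ‖fzero f (κ t) 0‖ := ht₀ ht
    have h4 := norm_sub_norm_le (fzero f (κ t) 0) (f (κ t, ofR x, ω))
    rw [norm_sub_rev] at h4
    linarith
  obtain ⟨τ, hτ, hτ0⟩ := exists_zero_of_norm_le (hf.periodic_fst (ofR x) ω) (c := 1) (y := 2)
    (δ := δ / 2) (by norm_num)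
    (fun v hv => hf.differentiableAt (γ := fun τ => (τ, ofR x, ω)) (by fun_prop)
      (mem_tube_ofR x (by linarith) hω0)) (hf.bounded_fst hL hw hω0 _) hlow
    (by rw [hcusp]; exact hω2) (by rw [hcusp]; exact fzero_ne_zero hL hf hZ hw hort hω0)
  have hτp : 0 < τ.im := by linarith
  obtain ⟨a, b, c, d, l, hn, he⟩ := hZ _ _ _ (mem_tube_ofR x hτp hω0) hτ0
  rcases zero_real hL hτp hω0 (by rw [rho_ofR]; nlinarith) hn he with ⟨hl, hh⟩ | ⟨m, hm⟩
  · exact absurd hh (hx l hl a)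
  · have h1 := (hf.periodic_fst (ofR x) ω).int_mul m ω
    rw [Complex.ofReal_one, mul_one, ← hm] at h1
    exact h1.symm.trans hτ0

lemma diag_zero (h0 : cuspFunction 1 (fun τ => fzero f τ 0) 0 = 0) {x : Fin r → ℝ}
    (hx : Generic L x) {ω : ℂ} (hω : 0 < ω.im) : f (ω, ofR x, ω) = 0 := by
  obtain ⟨J, hJ⟩ := diag_zero_near hL hf hZ hw hort h0 hx
  have hU : IsOpen {ω : ℂ | 0 < ω.im} := isOpen_lt continuous_const Complex.continuous_im
  have han : AnalyticOnNhd ℂ (fun ω => f (ω, ofR x, ω)) {ω : ℂ | 0 < ω.im} := by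
    refine DifferentiableOn.analyticOnNhd (fun v hv => ?_) hU
    exact (hf.differentiableAt (γ := fun ω => (ω, ofR x, ω)) (by fun_prop)
      (mem_tube_ofR x hv hv)).differentiableWithinAt
  have hz : ((|J| + 1 : ℝ) : ℂ) * Complex.I ∈ {ω : ℂ | 0 < ω.im} := by
    simp; positivity
  refine han.eqOn_zero_of_preconnected_of_eventuallyEq_zero
    (convex_halfSpace_im_gt 0).isPreconnected hz ?_ hω
  have : {v : ℂ | |J| < v.im} ∈ 𝓝 (((|J| + 1 : ℝ) : ℂ) * Complex.I) :=
    (isOpen_lt continuous_const Complex.continuous_im).mem_nhds (by simp)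
  filter_upwards [this] with v hv
  exact hJ v ((le_abs_self J).trans_lt hv)

lemma diag_zero_line (h0 : cuspFunction 1 (fun τ => fzero f τ 0) 0 = 0) {x : Fin r → ℝ}
    (hx : Generic L x) {l : Fin r → ℤ} (hl : qnorm L l = 2) {ω s : ℂ} (hs : |s.im| < ω.im) :
    f (ω, ofR x + s • intC l, ω) = 0 := by
  have hω : 0 < ω.im := (abs_nonneg _).trans_lt hs
  set S : Set ℂ := {s | |s.im| < ω.im}
  have hS : S = {s : ℂ | -ω.im < s.im} ∩ {s : ℂ | s.im < ω.im} := by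
    ext s; simp [S, abs_lt]
  have hSo : IsOpen S := isOpen_lt (Complex.continuous_im.abs) continuous_const
  have hSc : IsPreconnected S := by
    rw [hS]
    exact ((convex_halfSpace_im_gt _).inter (convex_halfSpace_im_lt _)).isPreconnected
  have hmem : ∀ s ∈ S, (ω, ofR x + s • intC l, ω) ∈ Tube L := by
    intro s hs
    refine ⟨hω, ?_⟩
    simp only [rho, vim_add, vim_ofR, zero_add, vim_smul_intC, rpair_smul_left, rpair_smul_right,
      rpair_intR_self, hl]
    have : s.im ^ 2 < ω.im ^ 2 := sq_lt_sq.2 (by rwa [abs_of_pos hω])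
    push_cast
    nlinarith
  have hd : DifferentiableOn ℂ (fun s : ℂ => f (ω, ofR x + s • intC l, ω)) S := fun s hs =>
    (hf.differentiableAt (γ := fun s : ℂ => (ω, ofR x + s • intC l, ω)) (by fun_prop)
      (hmem s hs)).differentiableWithinAt
  have hreal : ∀ t : ℝ, f (ω, ofR x + (t : ℂ) • intC l, ω) = 0 := by
    have hc : Continuous fun t : ℝ => f (ω, ofR x + (t : ℂ) • intC l, ω) := by
      refine hd.continuousOn.comp_continuous (f := fun t : ℝ => (t : ℂ))
        Complex.continuous_ofReal ?_
      intro t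
      simpa [S] using hω
    have hdense := (hx.countable_compl l).dense_compl ℝ
    intro t
    refine congrFun (hc.ext_on hdense continuous_const ?_) t
    intro t ht
    have hg : Generic L (x + t • intR l) := by simpa using ht
    have := diag_zero hL hf hZ hw hort h0 hg hω
    convert this using 4
    ext i
    simp [ofR, intC, intR]
  refine (hd.analyticOnNhd hSo).eqOn_zero_of_preconnected_of_frequently_eq_zero hSc
    (z₀ := 0) (by simpa [S] using hω) ?_ hs
  have hseq : Tendsto (fun n : ℕ => ((1 / ((n : ℝ) + 1) : ℝ) : ℂ)) atTop (𝓝[≠] 0) := by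
    refine tendsto_nhdsWithin_iff.2 ⟨?_, ?_⟩
    · have := Complex.continuous_ofReal.tendsto 0 |>.comp tendsto_one_div_add_atTop_nhds_zero_nat
      simpa [Function.comp_def] using this
    · refine Eventually.of_forall fun n => ?_
      simp only [Set.mem_compl_iff, Set.mem_singleton_iff, Complex.ofReal_eq_zero]
      positivity
  exact hseq.frequently (Frequently.of_forall fun n => hreal _)

lemma cuspFunction_fzero_ne_zero {l : Fin r → ℤ} (hl : qnorm L l = 2) :
    cuspFunction 1 (fun τ => fzero f τ 0) 0 ≠ 0 := by
  intro h0
  obtain ⟨x, hx⟩ := exists_generic (L := L)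
  have hI : (0 : ℝ) < Complex.I.im := by simp
  refine fzero_ne_zero hL hf hZ hw hort hI ?_
  set s : ℂ := -(Complex.I + rpair L (intR l) x) / 2 with hs
  rw [← fzero_eq hf hL hI (ofR x + s • intC l)]
  refine tendsto_nhds_unique (fzero_tendsto hf hL hw hI _) (tendsto_const_nhds.congr' ?_)
  filter_upwards [mem_comap_im_atTop 1] with ω hω
  rw [← hf.swap_heis _ _ _ l]
  have h1 : Complex.I + cpair L (intC l) (ofR x + s • intC l) + (qnorm L l : ℂ) / 2 * ω = ω := by
    rw [cpair_add_right, cpair_smul_right, cpair_intC_self, cpair_intC_ofR, hl, hs]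
    push_cast; ring
  have h2 : ofR x + s • intC l + ω • intC l = ofR x + (s + ω) • intC l := by module
  rw [h1, h2]
  symm
  refine diag_zero_line hL hf hZ hw hort h0 hx hl ?_
  have h3 : (s + ω).im = ω.im - 1 / 2 := by
    simp [hs]; ring
  rw [h3, abs_lt]
  constructor <;> linarith

end Generic

section LevelOne
open ModularForm UpperHalfPlane MatrixGroups

lemma exists_modularForm {k : ℤ} {h : ℂ → ℂ} (hd : ∀ τ : ℂ, 0 < τ.im → DifferentiableAt ℂ h τ)
    (hT : ∀ τ : ℂ, 0 < τ.im → h (τ + 1) = h τ)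
    (hS : ∀ τ : ℂ, 0 < τ.im → h (-1 / τ) = τ ^ k * h τ)
    (hb : ∃ C A : ℝ, ∀ τ : ℂ, A ≤ τ.im → ‖h τ‖ ≤ C) :
    ∃ F : ModularForm 𝒮ℒ k, ∀ τ : ℍ, F τ = h τ := by
  have hslash : ∀ γ : SL(2, ℤ), (fun τ : ℍ => h τ) ∣[k] γ = fun τ : ℍ => h τ := by
    refine SlashInvariantForm.slash_action_generators_SL2Z ?_ ?_
    · ext τ
      rw [SlashInvariantForm.slash_S_apply]
      have h1 := hS τ τ.im_pos
      have h2 : ((-(τ : ℂ))⁻¹) = -1 / (τ : ℂ) := by rw [inv_neg, neg_div, one_div]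
      simp only [h2, h1]
      rw [mul_right_comm, ← zpow_add₀ τ.ne_zero, add_neg_cancel, zpow_zero, one_mul]
    · ext τ
      have h0 := hT τ τ.im_pos
      have h1 : denom (ModularGroup.T : SL(2, ℤ)) τ = 1 := by
        rw [ModularGroup.denom_apply]
        simp [ModularGroup.T]
      rw [SL_slash_apply, h1, modular_T_smul, coe_vadd]
      simp [add_comm, h0]
  obtain ⟨C, A, hC⟩ := hb
  refine ⟨{ toFun := fun τ => h τ
            slash_action_eq' := fun _ ⟨γ, hγ⟩ => hγ ▸ hslash γ
            holo' := ?_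
            bdd_at_cusps' := ?_ }, fun τ => rfl⟩
  · intro τ
    rw [UpperHalfPlane.mdifferentiableAt_iff]
    refine (hd τ τ.im_pos).congr_of_eventuallyEq ?_
    filter_upwards [(isOpen_lt continuous_const Complex.continuous_im).mem_nhds τ.im_pos]
      with w hw
    simp [ofComplex_apply_of_im_pos hw]
  · intro c hc
    rw [OnePoint.isBoundedAt_iff_forall_SL2Z hc]
    intro γ _
    rw [hslash γ, isBoundedAtImInfty_iff]
    exact ⟨C, A, fun τ hτ => hC τ hτ⟩

end LevelOne

section Weight
variable {r : ℕ} {L : Matrix (Fin r) (Fin r) ℤ} {k : ℤ} {f : ℂ × (Fin r → ℂ) × ℂ → ℂ}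

lemma im_neg_one_div_pos {τ : ℂ} (hτ : 0 < τ.im) : 0 < (-1 / τ).im := by
  rw [neg_div, one_div, Complex.neg_im, Complex.inv_im, neg_div, neg_neg]
  exact div_pos hτ (Complex.normSq_pos.2 (by rintro rfl; simp at hτ))

/-- Reflective forms of non-zero weight do not exist if the 2-roots do not span. -/
theorem weight_eq_zero (hL : IsEvenPosDef L) (hf : Jac L k f) (hZ : ZerosNormTwo L f)
    {w : Fin r → ℤ} (hw : w ≠ 0) (hort : ∀ l : Fin r → ℤ, qnorm L l = 2 → zpair L l w = 0)
    {l : Fin r → ℤ} (hl : qnorm L l = 2) : k = 0 := by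
  set h : ℂ → ℂ := fun τ => fzero f τ 0 with hh
  have hne : ∀ τ : ℂ, 0 < τ.im → h τ ≠ 0 := fun τ => fzero_ne_zero hL hf hZ hw hort
  have hd : ∀ τ : ℂ, 0 < τ.im → DifferentiableAt ℂ h τ :=
    fun τ => fzero_zero_differentiableAt hf hL hw
  have hT : ∀ τ, h (τ + 1) = h τ := fun τ => fzero_add_one hf τ 0
  have hS : ∀ τ : ℂ, 0 < τ.im → h (-1 / τ) = (-τ) ^ k * h τ := fun τ => fzero_inversion hf hL hw
  have heven : Even k := by
    have h1 := hS Complex.I (by simp)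
    have h2 : -1 / Complex.I = Complex.I := by
      rw [div_eq_iff Complex.I_ne_zero, Complex.I_mul_I]
    have h3 := hS _ (im_neg_one_div_pos (τ := 2 * Complex.I) (by simp))
    have h4 := hS (2 * Complex.I) (by simp)
    have h5 : -1 / (-1 / (2 * Complex.I)) = 2 * Complex.I := by field_simp
    rw [h5, h4, ← mul_assoc, ← mul_zpow] at h3
    have h6 : -(-1 / (2 * Complex.I)) * -(2 * Complex.I) = -1 := by field_simp
    rw [h6] at h3
    have h7 : ((-1 : ℂ)) ^ k = 1 := by
      have := hne (2 * Complex.I) (by simp)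
      field_simp at h3
      exact h3.symm
    by_contra hodd
    rw [Int.not_even_iff_odd] at hodd
    rw [hodd.neg_one_zpow] at h7
    norm_num at h7
  have hS' : ∀ τ : ℂ, 0 < τ.im → h (-1 / τ) = τ ^ k * h τ := fun τ hτ => by
    rw [hS τ hτ, heven.neg_zpow]
  have hbd := fzero_bounded hf hL hw
  have hper : Function.Periodic h ((1 : ℝ) : ℂ) := fun τ => by
    rw [Complex.ofReal_one]; exact hT τ
  have hlim : Tendsto h (comap Complex.im atTop) (𝓝 (cuspFunction 1 h 0)) := by
    obtain ⟨C, hC⟩ := hbd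
    exact cusp_tendsto hper (c := 1) (fun τ hτ => hd τ (by linarith))
      (bounded_of_forall fun τ hτ => hC τ hτ.le)
  have hc0 : cuspFunction 1 h 0 ≠ 0 := cuspFunction_fzero_ne_zero hL hf hZ hw hort hl
  have key : ∀ {k : ℤ} {h : ℂ → ℂ}, (∀ τ : ℂ, 0 < τ.im → h τ ≠ 0) →
      (∃ F : ModularForm
        (MonoidHom.range (Matrix.SpecialLinearGroup.mapGL (n := Fin 2) (R := ℤ) ℝ)) k,
        ∀ τ : UpperHalfPlane, F τ = h τ) → 0 ≤ k := by
    rintro k h hne ⟨F, hF⟩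
    by_contra hk
    have h0 := ModularFormClass.levelOne_neg_weight_eq_zero (not_le.1 hk) F
    have := congrFun h0 ⟨Complex.I, by simp⟩
    rw [hF] at this
    exact hne _ (by simp) this
  have h1 : 0 ≤ k := key hne (exists_modularForm hd (fun τ _ => hT τ) hS'
    (hbd.imp fun C hC => ⟨1, hC⟩))
  have h2 : 0 ≤ -k := by
    refine key (h := h⁻¹) (fun τ hτ => inv_ne_zero (hne τ hτ))
      (exists_modularForm (fun τ hτ => (hd τ hτ).inv (hne τ hτ))
        (fun τ _ => by rw [Pi.inv_apply, Pi.inv_apply, hT])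
        (fun τ hτ => by
          rw [Pi.inv_apply, Pi.inv_apply, hS' τ hτ, mul_inv, _root_.zpow_neg]) ?_)
    have h3 := (hlim.inv₀ hc0).norm.eventually_le_const (lt_add_one _)
    rw [eventually_comap] at h3
    obtain ⟨A, hA⟩ := eventually_atTop.1 h3
    exact ⟨_, A, fun τ hτ => hA _ hτ τ rfl⟩
  omega

end Weight

section Coordinates

lemma cpair_dsum {m n : ℕ} (A : Matrix (Fin m) (Fin m) ℤ) (B : Matrix (Fin n) (Fin n) ℤ)
    (x x' : Fin m → ℂ) (y y' : Fin n → ℂ) :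
    cpair (dsum A B) (Fin.append x y) (Fin.append x' y') = cpair A x x' + cpair B y y' := by
  simp [cpair, dsum, Fin.sum_univ_add]

variable {r : ℕ}

/-- The vector with the given coordinates with respect to `2U ⊕ L(-1)`. -/
def vec {R : Type*} (a b c d : R) (z : Fin r → R) : Fin (2 + (2 + r)) → R :=
  Fin.append ![a, b] (Fin.append ![c, d] z)

lemma vec_induction {R : Type*} (x : Fin (2 + (2 + r)) → R) : ∃ a b c d z, x = vec a b c d z := by
  refine ⟨x (Fin.castAdd _ 0), x (Fin.castAdd _ 1), x (Fin.natAdd _ (Fin.castAdd _ 0)),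
    x (Fin.natAdd _ (Fin.castAdd _ 1)), fun i => x (Fin.natAdd _ (Fin.natAdd _ i)), ?_⟩
  ext i
  refine Fin.addCases (fun i => ?_) (fun i => Fin.addCases (fun i => ?_) (fun i => ?_) i) i
  · fin_cases i <;> simp [vec]
  · fin_cases i <;> simp [vec]
  · simp [vec]

lemma vec_ext {R : Type*} {a b c d a' b' c' d' : R} {z z' : Fin r → R} (ha : a = a') (hb : b = b')
    (hc : c = c') (hd : d = d') (hz : z = z') : vec a b c d z = vec a' b' c' d' z' := by
  rw [ha, hb, hc, hd, hz]

lemma vec_inj {R : Type*} {a b c d a' b' c' d' : R} {z z' : Fin r → R}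
    (h : vec a b c d z = vec a' b' c' d' z') :
    a = a' ∧ b = b' ∧ c = c' ∧ d = d' ∧ z = z' := by
  refine ⟨?_, ?_, ?_, ?_, funext fun i => ?_⟩
  · simpa [vec] using congrFun h (Fin.castAdd _ 0)
  · simpa [vec] using congrFun h (Fin.castAdd _ 1)
  · simpa [vec] using congrFun h (Fin.natAdd _ (Fin.castAdd _ 0))
  · simpa [vec] using congrFun h (Fin.natAdd _ (Fin.castAdd _ 1))
  · simpa [vec] using congrFun h (Fin.natAdd _ (Fin.natAdd _ i))

lemma vec_map {R R' : Type*} (g : R → R') (a b c d : R) (z : Fin r → R) :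
    (fun i => g (vec a b c d z i)) = vec (g a) (g b) (g c) (g d) (fun i => g (z i)) := by
  ext i
  refine Fin.addCases (fun i => ?_) (fun i => Fin.addCases (fun i => ?_) (fun i => ?_) i) i
  · fin_cases i <;> simp [vec]
  · fin_cases i <;> simp [vec]
  · simp [vec]

lemma vec_map₂ {R R' R'' : Type*} (g : R → R' → R'') (a b c d : R) (z : Fin r → R)
    (a' b' c' d' : R') (z' : Fin r → R') :
    (fun i => g (vec a b c d z i) (vec a' b' c' d' z' i)) =
      vec (g a a') (g b b') (g c c') (g d d') (fun i => g (z i) (z' i)) := by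
  ext i
  refine Fin.addCases (fun i => ?_) (fun i => Fin.addCases (fun i => ?_) (fun i => ?_) i) i
  · fin_cases i <;> simp [vec]
  · fin_cases i <;> simp [vec]
  · simp [vec]

lemma vec_add (a b c d : ℂ) (z : Fin r → ℂ) (a' b' c' d' : ℂ) (z' : Fin r → ℂ) :
    vec a b c d z + vec a' b' c' d' z' = vec (a + a') (b + b') (c + c') (d + d') (z + z') :=
  vec_map₂ (fun x y => x + y) a b c d z a' b' c' d' z'

lemma smul_vec (t a b c d : ℂ) (z : Fin r → ℂ) :
    t • vec a b c d z = vec (t * a) (t * b) (t * c) (t * d) (t • z) :=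
  vec_map (t * ·) ..

lemma intC_vec (a b c d : ℤ) (z : Fin r → ℤ) :
    intC (vec a b c d z) = vec (a : ℂ) b c d (intC z) :=
  vec_map (fun m : ℤ => (m : ℂ)) ..

variable (L : Matrix (Fin r) (Fin r) ℤ)

lemma cpair_vec (a b c d a' b' c' d' : ℂ) (z z' : Fin r → ℂ) :
    cpair (M2U L) (vec a b c d z) (vec a' b' c' d' z') =
      a * b' + b * a' + c * d' + d * c' - cpair L z z' := by
  rw [M2U, vec, vec, cpair_dsum, cpair_dsum]
  simp [cpair, U, Fin.sum_univ_two]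
  ring

lemma qnorm_vec (a b c d : ℤ) (z : Fin r → ℤ) :
    qnorm (M2U L) (vec a b c d z) = 2 * a * b + 2 * c * d - qnorm L z := by
  have h := cpair_vec L a b c d a b c d (intC z) (intC z)
  rw [← intC_vec, cpair_intC_self, cpair_intC_self] at h
  have h' : ((qnorm (M2U L) (vec a b c d z) : ℤ) : ℂ) =
      ((2 * a * b + 2 * c * d - qnorm L z : ℤ) : ℂ) := by
    rw [h]; push_cast; ring
  exact_mod_cast h'

lemma zpair_vec (a b c d a' b' c' d' : ℤ) (z z' : Fin r → ℤ) :
    zpair (M2U L) (vec a b c d z) (vec a' b' c' d' z') =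
      a * b' + b * a' + c * d' + d * c' - zpair L z z' := by
  have h := cpair_vec L a b c d a' b' c' d' (intC z) (intC z')
  rw [← intC_vec, ← intC_vec, cpair_intC, cpair_intC] at h
  exact_mod_cast h

variable {L} in
lemma M2U_isSymm (hL : L.IsSymm) : (M2U L).IsSymm := by
  have h : ∀ x y, zpair (M2U L) x y = zpair (M2U L) y x := by
    intro x y
    obtain ⟨a, b, c, d, z, rfl⟩ := vec_induction x
    obtain ⟨a', b', c', d', z', rfl⟩ := vec_induction y
    have h1 : zpair L z z' = zpair L z' z := by
      have := cpair_comm hL (intC z) (intC z')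
      rw [cpair_intC, cpair_intC] at this
      exact_mod_cast this
    rw [zpair_vec, zpair_vec, h1]; ring
  ext i j
  simpa [zpair] using h (Pi.single j 1) (Pi.single i 1)

end Coordinates

section Isometries
variable {n : ℕ} {B : Matrix (Fin n) (Fin n) ℤ}

lemma actC_intC (g : Matrix (Fin n) (Fin n) ℤ) (x : Fin n → ℤ) :
    actC g (intC x) = intC (g.mulVec x) := by
  ext i; simp [actC, intC, mulVec, dotProduct]

lemma actC_one (Z : Fin n → ℂ) : actC 1 Z = Z := by
  simp [actC]

lemma actC_mul (g h : Matrix (Fin n) (Fin n) ℤ) (Z : Fin n → ℂ) :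
    actC (g * h) Z = actC g (actC h Z) := by
  simp only [actC, mulVec_mulVec]
  congr 1
  ext i j
  simp [mul_apply]

lemma actC_add (g h : Matrix (Fin n) (Fin n) ℤ) (Z : Fin n → ℂ) :
    actC (g + h) Z = actC g Z + actC h Z := by
  ext i; simp [actC, mulVec, dotProduct, add_mul, Finset.sum_add_distrib]

lemma actC_smul (g : Matrix (Fin n) (Fin n) ℤ) (t : ℂ) (Z : Fin n → ℂ) :
    actC g (t • Z) = t • actC g Z := by
  simp [actC, mulVec_smul]

lemma smul_actC (m : ℤ) (g : Matrix (Fin n) (Fin n) ℤ) (Z : Fin n → ℂ) :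
    actC (m • g) Z = (m : ℂ) • actC g Z := by
  ext i
  simp only [actC, mulVec, dotProduct, Pi.smul_apply, smul_eq_mul, Finset.mul_sum,
    Matrix.map_apply, Matrix.smul_apply]
  exact Finset.sum_congr rfl fun j _ => by push_cast; ring

lemma actC_vecMulVec (x y : Fin n → ℤ) (Z : Fin n → ℂ) :
    actC (vecMulVec x (B.mulVec y)) Z = (∑ i, ((B.mulVec y) i : ℂ) * Z i) • intC x := by
  ext i
  simp only [actC, mulVec, dotProduct, vecMulVec_apply, Pi.smul_apply, smul_eq_mul, intC,
    Matrix.map_apply, Finset.sum_mul]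
  exact Finset.sum_congr rfl fun j _ => by push_cast; ring

lemma sum_mulVec_mul (hB : B.IsSymm) (y : Fin n → ℤ) (Z : Fin n → ℂ) :
    ∑ i, ((B.mulVec y) i : ℂ) * Z i = cpair B (intC y) Z := by
  simp only [cpair, intC, mulVec, dotProduct, Int.cast_sum, Int.cast_mul, Finset.sum_mul]
  rw [Finset.sum_comm]
  refine Finset.sum_congr rfl fun i _ => Finset.sum_congr rfl fun j _ => ?_
  rw [hB.apply i j]

lemma differentiable_actC (g : Matrix (Fin n) (Fin n) ℤ) : Differentiable ℂ (actC g) := by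
  have : actC g = fun Z =>
      (Matrix.mulVecLin (g.map (Int.cast : ℤ → ℂ))).toContinuousLinearMap Z := rfl
  rw [this]
  exact ContinuousLinearMap.differentiable _

lemma cpair_actC {g : Matrix (Fin n) (Fin n) ℤ} (hg : gᵀ * B * g = B) (Z W : Fin n → ℂ) :
    cpair B (actC g Z) (actC g W) = cpair B Z W := by
  have h : (g.map (Int.cast : ℤ → ℂ))ᵀ * B.map (Int.cast : ℤ → ℂ) * g.map (Int.cast : ℤ → ℂ)
      = B.map (Int.cast : ℤ → ℂ) := by
    conv_rhs => rw [← hg]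
    ext i j
    simp [mul_apply]
  rw [cpair_eq_dotProduct, cpair_eq_dotProduct, actC, actC, mulVec_mulVec, ← vecMul_transpose,
    ← dotProduct_mulVec, mulVec_mulVec, ← Matrix.mul_assoc, h]

lemma gram_of_cpair {g : Matrix (Fin n) (Fin n) ℤ} {m : ℤ}
    (h : ∀ Z W, cpair B (actC g Z) (actC g W) = m * cpair B Z W) : gᵀ * B * g = m • B := by
  ext i j
  have := h (intC (Pi.single i 1)) (intC (Pi.single j 1))
  rw [actC_intC, actC_intC, cpair_intC, cpair_intC] at this
  have h1 : zpair B (g.mulVec (Pi.single i 1)) (g.mulVec (Pi.single j 1)) =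
      m * zpair B (Pi.single i 1) (Pi.single j 1) := by exact_mod_cast this
  have h2 : ∀ C : Matrix (Fin n) (Fin n) ℤ,
      (Pi.single i 1 : Fin n → ℤ) ⬝ᵥ C.mulVec (Pi.single j 1) = C i j := by simp
  rw [zpair, zpair, h2, mulVec_mulVec, ← vecMul_transpose, ← dotProduct_mulVec, mulVec_mulVec, h2,
    ← Matrix.mul_assoc] at h1
  simpa using h1

lemma gram_of_cpair_one {g : Matrix (Fin n) (Fin n) ℤ}
    (h : ∀ Z W, cpair B (actC g Z) (actC g W) = cpair B Z W) : gᵀ * B * g = B := by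
  have := gram_of_cpair (B := B) (g := g) (m := 1) (by simpa using h)
  simpa using this

/-- The Eichler transvection with isotropic vector `u` and direction `θ a`, where `(a, a) = 2q`. -/
noncomputable def transv (B : Matrix (Fin n) (Fin n) ℤ) (u a : Fin n → ℤ) (q : ℤ) (θ : ℝ)
    (Z : Fin n → ℂ) : Fin n → ℂ :=
  Z + (-(θ * cpair B (intC a) Z) - θ ^ 2 * q * cpair B (intC u) Z) • intC u
    + (θ * cpair B (intC u) Z) • intC a

/-- The conditions under which `transv` is an isometry. -/
structure IsEichler (B : Matrix (Fin n) (Fin n) ℤ) (u a : Fin n → ℤ) (q : ℤ) : Prop where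
  symm : B.IsSymm
  isotropic : qnorm B u = 0
  orth : zpair B u a = 0
  norm : qnorm B a = 2 * q

variable {u a : Fin n → ℤ} {q : ℤ}

lemma IsEichler.cpair_u (h : IsEichler B u a q) : cpair B (intC u) (intC u) = 0 := by
  rw [cpair_intC_self, h.isotropic, Int.cast_zero]

lemma IsEichler.cpair_ua (h : IsEichler B u a q) : cpair B (intC u) (intC a) = 0 := by
  rw [cpair_intC, h.orth, Int.cast_zero]

lemma IsEichler.cpair_a (h : IsEichler B u a q) : cpair B (intC a) (intC a) = 2 * q := by
  rw [cpair_intC_self, h.norm]; push_cast; rfl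

lemma cpair_transv (h : IsEichler B u a q) (θ : ℝ) (Z W : Fin n → ℂ) :
    cpair B (transv B u a q θ Z) (transv B u a q θ W) = cpair B Z W := by
  simp only [transv, cpair_add_left, cpair_add_right, cpair_smul_left, cpair_smul_right,
    h.cpair_u, h.cpair_ua, cpair_comm h.symm (intC a) (intC u), h.cpair_a,
    cpair_comm h.symm Z (intC u), cpair_comm h.symm Z (intC a)]
  ring

lemma transv_zero (Z : Fin n → ℂ) : transv B u a q 0 Z = Z := by
  simp [transv]

lemma transv_transv (h : IsEichler B u a q) (θ η : ℝ) (Z : Fin n → ℂ) :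
    transv B u a q θ (transv B u a q η Z) = transv B u a q (θ + η) Z := by
  simp only [transv, cpair_add_right, cpair_smul_right,
    h.cpair_u, h.cpair_ua, cpair_comm h.symm (intC a) (intC u), h.cpair_a]
  ext i
  simp only [Pi.add_apply, Pi.smul_apply, smul_eq_mul]
  push_cast
  ring

lemma conj_cpair_intC (x : Fin n → ℤ) (Z : Fin n → ℂ) :
    cpair B (intC x) (fun i => (starRingEnd ℂ) (Z i)) = (starRingEnd ℂ) (cpair B (intC x) Z) := by
  simp [cpair, intC]

lemma conj_transv (θ : ℝ) (Z : Fin n → ℂ) :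
    (fun i => (starRingEnd ℂ) (transv B u a q θ Z i)) =
      transv B u a q θ (fun i => (starRingEnd ℂ) (Z i)) := by
  ext i
  simp [transv, conj_cpair_intC, intC]

lemma transv_mem_cone (h : IsEichler B u a q) (θ : ℝ) {Z : Fin n → ℂ} (hZ : Z ∈ Cone B) :
    transv B u a q θ Z ∈ Cone B := by
  refine ⟨?_, ?_⟩
  · rw [cpair_transv h, hZ.1]
  · rw [conj_transv, cpair_transv h]; exact hZ.2

lemma IsComponent.subset {D : Set (Fin n → ℂ)} (hD : IsComponent B D) : D ⊆ Cone B := by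
  obtain ⟨Z, _, rfl⟩ := hD
  exact connectedComponentIn_subset _ _

lemma IsComponent.isPreconnected {D : Set (Fin n → ℂ)} (hD : IsComponent B D) :
    IsPreconnected D := by
  obtain ⟨Z, _, rfl⟩ := hD
  exact isPreconnected_connectedComponentIn

lemma IsComponent.subset_of_mem {D : Set (Fin n → ℂ)} (hD : IsComponent B D) {S : Set (Fin n → ℂ)}
    (hS : IsPreconnected S) (hSC : S ⊆ Cone B) {W : Fin n → ℂ} (hW : W ∈ S) (hWD : W ∈ D) :
    S ⊆ D := by
  obtain ⟨Z, hZ, rfl⟩ := hD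
  rw [connectedComponentIn_eq hWD]
  exact hS.subset_connectedComponentIn hW hSC

lemma transv_mem {D : Set (Fin n → ℂ)} (hD : IsComponent B D) (h : IsEichler B u a q) (θ : ℝ)
    {Z : Fin n → ℂ} (hZ : Z ∈ D) : transv B u a q θ Z ∈ D := by
  have hS : IsPreconnected (Set.range fun θ => transv B u a q θ Z) :=
    isPreconnected_range (by unfold transv; fun_prop)
  refine hD.subset_of_mem hS ?_ ⟨0, transv_zero Z⟩ hZ ⟨θ, rfl⟩
  rintro _ ⟨θ, rfl⟩
  exact transv_mem_cone h θ (hD.subset hZ)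

lemma transv_image {D : Set (Fin n → ℂ)} (hD : IsComponent B D) (h : IsEichler B u a q) (θ : ℝ) :
    transv B u a q θ '' D = D := by
  refine Set.Subset.antisymm ?_ fun Z hZ => ⟨_, transv_mem hD h (-θ) hZ, ?_⟩
  · rintro _ ⟨Z, hZ, rfl⟩
    exact transv_mem hD h θ hZ
  · rw [transv_transv h, add_neg_cancel, transv_zero]

/-- The integral matrix of `N²` times the transvection with parameter `1 / N`. -/
def transvMat (B : Matrix (Fin n) (Fin n) ℤ) (u a : Fin n → ℤ) (q N : ℤ) :
    Matrix (Fin n) (Fin n) ℤ :=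
  N ^ 2 • (1 : Matrix (Fin n) (Fin n) ℤ) + (-N) • vecMulVec u (B.mulVec a)
    + N • vecMulVec a (B.mulVec u) + (-q) • vecMulVec u (B.mulVec u)

lemma actC_transvMat (hB : B.IsSymm) {N : ℤ} (hN : N ≠ 0) (Z : Fin n → ℂ) :
    actC (transvMat B u a q N) Z = (N : ℂ) ^ 2 • transv B u a q (1 / N) Z := by
  have hN' : (N : ℂ) ≠ 0 := by exact_mod_cast hN
  simp only [transvMat, actC_add, smul_actC, actC_one, actC_vecMulVec, sum_mulVec_mul hB, transv]
  ext i
  simp only [Pi.add_apply, Pi.smul_apply, smul_eq_mul]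
  push_cast
  field_simp
  ring

lemma actC_transvMat_one (hB : B.IsSymm) (Z : Fin n → ℂ) :
    actC (transvMat B u a q 1) Z = transv B u a q 1 Z := by
  rw [actC_transvMat hB one_ne_zero]; simp

lemma transvMat_mem {D : Set (Fin n → ℂ)} (hD : IsComponent B D) (h : IsEichler B u a q) :
    transvMat B u a q 1 ∈ OPlus B D := by
  have h1 : actC (transvMat B u a q 1) = transv B u a q 1 := funext (actC_transvMat_one h.symm)
  exact ⟨gram_of_cpair_one fun Z W => by rw [h1, cpair_transv h], by rw [h1, transv_image hD h]⟩

end Isometries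

section TubeModel
variable {r : ℕ} (L : Matrix (Fin r) (Fin r) ℤ)

lemma re_cpair_self_sub (z : Fin r → ℂ) :
    (cpair L z z).re - (cpair L z fun i => (starRingEnd ℂ) (z i)).re
      = -2 * rpair L (vim z) (vim z) := by
  simp only [cpair, rpair, Complex.re_sum, ← Finset.sum_sub_distrib, Finset.mul_sum, vim]
  refine Finset.sum_congr rfl fun i _ => Finset.sum_congr rfl fun j _ => ?_
  simp [mul_assoc]
  ring

/-- The tube domain realisation, with `ε = ±1` selecting the component. -/
noncomputable def phi (ε : ℤ) (p : ℂ × (Fin r → ℂ) × ℂ) : Fin (2 + (2 + r)) → ℂ :=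
  vec (ε * (-p.1 * p.2.2 + cpair L p.2.1 p.2.1 / 2)) ε p.1 p.2.2 p.2.1

variable {L} {ε : ℤ}

lemma sign_mul_self (hε : ε * ε = 1) : (ε : ℂ) * ε = 1 := by exact_mod_cast hε

lemma cpair_phi_self (hε : ε * ε = 1) (p) : cpair (M2U L) (phi L ε p) (phi L ε p) = 0 := by
  rw [phi, cpair_vec]
  linear_combination (2 * (-p.1 * p.2.2 + cpair L p.2.1 p.2.1 / 2)) * sign_mul_self hε

lemma re_cpair_phi_conj (hε : ε * ε = 1) (p) :
    (cpair (M2U L) (phi L ε p) fun i => (starRingEnd ℂ) (phi L ε p i)).re = 2 * rho L p := by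
  obtain ⟨τ, z, ω⟩ := p
  have h1 := re_cpair_self_sub L z
  have h2 : (ε : ℝ) * ε = 1 := by exact_mod_cast hε
  rw [phi, vec_map, cpair_vec, rho]
  simp only [map_mul, map_add, map_neg, map_div₀, Complex.add_re, Complex.mul_re, Complex.sub_re,
    Complex.conj_re, Complex.conj_im, Complex.intCast_re, Complex.intCast_im, Complex.neg_re,
    Complex.neg_im, Complex.mul_im, Complex.add_im, map_intCast, map_ofNat]
  have h3 : (cpair L z z / 2).re = (cpair L z z).re / 2 := by simp
  have h4 : ((starRingEnd ℂ) (cpair L z z) / 2).re = (cpair L z z).re / 2 := by simp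
  rw [h3, h4]
  linear_combination h1 + 2 * (-(τ.re * ω.re) + τ.im * ω.im + (cpair L z z).re / 2) * h2

lemma smul_mem_cone_iff {n : ℕ} {B : Matrix (Fin n) (Fin n) ℤ} {t : ℂ} (ht : t ≠ 0)
    {Z : Fin n → ℂ} : t • Z ∈ Cone B ↔ Z ∈ Cone B := by
  have h1 : (fun i => (starRingEnd ℂ) ((t • Z) i)) =
      (starRingEnd ℂ) t • fun i => (starRingEnd ℂ) (Z i) := by
    ext i; simp
  simp only [Cone, Set.mem_ofPred_eq]
  rw [h1]
  simp only [cpair_smul_left, cpair_smul_right]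
  rw [← mul_assoc ((starRingEnd ℂ) t), mul_comm ((starRingEnd ℂ) t), Complex.mul_conj,
    Complex.re_ofReal_mul,
    mul_pos_iff_of_pos_left (Complex.normSq_pos.2 ht)]
  simp [ht]

lemma phi_mem_cone_iff (hε : ε * ε = 1) {p} : phi L ε p ∈ Cone (M2U L) ↔ 0 < rho L p := by
  simp only [Cone, Set.mem_ofPred_eq, cpair_phi_self hε, re_cpair_phi_conj hε, true_and]
  constructor <;> intro h <;> linarith

variable (L ε) in
/-- The affine cone over the image of the tube domain. -/
def Part : Set (Fin (2 + (2 + r)) → ℂ) :=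
  {Z | ∃ (t : ℂ) (p : ℂ × (Fin r → ℂ) × ℂ), t ≠ 0 ∧ p ∈ Tube L ∧ Z = t • phi L ε p}

lemma part_subset_cone (hε : ε * ε = 1) : Part L ε ⊆ Cone (M2U L) := by
  rintro _ ⟨t, p, ht, hp, rfl⟩
  rw [smul_mem_cone_iff ht, phi_mem_cone_iff hε]
  exact hp.2

lemma smul_phi_inj (hε : ε * ε = 1) {t s : ℂ} {p q : ℂ × (Fin r → ℂ) × ℂ}
    (h : t • phi L ε p = s • phi L ε q)
    (ht : t ≠ 0) : t = s ∧ p = q := by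
  have hε0 : (ε : ℂ) ≠ 0 := by
    intro h0; have := sign_mul_self hε; simp [h0] at this
  rw [phi, phi, smul_vec, smul_vec] at h
  obtain ⟨_, h2, h3, h4, h5⟩ := vec_inj h
  have hts := mul_right_cancel₀ hε0 h2
  subst hts
  refine ⟨rfl, Prod.ext (mul_left_cancel₀ ht h3) (Prod.ext ?_ (mul_left_cancel₀ ht h4))⟩
  exact smul_right_injective _ ht h5

lemma phi_mem_part_iff (hε : ε * ε = 1) {p} : phi L ε p ∈ Part L ε ↔ p ∈ Tube L := by
  constructor
  · rintro ⟨t, q, ht, hq, h⟩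
    rw [← one_smul ℂ (phi L ε p)] at h
    exact (smul_phi_inj hε h one_ne_zero).2 ▸ hq
  · exact fun h => ⟨1, p, one_ne_zero, h, (one_smul _ _).symm⟩

lemma differentiable_phi : Differentiable ℂ (phi L ε) := by
  refine differentiable_pi.2 fun i => ?_
  refine Fin.addCases (fun i => ?_) (fun i => Fin.addCases (fun i => ?_) (fun i => ?_) i) i
  · fin_cases i <;> simp [phi, vec, cpair]; fun_prop
  · fin_cases i <;> simp [phi, vec]
  · simp [phi, vec]; fun_prop

lemma continuous_phi : Continuous (phi L ε) := differentiable_phi.continuous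

lemma isPreconnected_tube : IsPreconnected (Tube L) := by
  have h1 : Tube L = (fun p : ℂ × (Fin r → ℂ) × ℂ =>
      (p.1, p.2.1, p.2.2 + Complex.I * (height L 0 p.1 p.2.1 : ℝ))) ''
      ({τ : ℂ | 0 < τ.im} ×ˢ (Set.univ ×ˢ {s : ℂ | 0 < s.im})) := by
    ext ⟨τ, z, ω⟩
    simp only [Set.mem_image, Set.mem_prod, Set.mem_ofPred_eq, Set.mem_univ, true_and, Prod.exists,
      Prod.mk.injEq]
    constructor
    · rintro ⟨h1, h2⟩
      rw [lt_rho_iff h1] at h2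
      exact ⟨τ, z, ω - Complex.I * (height L 0 τ z : ℝ), ⟨h1, by simpa using h2⟩, rfl, rfl,
        by ring⟩
    · rintro ⟨τ, z, s, ⟨h1, h2⟩, rfl, rfl, rfl⟩
      refine ⟨h1, ?_⟩
      rw [lt_rho_iff h1]
      simpa using h2
  rw [h1]
  refine IsPreconnected.image ?_ _ ?_
  · exact (convex_halfSpace_im_gt 0).isPreconnected.prod
      (isPreconnected_univ.prod (convex_halfSpace_im_gt 0).isPreconnected)
  · have hc : ContinuousOn (fun p : ℂ × (Fin r → ℂ) × ℂ => height L 0 p.1 p.2.1)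
        ({τ : ℂ | 0 < τ.im} ×ˢ (Set.univ ×ˢ {s : ℂ | 0 < s.im})) := by
      unfold height
      refine ContinuousOn.div ?_ ?_ ?_
      · unfold rpair vim; fun_prop
      · fun_prop
      · rintro ⟨τ, z, s⟩ ⟨h, _⟩
        exact mul_ne_zero two_ne_zero (ne_of_gt h)
    refine continuousOn_fst.prodMk (ContinuousOn.prodMk (by fun_prop) ?_)
    exact ContinuousOn.add (by fun_prop)
      (continuousOn_const.mul (Complex.continuous_ofReal.comp_continuousOn hc))

lemma isPreconnected_part : IsPreconnected (Part L ε) := by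
  have h1 : Part L ε = (fun q : ℂ × (ℂ × (Fin r → ℂ) × ℂ) => q.1 • phi L ε q.2) ''
      ({0}ᶜ ×ˢ Tube L) := by
    ext Z
    simp only [Part, Set.mem_ofPred_eq, Set.mem_image, Set.mem_prod, Set.mem_compl_iff,
      Set.mem_singleton_iff]
    constructor
    · rintro ⟨t, p, ht, hp, rfl⟩
      exact ⟨(t, p), ⟨ht, hp⟩, rfl⟩
    · rintro ⟨⟨t, p⟩, ⟨ht, hp⟩, rfl⟩
      exact ⟨t, p, ht, hp, rfl⟩
  rw [h1]
  refine IsPreconnected.image ?_ _ ?_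
  · refine IsPreconnected.prod ?_ isPreconnected_tube
    exact (isConnected_compl_singleton_of_one_lt_rank (by simp) 0).isPreconnected
  · exact (continuous_fst.smul (continuous_phi.comp continuous_snd)).continuousOn

variable (hL : IsEvenPosDef L)
include hL

lemma second_coord_ne_zero {a b c d : ℂ} {z : Fin r → ℂ} (h : vec a b c d z ∈ Cone (M2U L)) :
    b ≠ 0 := by
  rintro rfl
  have hc : c ≠ 0 := by
    rintro rfl
    obtain ⟨h1, h2⟩ := h
    rw [cpair_vec] at h1
    rw [vec_map, cpair_vec] at h2
    have h3 := re_cpair_self_sub L z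
    have h4 := rpair_self_nonneg hL (vim z)
    have h5 : (cpair L z z).re = 0 := by
      have : cpair L z z = 0 := by linear_combination -h1
      simp [this]
    simp at h2
    linarith
  have h' := (smul_mem_cone_iff (inv_ne_zero hc)).2 h
  rw [smul_vec, inv_mul_cancel₀ hc, mul_zero] at h'
  generalize c⁻¹ • z = y at h'
  generalize c⁻¹ * d = e at h'
  obtain ⟨h1, h2⟩ := h'
  rw [cpair_vec] at h1
  rw [vec_map, cpair_vec] at h2
  have h3 := re_cpair_self_sub L y
  have h4 := rpair_self_nonneg hL (vim y)
  have h5 : (cpair L y y).re = 2 * e.re := by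
    have : cpair L y y = e + e := by linear_combination -h1
    rw [this, Complex.add_re]; ring
  simp at h2
  linarith

lemma cone_eq : Cone (M2U L) = Part L 1 ∪ Part L (-1) := by
  refine Set.Subset.antisymm (fun Z hZ => ?_)
    (Set.union_subset (part_subset_cone (by norm_num)) (part_subset_cone (by norm_num)))
  obtain ⟨a, b, c, d, z, rfl⟩ := vec_induction Z
  have hb := second_coord_ne_zero hL hZ
  have hp : vec a b c d z = b • phi L 1 (b⁻¹ * c, b⁻¹ • z, b⁻¹ * d) := by
    have h1 := hZ.1
    rw [cpair_vec] at h1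
    rw [phi, smul_vec]
    refine vec_ext ?_ ?_ ?_ ?_ ?_
    · simp only [cpair_smul_left, cpair_smul_right]
      field_simp
      push_cast
      linear_combination h1
    · simp
    · field_simp
    · field_simp
    · rw [smul_smul, mul_inv_cancel₀ hb, one_smul]
  rw [hp] at hZ ⊢
  rw [smul_mem_cone_iff hb, phi_mem_cone_iff (by norm_num)] at hZ
  generalize b⁻¹ * c = τ at hZ ⊢
  generalize b⁻¹ * d = ω at hZ ⊢
  generalize b⁻¹ • z = y at hZ ⊢
  have h4 := rpair_self_nonneg hL (vim y)
  have hZ' := hZ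
  simp only [rho] at hZ'
  rcases lt_trichotomy τ.im 0 with h | h | h
  · right
    refine ⟨-b, (-τ, -y, -ω), neg_ne_zero.2 hb, ⟨by simpa using h, ?_⟩, ?_⟩
    · have : vim (-y) = (-1 : ℝ) • vim y := by ext i; simp [vim]
      simp only [rho, this, rpair_smul_left, rpair_smul_right, Complex.neg_im]
      linarith
    · have : -y = (-1 : ℂ) • y := by simp
      rw [phi, phi, smul_vec, smul_vec]
      simp only [this, cpair_smul_left, cpair_smul_right]
      refine vec_ext ?_ ?_ ?_ ?_ ?_
      · push_cast; ring
      · push_cast; ring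
      · ring
      · ring
      · simp
  · rw [h] at hZ'; linarith
  · left
    exact ⟨b, _, hb, ⟨h, hZ⟩, rfl⟩

omit hL in
/-- A function whose sign separates the two components. -/
lemma part_sign {Z} (hZ : Z ∈ Part L ε) :
    ∃ s : ℝ, 0 < s ∧ (Z (Fin.natAdd 2 (Fin.castAdd r 0)) *
      (starRingEnd ℂ) (Z (Fin.castAdd (2 + r) 1))).im = ε * s := by
  obtain ⟨t, p, ht, hp, rfl⟩ := hZ
  refine ⟨Complex.normSq t * p.1.im, mul_pos (Complex.normSq_pos.2 ht) hp.1, ?_⟩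
  simp [phi, vec, Complex.normSq_apply]
  ring

lemma exists_sign {D} (hD : IsComponent (M2U L) D) : ∃ ε : ℤ, ε * ε = 1 ∧ D = Part L ε := by
  obtain ⟨Z₀, hZ₀, hZ₀D⟩ : ∃ Z ∈ Cone (M2U L), Z ∈ D := by
    obtain ⟨Z, hZ, rfl⟩ := hD
    exact ⟨Z, hZ, mem_connectedComponentIn hZ⟩
  have hc : ContinuousOn (fun Z : Fin (2 + (2 + r)) → ℂ => (Z (Fin.natAdd 2 (Fin.castAdd r 0)) *
      (starRingEnd ℂ) (Z (Fin.castAdd (2 + r) 1))).im) D := by fun_prop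
  have hmix : ∀ Z ∈ D, ∀ W ∈ D, Z ∈ Part L (-1) → W ∈ Part L 1 → False := by
    intro Z hZ W hW hZ1 hW1
    obtain ⟨s, hs, h1⟩ := part_sign hZ1
    obtain ⟨s', hs', h2⟩ := part_sign hW1
    obtain ⟨V, hV, h3⟩ := hD.isPreconnected.intermediate_value hZ hW hc
      (show (0 : ℝ) ∈ Set.Icc _ _ by
        simp only [h1, h2]; push_cast; constructor <;> linarith)
    have h4 := hD.subset hV
    rw [cone_eq hL] at h4
    simp only at h3
    rcases h4 with h4 | h4 <;> obtain ⟨s, hs, h5⟩ := part_sign h4 <;> rw [h3] at h5 <;>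
      push_cast at h5 <;> linarith
  have hsub : ∀ Z ∈ D, Z ∈ Part L 1 ∨ Z ∈ Part L (-1) := fun Z hZ => by
    have := hD.subset hZ
    rwa [cone_eq hL] at this
  rcases hsub Z₀ hZ₀D with h | h
  · refine ⟨1, by norm_num, Set.Subset.antisymm (fun Z hZ => ?_)
      (hD.subset_of_mem isPreconnected_part (part_subset_cone (by norm_num)) h hZ₀D)⟩
    exact (hsub Z hZ).resolve_right fun h' => hmix Z hZ Z₀ hZ₀D h' h
  · refine ⟨-1, by norm_num, Set.Subset.antisymm (fun Z hZ => ?_)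
      (hD.subset_of_mem isPreconnected_part (part_subset_cone (by norm_num)) h hZ₀D)⟩
    exact (hsub Z hZ).resolve_left fun h' => hmix Z₀ hZ₀D Z hZ h h'

end TubeModel

/-- Modular forms for the whole group `O⁺` with trivial character, extended by zero. -/
structure InvForm {n : ℕ} (B : Matrix (Fin n) (Fin n) ℤ) (D : Set (Fin n → ℂ)) (k : ℤ)
    (F : (Fin n → ℂ) → ℂ) : Prop where
  holo : DifferentiableOn ℂ F D
  zero_off : ∀ Z ∉ D, F Z = 0
  homogeneous : ∀ t : ℂ, t ≠ 0 → ∀ Z ∈ D, F (t • Z) = t ^ (-k) * F Z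
  invariant : ∀ g ∈ OPlus B D, ∀ Z, F (actC g Z) = F Z

section Restriction
variable {r : ℕ} {L : Matrix (Fin r) (Fin r) ℤ} {ε : ℤ} {k : ℤ} {F : (Fin (2 + (2 + r)) → ℂ) → ℂ}

lemma InvForm.transv_one {D : Set (Fin (2 + (2 + r)) → ℂ)} (hF : InvForm (M2U L) D k F)
    (hD : IsComponent (M2U L) D) {u a : Fin (2 + (2 + r)) → ℤ} {q : ℤ}
    (h : IsEichler (M2U L) u a q) (Z) : F (transv (M2U L) u a q 1 Z) = F Z := by
  rw [← actC_transvMat_one h.symm]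
  exact hF.invariant _ (transvMat_mem hD h) Z

/-- The isometry swapping the two basis vectors of the second hyperbolic plane. -/
def swapMat (L : Matrix (Fin r) (Fin r) ℤ) : Matrix (Fin (2 + (2 + r))) (Fin (2 + (2 + r))) ℤ :=
  1 + vecMulVec (vec 0 0 1 (-1) 0) ((M2U L).mulVec (vec 0 0 1 (-1) 0))

lemma intC_zero {n : ℕ} : intC (0 : Fin n → ℤ) = 0 := by ext i; simp [intC]

lemma actC_swapMat (hL : L.IsSymm) (a b c d : ℂ) (z : Fin r → ℂ) :
    actC (swapMat L) (vec a b c d z) = vec a b d c z := by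
  rw [swapMat, actC_add, actC_one, actC_vecMulVec, sum_mulVec_mul (M2U_isSymm hL), intC_vec,
    cpair_vec, smul_vec, vec_add]
  refine vec_ext ?_ ?_ ?_ ?_ ?_ <;> simp [intC_zero, cpair_zero_left]

lemma actC_swapMat_phi (hL : L.IsSymm) (τ z ω) :
    actC (swapMat L) (phi L ε (τ, z, ω)) = phi L ε (ω, z, τ) := by
  rw [phi, actC_swapMat hL, phi, neg_mul, neg_mul, mul_comm τ]

lemma swapMat_mem (hL : IsEvenPosDef L) : swapMat L ∈ OPlus (M2U L) (Part L ε) := by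
  have hsub : actC (swapMat L) '' Part L ε ⊆ Part L ε := by
    rintro _ ⟨_, ⟨t, ⟨τ, z, ω⟩, ht, hp, rfl⟩, rfl⟩
    refine ⟨t, (ω, z, τ), ht, ⟨tube_im_pos hL hp, ?_⟩, ?_⟩
    · rw [rho_swap]; exact hp.2
    · rw [actC_smul, actC_swapMat_phi hL.1]
  refine ⟨gram_of_cpair_one fun Z W => ?_, Set.Subset.antisymm hsub fun Z hZ => ?_⟩
  · obtain ⟨a, b, c, d, z, rfl⟩ := vec_induction Z
    obtain ⟨a', b', c', d', z', rfl⟩ := vec_induction W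
    rw [actC_swapMat hL.1, actC_swapMat hL.1, cpair_vec, cpair_vec]
    ring
  · refine ⟨_, hsub ⟨Z, hZ, rfl⟩, ?_⟩
    obtain ⟨a, b, c, d, z, rfl⟩ := vec_induction Z
    rw [actC_swapMat hL.1, actC_swapMat hL.1]

lemma qnorm_zero {n : ℕ} (B : Matrix (Fin n) (Fin n) ℤ) : qnorm B 0 = 0 := by simp [qnorm]

lemma zpair_zero_left {n : ℕ} (B : Matrix (Fin n) (Fin n) ℤ) (x) : zpair B 0 x = 0 := by
  simp [zpair]

lemma isEichler_trans (hL : IsEvenPosDef L) (μ : Fin r → ℤ) :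
    IsEichler (M2U L) (vec ε 0 0 0 0) (vec 0 0 0 0 μ) (-(qnorm L μ / 2)) where
  symm := M2U_isSymm hL.1
  isotropic := by rw [qnorm_vec, qnorm_zero]; ring
  orth := by rw [zpair_vec, zpair_zero_left]; ring
  norm := by
    rw [qnorm_vec]
    have := Int.mul_ediv_cancel' (hL.2.1 μ)
    linarith

lemma isEichler_shift (hL : IsEvenPosDef L) :
    IsEichler (M2U L) (vec ε 0 0 0 0) (vec 0 0 1 0 0) 0 where
  symm := M2U_isSymm hL.1
  isotropic := by rw [qnorm_vec, qnorm_zero]; ring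
  orth := by rw [zpair_vec, zpair_zero_left]; ring
  norm := by rw [qnorm_vec, qnorm_zero]; ring

lemma isEichler_heis (hL : IsEvenPosDef L) (l : Fin r → ℤ) :
    IsEichler (M2U L) (vec 0 0 0 1 0) (vec 0 0 0 0 l) (-(qnorm L l / 2)) where
  symm := M2U_isSymm hL.1
  isotropic := by rw [qnorm_vec, qnorm_zero]; ring
  orth := by rw [zpair_vec, zpair_zero_left]; ring
  norm := by
    rw [qnorm_vec]
    have := Int.mul_ediv_cancel' (hL.2.1 l)
    linarith

lemma isEichler_unip (hL : IsEvenPosDef L) :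
    IsEichler (M2U L) (vec 0 ε 0 0 0) (vec 0 0 0 1 0) 0 where
  symm := M2U_isSymm hL.1
  isotropic := by rw [qnorm_vec, qnorm_zero]; ring
  orth := by rw [zpair_vec, zpair_zero_left]; ring
  norm := by rw [qnorm_vec, qnorm_zero]; ring

lemma cast_half_qnorm (hL : IsEvenPosDef L) (l : Fin r → ℤ) :
    ((qnorm L l / 2 : ℤ) : ℂ) = (qnorm L l : ℂ) / 2 := by
  rw [Int.cast_div (hL.2.1 l) (by norm_num)]; norm_num

lemma transv_trans (hL : IsEvenPosDef L) (hε : ε * ε = 1) (μ : Fin r → ℤ) (θ : ℝ) (τ z ω) :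
    transv (M2U L) (vec ε 0 0 0 0) (vec 0 0 0 0 μ) (-(qnorm L μ / 2)) θ (phi L ε (τ, z, ω)) =
      phi L ε (τ, z + (θ : ℂ) • intC μ, ω) := by
  have h2 := sign_mul_self hε
  rw [transv, phi, phi, intC_vec, intC_vec, cpair_vec, cpair_vec, smul_vec, smul_vec, vec_add,
    vec_add, intC_zero, cpair_zero_left]
  push_cast
  rw [cast_half_qnorm hL]
  refine vec_ext ?_ ?_ ?_ ?_ ?_
  · simp only [cpair_add_left, cpair_add_right, cpair_smul_left, cpair_smul_right,
      cpair_comm hL.1 z (intC μ), cpair_intC_self]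
    linear_combination (θ ^ 2 * (qnorm L μ : ℂ) / 2 * ε) * h2
  · ring
  · ring
  · ring
  · ext i
    simp only [Pi.add_apply, Pi.smul_apply, smul_eq_mul, Pi.zero_apply]
    linear_combination (θ * intC μ i) * h2

lemma transv_shift (hε : ε * ε = 1) (τ z ω) :
    transv (M2U L) (vec ε 0 0 0 0) (vec 0 0 1 0 0) 0 1 (phi L ε (τ, z, ω)) =
      phi L ε (τ + 1, z, ω) := by
  have h2 := sign_mul_self hε
  rw [transv, phi, phi, intC_vec, intC_vec, cpair_vec, cpair_vec, smul_vec, smul_vec, vec_add,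
    vec_add, intC_zero, cpair_zero_left]
  push_cast
  refine vec_ext ?_ ?_ ?_ ?_ ?_
  · ring
  · ring
  · linear_combination h2
  · ring
  · simp

lemma transv_heis (hL : IsEvenPosDef L) (l : Fin r → ℤ) (τ z ω) :
    transv (M2U L) (vec 0 0 0 1 0) (vec 0 0 0 0 l) (-(qnorm L l / 2)) 1 (phi L ε (τ, z, ω)) =
      phi L ε (τ, z + τ • intC l, ω + cpair L (intC l) z + (qnorm L l : ℂ) / 2 * τ) := by
  rw [transv, phi, phi, intC_vec, intC_vec, cpair_vec, cpair_vec, smul_vec, smul_vec, vec_add,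
    vec_add, intC_zero, cpair_zero_left]
  push_cast
  rw [cast_half_qnorm hL]
  refine vec_ext ?_ ?_ ?_ ?_ ?_
  · simp only [cpair_add_left, cpair_add_right, cpair_smul_left, cpair_smul_right,
      cpair_comm hL.1 z (intC l), cpair_intC_self]
    ring
  · ring
  · ring
  · ring
  · simp

lemma transv_unip (hε : ε * ε = 1) {τ : ℂ} (hτ : 1 - τ ≠ 0) (ω : ℂ) :
    transv (M2U L) (vec 0 ε 0 0 0) (vec 0 0 0 1 0) 0 1 (phi L ε (τ, 0, ω)) =
      (1 - τ) • phi L ε (τ / (1 - τ), 0, ω) := by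
  have h2 := sign_mul_self hε
  rw [transv, phi, phi, intC_vec, intC_vec, cpair_vec, cpair_vec, smul_vec, smul_vec, vec_add,
    vec_add, intC_zero, cpair_zero_left, smul_vec]
  push_cast
  refine vec_ext ?_ ?_ ?_ ?_ ?_
  · field_simp; simp
  · ring
  · field_simp; ring
  · linear_combination (-τ * ω) * h2
  · simp

lemma InvForm.jac (hL : IsEvenPosDef L) (hε : ε * ε = 1) (hD : IsComponent (M2U L) (Part L ε))
    (hF : InvForm (M2U L) (Part L ε) k F) : Jac L k fun p => F (phi L ε p) where
  holo := hF.holo.comp differentiable_phi.differentiableOn fun p hp => (phi_mem_part_iff hε).2 hp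
  zero_off p hp := hF.zero_off _ fun h => hp ((phi_mem_part_iff hε).1 h)
  shift τ z ω := by
    rw [← transv_shift hε, hF.transv_one hD (isEichler_shift hL)]
  trans τ z ω μ := by
    have := transv_trans hL hε μ 1 τ z ω
    rw [Complex.ofReal_one, one_smul] at this
    rw [← this, hF.transv_one hD (isEichler_trans hL μ)]
  swap τ z ω := by
    rw [← actC_swapMat_phi hL.1, hF.invariant _ (swapMat_mem hL)]
  heis τ z ω l := by
    rw [← transv_heis hL, hF.transv_one hD (isEichler_heis hL l)]
  unip τ ω hτ hω := by
    have h1 : 1 - τ ≠ 0 := by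
      intro h
      have : τ = 1 := by linear_combination -h
      rw [this] at hτ
      simp at hτ
    have him : 0 < (τ / (1 - τ)).im := by
      have : (τ / (1 - τ)).im = τ.im / Complex.normSq (1 - τ) := by
        rw [Complex.div_im]; simp; ring
      rw [this]
      exact div_pos hτ (Complex.normSq_pos.2 h1)
    have h2 := hF.transv_one hD (isEichler_unip (ε := ε) hL) (phi L ε (τ, 0, ω))
    rw [transv_unip hε h1, hF.homogeneous _ h1 _ ((phi_mem_part_iff hε).2 (mem_tube_zero him hω))]
      at h2
    rw [← h2, ← mul_assoc, ← zpow_add₀ h1, add_neg_cancel, zpow_zero, one_mul]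

lemma zerosNormTwo (hL : IsEvenPosDef L) (hε : ε * ε = 1)
    (hZ : ∀ Z ∈ Part L ε, F Z = 0 → ∃ v, qnorm (M2U L) v = -2 ∧ OrthZ (M2U L) Z v) :
    ZerosNormTwo L fun p => F (phi L ε p) := by
  intro τ z ω hp h0
  obtain ⟨v, hv, ho⟩ := hZ _ ((phi_mem_part_iff hε).2 hp) h0
  obtain ⟨a, b, c, d, l, rfl⟩ := vec_induction v
  refine ⟨ε * a, ε * b, c, d, l, ?_, ?_⟩
  · rw [qnorm_vec] at hv
    linear_combination hv + 2 * a * b * hε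
  · rw [OrthZ, phi, intC_vec, cpair_vec] at ho
    have hc := cpair_comm hL.1 (intC l) z
    push_cast
    linear_combination ho - hc

end Restriction

section Products
variable {n : ℕ} {B : Matrix (Fin n) (Fin n) ℤ} {D : Set (Fin n → ℂ)}

lemma OPlus.mul_mem {g h} (hg : g ∈ OPlus B D) (hh : h ∈ OPlus B D) : g * h ∈ OPlus B D := by
  refine ⟨?_, ?_⟩
  · rw [transpose_mul, Matrix.mul_assoc, Matrix.mul_assoc, ← Matrix.mul_assoc B,
      ← Matrix.mul_assoc gᵀ, ← Matrix.mul_assoc gᵀ, hg.1, ← Matrix.mul_assoc, hh.1]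
  · have : actC (g * h) = actC g ∘ actC h := funext (actC_mul g h)
    rw [this, Set.image_comp, hh.2, hg.2]

lemma OPlus.one_mem : 1 ∈ OPlus B D := by
  refine ⟨by simp, ?_⟩
  have : actC (1 : Matrix (Fin n) (Fin n) ℤ) = id := funext actC_one
  rw [this, Set.image_id]

lemma OPlus.exists_inv (hB : B.det ≠ 0) {g} (hg : g ∈ OPlus B D) :
    ∃ h ∈ OPlus B D, g * h = 1 ∧ h * g = 1 := by
  have h1 := congrArg Matrix.det hg.1
  rw [det_mul, det_mul, det_transpose] at h1
  have h2 : g.det * g.det = 1 := by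
    apply mul_right_cancel₀ hB
    linear_combination h1
  have hu : IsUnit g.det := IsUnit.of_mul_eq_one _ h2
  have h3 := mul_nonsing_inv g hu
  have h4 := nonsing_inv_mul g hu
  refine ⟨g⁻¹, ⟨?_, ?_⟩, h3, h4⟩
  · have h5 : g⁻¹ᵀ * gᵀ = 1 := by rw [← transpose_mul, h3, transpose_one]
    conv_lhs => rw [← hg.1]
    rw [Matrix.mul_assoc, Matrix.mul_assoc _ g, h3, Matrix.mul_one, ← Matrix.mul_assoc, h5,
      Matrix.one_mul]
  · conv_lhs => rw [← hg.2]
    rw [← Set.image_comp]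
    have : actC g⁻¹ ∘ actC g = id := by
      ext Z : 1
      rw [Function.comp_apply, ← actC_mul, h4, actC_one, id]
    rw [this, Set.image_id]

lemma OPlus.mem_iff (hB : B.det ≠ 0) {g} (hg : g ∈ OPlus B D) (Z : Fin n → ℂ) :
    actC g Z ∈ D ↔ Z ∈ D := by
  constructor
  · intro h
    obtain ⟨h', hh, _, h1⟩ := OPlus.exists_inv hB hg
    have : actC h' (actC g Z) ∈ D := hh.2 ▸ Set.mem_image_of_mem _ h
    rwa [← actC_mul, h1, actC_one] at this
  · intro h
    exact hg.2 ▸ Set.mem_image_of_mem _ h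

open Classical in
/-- The product of `G ∘ Φ` over `Φ ∈ S` on `D`, extended by zero. -/
noncomputable def prodForm (D : Set (Fin n → ℂ)) (S : Finset ((Fin n → ℂ) → ℂ)) (G : ℂ → ℂ)
    (Z : Fin n → ℂ) : ℂ :=
  if Z ∈ D then ∏ Φ ∈ S, G (Φ Z) else 0

lemma prodForm_of_mem {S : Finset ((Fin n → ℂ) → ℂ)} {G : ℂ → ℂ} {Z : Fin n → ℂ} (hZ : Z ∈ D) :
    prodForm D S G Z = ∏ Φ ∈ S, G (Φ Z) := if_pos hZ

open Classical in
lemma prodForm_invariant (hB : B.det ≠ 0) {S : Finset ((Fin n → ℂ) → ℂ)}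
    (hS : ∀ g ∈ OPlus B D, ∀ Φ ∈ S, (fun Z => Φ (actC g Z)) ∈ S) (G : ℂ → ℂ)
    {g} (hg : g ∈ OPlus B D) (Z : Fin n → ℂ) :
    prodForm D S G (actC g Z) = prodForm D S G Z := by
  unfold prodForm
  simp only [OPlus.mem_iff hB hg]
  split_ifs with hZ
  · have hinj : Set.InjOn (fun (Φ : (Fin n → ℂ) → ℂ) Z => Φ (actC g Z)) S := by
      intro Φ _ Ψ _ h
      obtain ⟨h', _, h1, _⟩ := OPlus.exists_inv hB hg
      ext W
      have := congrFun h (actC h' W)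
      simpa only [← actC_mul, h1, actC_one] using this
    have himg : S.image (fun (Φ : (Fin n → ℂ) → ℂ) Z => Φ (actC g Z)) = S := by
      refine Finset.eq_of_subset_of_card_le (fun Ψ hΨ => ?_) (Finset.card_image_of_injOn hinj).ge
      obtain ⟨Φ, hΦ, rfl⟩ := Finset.mem_image.1 hΨ
      exact hS g hg Φ hΦ
    conv_rhs => rw [← himg, Finset.prod_image hinj]
  · rfl

open Classical in
lemma prodForm_invForm (hB : B.det ≠ 0) (hD : ∀ t : ℂ, t ≠ 0 → ∀ Z ∈ D, t • Z ∈ D)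
    {S : Finset ((Fin n → ℂ) → ℂ)}
    (hS : ∀ g ∈ OPlus B D, ∀ Φ ∈ S, (fun Z => Φ (actC g Z)) ∈ S) {G : ℂ → ℂ}
    (hG : Differentiable ℂ G) (hd : ∀ Φ ∈ S, DifferentiableOn ℂ Φ D) {k : ℤ}
    (hk : ∀ Φ ∈ S, ∀ t : ℂ, t ≠ 0 → ∀ Z ∈ D, G (Φ (t • Z)) = t ^ (-k) * G (Φ Z)) :
    InvForm B D (k * S.card) (prodForm D S G) where
  holo := by
    have : DifferentiableOn ℂ (fun Z => ∏ Φ ∈ S, G (Φ Z)) D := by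
      clear hS hk
      induction S using Finset.induction_on with
      | empty => simp
      | insert a s ha ih =>
        simp only [Finset.prod_insert ha]
        exact (hG.comp_differentiableOn (hd a (Finset.mem_insert_self a s))).mul
          (ih fun Φ hΦ => hd Φ (Finset.mem_insert_of_mem hΦ))
    exact this.congr fun Z hZ => prodForm_of_mem hZ
  zero_off Z hZ := if_neg hZ
  homogeneous t ht Z hZ := by
    rw [prodForm_of_mem hZ, prodForm_of_mem (hD t ht Z hZ),
      Finset.prod_congr rfl fun Φ hΦ => hk Φ hΦ t ht Z hZ, Finset.prod_mul_distrib,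
      Finset.prod_const, ← zpow_natCast, ← _root_.zpow_mul, neg_mul]
  invariant g hg Z := prodForm_invariant hB hS G hg Z

lemma constant_of_finite_values {X : Type*} [TopologicalSpace X] {D : Set X} {F : X → ℂ}
    (hD : IsPreconnected D) (hF : ContinuousOn F D) (hfin : (F '' D).Finite) {x y : X}
    (hx : x ∈ D) (hy : y ∈ D) : F x = F y := by
  by_contra hne
  exact (hD.image F hF).infinite_of_nontrivial ⟨_, ⟨x, hx, rfl⟩, _, ⟨y, hy, rfl⟩, hne⟩ hfin

end Products

section Hecke
variable {n : ℕ} {B : Matrix (Fin n) (Fin n) ℤ} {D : Set (Fin n → ℂ)}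

/-- A finite family of weight zero forms permuted by the orthogonal group consists of functions
which are constant wherever all invariant forms of weight zero are. -/
lemma const_of_finite_orbit (hB : B.det ≠ 0) (hD : ∀ t : ℂ, t ≠ 0 → ∀ Z ∈ D, t • Z ∈ D)
    {Y : Set (Fin n → ℂ)} (hYD : Y ⊆ D) (hY : IsPreconnected Y)
    (hconst : ∀ E, InvForm B D 0 E → ∀ x ∈ Y, ∀ y ∈ Y, E x = E y)
    {S : Set ((Fin n → ℂ) → ℂ)} (hfin : S.Finite)
    (hS : ∀ g ∈ OPlus B D, ∀ Φ ∈ S, (fun Z => Φ (actC g Z)) ∈ S)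
    (hd : ∀ Φ ∈ S, DifferentiableOn ℂ Φ D)
    (hh : ∀ Φ ∈ S, ∀ t : ℂ, t ≠ 0 → ∀ Z ∈ D, Φ (t • Z) = Φ Z)
    {Φ : (Fin n → ℂ) → ℂ} (hΦ : Φ ∈ S) {x y : Fin n → ℂ} (hx : x ∈ Y) (hy : y ∈ Y) :
    Φ x = Φ y := by
  refine constant_of_finite_values hY ((hd Φ hΦ).continuousOn.mono hYD)
    ((hfin.image fun Ψ => Ψ y).subset ?_) hx hy
  rintro _ ⟨w, hw, rfl⟩
  lift S to Finset ((Fin n → ℂ) → ℂ) using hfin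
  have hE := prodForm_invForm hB hD (S := S) (G := fun v => Φ w - v) (k := 0) hS (by fun_prop) hd
    fun Ψ hΨ t ht Z hZ => by simp [hh Ψ hΨ t ht Z hZ]
  rw [zero_mul] at hE
  have h1 := hconst _ hE w hw y hy
  rw [prodForm_of_mem (hYD hw), prodForm_of_mem (hYD hy),
    Finset.prod_eq_zero (f := fun Ψ => Φ w - Ψ w) hΦ (sub_self _)] at h1
  obtain ⟨Ψ, hΨ, h2⟩ := Finset.prod_eq_zero_iff.1 h1.symm
  exact ⟨Ψ, hΨ, (sub_eq_zero.1 h2).symm⟩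

lemma eq_of_actC_eq {g h : Matrix (Fin n) (Fin n) ℤ} (H : ∀ Z, actC g Z = actC h Z) : g = h := by
  ext i j
  have := congrFun (H (Pi.single j 1)) i
  simpa [actC] using this

lemma finite_image_of_factor {α β γ : Type*} [Finite γ] (ρ : α → γ) (φ : α → β) (s : Set α)
    (h : ∀ x ∈ s, ∀ y ∈ s, ρ x = ρ y → φ x = φ y) : (φ '' s).Finite := by
  classical
  have hfin : (ρ '' s).Finite := Set.toFinite _
  rcases s.eq_empty_or_nonempty with rfl | ⟨x₀, hx₀⟩
  · simp
  refine (hfin.image fun c => if hc : ∃ x ∈ s, ρ x = c then φ hc.choose else φ x₀).subset ?_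
  rintro _ ⟨x, hx, rfl⟩
  have hc : ∃ y ∈ s, ρ y = ρ x := ⟨x, hx, rfl⟩
  refine ⟨ρ x, ⟨x, hx, rfl⟩, ?_⟩
  exact (dif_pos hc).trans (h _ hc.choose_spec.1 _ hx hc.choose_spec.2)

variable {u a : Fin n → ℤ} {q : ℤ}

lemma transvMat_mul (h : IsEichler B u a q) {N : ℤ} (hN : N ≠ 0) :
    transvMat B u a q N * transvMat B u a q (-N) = N ^ 4 • 1 := by
  refine eq_of_actC_eq fun Z => ?_
  rw [actC_mul, actC_transvMat h.symm (neg_ne_zero.2 hN), actC_smul, actC_transvMat h.symm hN,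
    transv_transv h, smul_actC, actC_one]
  have : (1 / (N : ℝ) + 1 / ((-N : ℤ) : ℝ)) = 0 := by push_cast; ring
  rw [this, transv_zero, smul_smul]
  congr 1
  push_cast
  ring

lemma exists_conj (hB : B.det ≠ 0) (hD : IsComponent B D) (h : IsEichler B u a q) {N : ℤ}
    (hN : N ≠ 0) {g g' E : Matrix (Fin n) (Fin n) ℤ} (hg : g ∈ OPlus B D) (hg' : g' ∈ OPlus B D)
    (hE : g = g' + N ^ 4 • E) :
    ∃ k ∈ OPlus B D, k * (transvMat B u a q N * g') = transvMat B u a q N * g := by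
  obtain ⟨i, hi, hi1, hi2⟩ := OPlus.exists_inv hB hg'
  set A := transvMat B u a q N with hA
  set A' := transvMat B u a q (-N) with hA'
  have h1 : A * A' = N ^ 4 • 1 := transvMat_mul h hN
  have h2 : A' * A = N ^ 4 • 1 := by
    have := transvMat_mul h (neg_ne_zero.2 hN)
    rwa [neg_neg, Even.neg_pow (by decide)] at this
  set k := 1 + A * E * i * A' with hk
  have hkA : k * A = A * (g * i) := by
    rw [hk, hE, Matrix.add_mul, Matrix.one_mul, Matrix.mul_assoc _ A', h2, Matrix.add_mul, hi1,
      Matrix.mul_add, Matrix.mul_one]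
    simp only [Matrix.mul_assoc, Matrix.mul_smul, Matrix.smul_mul, Matrix.mul_one]
  have hN' : (N : ℂ) ≠ 0 := by exact_mod_cast hN
  have hact : ∀ Z, actC k Z =
      transv B u a q (1 / N) (actC (g * i) (transv B u a q (-(1 / N)) Z)) := by
    intro Z
    have h3 : actC (k * A * A') Z = actC (A * (g * i) * A') Z := by rw [hkA]
    rw [Matrix.mul_assoc, h1, actC_mul, smul_actC, actC_one, actC_smul, actC_mul, actC_mul,
      actC_transvMat h.symm (neg_ne_zero.2 hN), actC_smul, actC_smul, actC_transvMat h.symm hN,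
      smul_smul] at h3
    have h4 : (1 / ((-N : ℤ) : ℝ)) = -(1 / N) := by push_cast; ring
    rw [h4] at h3
    refine smul_right_injective _ (pow_ne_zero 4 hN') ?_
    beta_reduce
    convert h3 using 2
    · push_cast; ring
    · push_cast; ring
  have hgi : g * i ∈ OPlus B D := OPlus.mul_mem hg hi
  refine ⟨k, ⟨gram_of_cpair_one fun Z W => ?_, ?_⟩, ?_⟩
  · rw [hact, hact, cpair_transv h, cpair_actC hgi.1, cpair_transv h]
  · have : actC k = transv B u a q (1 / N) ∘ actC (g * i) ∘ transv B u a q (-(1 / N)) := funext hact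
    rw [this, Set.image_comp, Set.image_comp, transv_image hD h, hgi.2, transv_image hD h]
  · rw [← Matrix.mul_assoc, hkA, Matrix.mul_assoc, Matrix.mul_assoc, hi2, Matrix.mul_one]

lemma InvForm.transv_const {F : (Fin n → ℂ) → ℂ} (hF : InvForm B D 0 F) (hB : B.det ≠ 0)
    (hD : IsComponent B D) (hD' : ∀ t : ℂ, t ≠ 0 → ∀ Z ∈ D, t • Z ∈ D)
    (h : IsEichler B u a q) {N : ℤ} (hN : N ≠ 0)
    {Y : Set (Fin n → ℂ)} (hYD : Y ⊆ D) (hY : IsPreconnected Y)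
    (hconst : ∀ E, InvForm B D 0 E → ∀ x ∈ Y, ∀ y ∈ Y, E x = E y)
    {x y : Fin n → ℂ} (hx : x ∈ Y) (hy : y ∈ Y) :
    F (transv B u a q (1 / N) x) = F (transv B u a q (1 / N) y) := by
  have hN' : (N : ℂ) ≠ 0 := by exact_mod_cast hN
  have hF0 : ∀ t : ℂ, t ≠ 0 → ∀ Z ∈ D, F (t • Z) = F Z := fun t ht Z hZ => by
    rw [hF.homogeneous t ht Z hZ, neg_zero, zpow_zero, one_mul]
  set A := transvMat B u a q N with hA
  have hAD : ∀ g ∈ OPlus B D, ∀ Z ∈ D, actC (A * g) Z ∈ D := fun g hg Z hZ => by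
    rw [actC_mul, hA, actC_transvMat h.symm hN]
    exact hD' _ (pow_ne_zero 2 hN') _ (transv_mem hD h _ ((OPlus.mem_iff hB hg Z).2 hZ))
  set φ : Matrix (Fin n) (Fin n) ℤ → (Fin n → ℂ) → ℂ := fun g Z => F (actC (A * g) Z) with hφ
  have hfin : (φ '' OPlus B D).Finite := by
    have : NeZero (N ^ 4).natAbs := ⟨Int.natAbs_ne_zero.2 (pow_ne_zero 4 hN)⟩
    refine finite_image_of_factor
      (fun g : Matrix (Fin n) (Fin n) ℤ => fun i j => (g i j : ZMod (N ^ 4).natAbs)) φ _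
      fun g hg g' hg' hgg => ?_
    have hdvd : ∀ i j, ∃ e, g i j = g' i j + N ^ 4 * e := by
      intro i j
      have h1 := congrFun (congrFun hgg i) j
      have h2 := (ZMod.intCast_eq_intCast_iff_dvd_sub _ _ _).1 h1.symm
      rw [Int.natAbs_dvd] at h2
      obtain ⟨e, he⟩ := h2
      exact ⟨e, by linarith⟩
    choose e he using hdvd
    obtain ⟨k, hk, hkk⟩ := exists_conj hB hD h hN (E := Matrix.of e) hg hg'
      (by ext i j; simp [he])
    ext Z
    rw [hφ]
    beta_reduce
    rw [hA, ← hkk, actC_mul, hF.invariant k hk]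
  have key := const_of_finite_orbit hB hD' hYD hY hconst hfin ?_ ?_ ?_ (Φ := φ 1)
    ⟨1, OPlus.one_mem, rfl⟩ hx hy
  · simp only [hφ, Matrix.mul_one, hA, actC_transvMat h.symm hN] at key
    rwa [hF0 _ (pow_ne_zero 2 hN') _ (transv_mem hD h _ (hYD hx)),
      hF0 _ (pow_ne_zero 2 hN') _ (transv_mem hD h _ (hYD hy))] at key
  · rintro g hg _ ⟨g', hg', rfl⟩
    refine ⟨g' * g, OPlus.mul_mem hg' hg, ?_⟩
    ext Z
    simp only [hφ]
    rw [← actC_mul, Matrix.mul_assoc]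
  · rintro _ ⟨g, hg, rfl⟩
    exact hF.holo.comp (differentiable_actC _).differentiableOn (hAD g hg)
  · rintro _ ⟨g, hg, rfl⟩ t ht Z hZ
    simp only [hφ]
    rw [actC_smul, hF0 t ht _ (hAD g hg Z hZ)]

end Hecke

section WeightZero
variable {r : ℕ} {L : Matrix (Fin r) (Fin r) ℤ} {f : ℂ × (Fin r → ℂ) × ℂ → ℂ}

lemma Jac.const_fst (hf : Jac L 0 f) (hL : IsEvenPosDef L) {l : Fin r → ℤ} (hl : l ≠ 0)
    {τ τ' ω : ℂ} (hτ : 0 < τ.im) (hτ' : 0 < τ'.im) (hω : 0 < ω.im) :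
    f (τ, 0, ω) = f (τ', 0, ω) := by
  obtain ⟨F, hF⟩ := exists_modularForm (k := 0) (h := fun τ => f (τ, 0, ω))
    (fun τ hτ => hf.differentiableAt_fst hτ hω) (fun τ _ => hf.shift τ 0 ω)
    (fun τ hτ => by rw [hf.inversion hτ hω, zpow_zero, zpow_zero]) (by
      obtain ⟨C, hC⟩ := (hf.bounded_fst hL hl hω 0).bound
      rw [eventually_comap] at hC
      obtain ⟨A, hA⟩ := eventually_atTop.1 hC
      exact ⟨C, A, fun τ hτ => by simpa using hA _ hτ τ rfl⟩)
  obtain ⟨c, hc⟩ := ModularFormClass.levelOne_weight_zero_const F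
  have h : ∀ τ : ℂ, 0 < τ.im → f (τ, 0, ω) = c := fun τ hτ => by
    rw [← hF ⟨τ, hτ⟩, hc, Function.const_apply]
  rw [h τ hτ, h τ' hτ']

lemma Jac.const_slice (hf : Jac L 0 f) (hL : IsEvenPosDef L) {l : Fin r → ℤ} (hl : l ≠ 0)
    {τ τ' ω ω' : ℂ} (hτ : 0 < τ.im) (hτ' : 0 < τ'.im) (hω : 0 < ω.im) (hω' : 0 < ω'.im) :
    f (τ, 0, ω) = f (τ', 0, ω') := by
  rw [hf.const_fst hL hl hτ hτ' hω, ← hf.swap, hf.const_fst hL hl hω hω' hτ', hf.swap]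

lemma exists_rat_seq (x : Fin r → ℝ) : ∃ b : ℕ → Fin r → ℤ,
    Tendsto (fun N : ℕ => (1 / ((N + 1 : ℕ) : ℝ)) • intR (b N)) atTop (𝓝 x) := by
  refine ⟨fun N i => ⌊x i * (N + 1 : ℕ)⌋, tendsto_pi_nhds.2 fun i => ?_⟩
  have h0 : Tendsto (fun N : ℕ => x i - 1 / ((N : ℝ) + 1)) atTop (𝓝 (x i)) := by
    simpa using (tendsto_const_nhds (x := x i)).sub
      (tendsto_one_div_add_atTop_nhds_zero_nat (𝕜 := ℝ))
  refine tendsto_of_tendsto_of_tendsto_of_le_of_le h0 tendsto_const_nhds (fun N => ?_) fun N => ?_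
  · have hN : (0 : ℝ) < (N : ℝ) + 1 := by positivity
    have := Int.lt_floor_add_one (x i * ((N + 1 : ℕ) : ℝ))
    simp only [Pi.smul_apply, smul_eq_mul, intR]
    rw [sub_le_iff_le_add]
    push_cast at this ⊢
    field_simp
    linarith
  · have hN : (0 : ℝ) < (N : ℝ) + 1 := by positivity
    have := Int.floor_le (x i * ((N + 1 : ℕ) : ℝ))
    simp only [Pi.smul_apply, smul_eq_mul, intR]
    push_cast at this ⊢
    rwa [one_div_mul_eq_div, div_le_iff₀ hN]

lemma continuous_ofR : Continuous (ofR : (Fin r → ℝ) → Fin r → ℂ) := by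
  unfold ofR; fun_prop

lemma Jac.const_real (hf : Jac L 0 f)
    (hrat : ∀ (b : Fin r → ℤ) (N : ℕ), N ≠ 0 → ∀ τ τ' ω ω' : ℂ, 0 < τ.im → 0 < τ'.im → 0 < ω.im →
      0 < ω'.im → f (τ, ofR ((1 / (N : ℝ)) • intR b), ω) = f (τ', ofR ((1 / (N : ℝ)) • intR b), ω'))
    (x : Fin r → ℝ) {τ τ' ω ω' : ℂ} (hτ : 0 < τ.im) (hτ' : 0 < τ'.im) (hω : 0 < ω.im)
    (hω' : 0 < ω'.im) : f (τ, ofR x, ω) = f (τ', ofR x, ω') := by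
  obtain ⟨b, hb⟩ := exists_rat_seq x
  have key : ∀ τ ω : ℂ, 0 < τ.im → 0 < ω.im → Tendsto
      (fun N : ℕ => f (τ, ofR ((1 / ((N + 1 : ℕ) : ℝ)) • intR (b N)), ω)) atTop
      (𝓝 (f (τ, ofR x, ω))) := by
    intro τ ω hτ hω
    have h1 : ContinuousAt f (τ, ofR x, ω) :=
      hf.holo.continuousOn.continuousAt (isOpen_tube.mem_nhds (mem_tube_ofR x hτ hω))
    refine h1.tendsto.comp ?_
    have h2 : Continuous fun y : Fin r → ℝ => (τ, ofR y, ω) := by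
      have := continuous_ofR (r := r); fun_prop
    exact (h2.tendsto x).comp hb
  refine tendsto_nhds_unique (key τ ω hτ hω) ?_
  simpa only [hrat _ _ (Nat.succ_ne_zero _) τ τ' ω ω' hτ hτ' hω hω'] using key τ' ω' hτ' hω'

lemma vim_line (x y : Fin r → ℝ) (s : ℂ) : vim (ofR x + s • ofR y) = s.im • y := by
  rw [vim_add, vim_ofR, vim_smul_ofR, zero_add]

lemma Jac.const_fibre (hf : Jac L 0 f) (hL : IsEvenPosDef L)
    (hreal : ∀ (x : Fin r → ℝ) (τ τ' ω ω' : ℂ), 0 < τ.im → 0 < τ'.im → 0 < ω.im →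
      0 < ω'.im → f (τ, ofR x, ω) = f (τ', ofR x, ω'))
    {z : Fin r → ℂ} {τ τ' ω ω' : ℂ} (hp : (τ, z, ω) ∈ Tube L) (hp' : (τ', z, ω') ∈ Tube L) :
    f (τ, z, ω) = f (τ', z, ω') := by
  obtain ⟨x, y, rfl⟩ : ∃ x y : Fin r → ℝ, z = ofR x + Complex.I • ofR y :=
    ⟨fun i => (z i).re, fun i => (z i).im, by
      ext i; simp [ofR, mul_comm Complex.I, Complex.re_add_im]⟩
  have hω := tube_im_pos hL hp
  have hω' := tube_im_pos hL hp'
  set V : Set ℂ := {s | (τ, ofR x + s • ofR y, ω) ∈ Tube L ∧ (τ', ofR x + s • ofR y, ω') ∈ Tube L}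
    with hV
  have hVo : IsOpen V :=
    (isOpen_tube.preimage (f := fun s : ℂ => (τ, ofR x + s • ofR y, ω)) (by fun_prop)).inter
      (isOpen_tube.preimage (f := fun s : ℂ => (τ', ofR x + s • ofR y, ω')) (by fun_prop))
  have h0 : (0 : ℂ) ∈ V := by
    have h1 : ofR x + (0 : ℂ) • ofR y = ofR x := by rw [zero_smul, add_zero]
    rw [hV, Set.mem_ofPred_eq, h1]
    exact ⟨mem_tube_ofR x hp.1 hω, mem_tube_ofR x hp'.1 hω'⟩
  have hstar : ∀ {τ ω s : ℂ} {t : ℝ}, 0 ≤ t → t ≤ 1 → (τ, ofR x + s • ofR y, ω) ∈ Tube L →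
      (τ, ofR x + (t • s) • ofR y, ω) ∈ Tube L := by
    intro τ ω s t ht ht1 hs
    refine ⟨hs.1, ?_⟩
    have h1 := hs.2
    simp only [rho, vim_line, rpair_smul_left, rpair_smul_right] at h1 ⊢
    have h2 : 0 ≤ s.im * (s.im * rpair L y y) := by
      rw [← mul_assoc]; exact mul_nonneg (mul_self_nonneg _) (rpair_self_nonneg hL y)
    have h3 : t * t ≤ 1 := by nlinarith
    rw [Complex.smul_im, smul_eq_mul]
    nlinarith
  have hVs : StarConvex ℝ 0 V := by
    intro s hs a b ha hb hab
    rw [smul_zero, zero_add]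
    exact ⟨hstar hb (by linarith) hs.1, hstar hb (by linarith) hs.2⟩
  have hVp : IsPreconnected V := (hVs.isPathConnected h0).isConnected.isPreconnected
  have han : ∀ τ ω : ℂ, (∀ s ∈ V, (τ, ofR x + s • ofR y, ω) ∈ Tube L) →
      AnalyticOnNhd ℂ (fun s => f (τ, ofR x + s • ofR y, ω)) V := fun τ ω h =>
    DifferentiableOn.analyticOnNhd (fun s hs =>
      (hf.differentiableAt (γ := fun s => (τ, ofR x + s • ofR y, ω)) (by fun_prop)
        (h s hs)).differentiableWithinAt) hVo
  refine (han τ ω fun s hs => hs.1).eqOn_of_preconnected_of_frequently_eq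
    (han τ' ω' fun s hs => hs.2) hVp h0 ?_ (show Complex.I ∈ V from ⟨hp, hp'⟩)
  have hlim : Tendsto (fun N : ℕ => ((1 / ((N : ℝ) + 1) : ℝ) : ℂ)) atTop (𝓝[≠] 0) := by
    refine tendsto_nhdsWithin_iff.2 ⟨?_, Eventually.of_forall fun N => ?_⟩
    · have := (Complex.continuous_ofReal.tendsto 0).comp
        (tendsto_one_div_add_atTop_nhds_zero_nat (𝕜 := ℝ))
      rwa [Complex.ofReal_zero] at this
    · have : (0 : ℝ) < 1 / ((N : ℝ) + 1) := by positivity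
      exact Complex.ofReal_ne_zero.2 this.ne'
  refine hlim.frequently (Frequently.of_forall fun N => ?_)
  have h1 : ∀ t : ℝ, ofR x + (t : ℂ) • ofR y = ofR (x + t • y) := fun t => by
    ext i; simp [ofR]
  rw [h1]
  exact hreal _ τ τ' ω ω' hp.1 hp'.1 hω hω'

lemma exists_mem_tube {τ : ℂ} (hτ : 0 < τ.im) (z : Fin r → ℂ) : ∃ ω, (τ, z, ω) ∈ Tube L :=
  ⟨((height L 0 τ z + 1 : ℝ) : ℂ) * Complex.I, hτ, (lt_rho_iff hτ).2 (by simp)⟩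

lemma Jac.const_of_fibre (hf : Jac L 0 f) (hL : IsEvenPosDef L)
    (hfib : ∀ (z : Fin r → ℂ) (τ τ' ω ω' : ℂ), (τ, z, ω) ∈ Tube L → (τ', z, ω') ∈ Tube L →
      f (τ, z, ω) = f (τ', z, ω')) {p p' : ℂ × (Fin r → ℂ) × ℂ} (hp : p ∈ Tube L)
    (hp' : p' ∈ Tube L) : f p = f p' := by
  choose ω₀ hω₀ using fun z : Fin r → ℂ => exists_mem_tube (L := L) (τ := Complex.I) (by simp) z
  have hval : ∀ p ∈ Tube L, f p = f (Complex.I, p.2.1, ω₀ p.2.1) := fun p hp =>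
    hfib _ _ _ _ _ hp (hω₀ _)
  have h1 : ∀ (l : Fin r → ℤ) (τ : ℂ) (z : Fin r → ℂ), 0 < τ.im →
      f (Complex.I, z + τ • intC l, ω₀ (z + τ • intC l)) = f (Complex.I, z, ω₀ z) := by
    intro l τ z hτ
    obtain ⟨ω, hω⟩ := exists_mem_tube (L := L) hτ z
    rw [← hval _ hω, ← hf.heis τ z ω l]
    exact (hval (τ, z + τ • intC l, _) ⟨hτ, by rw [rho_heis hL]; exact hω.2⟩).symm
  have h2 : ∀ (l : Fin r → ℤ) (t : ℂ) (z : Fin r → ℂ),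
      f (Complex.I, z + t • intC l, ω₀ (z + t • intC l)) = f (Complex.I, z, ω₀ z) := by
    intro l t z
    set s : ℂ := ((|t.im| + 1 : ℝ) : ℂ) * Complex.I with hs
    have hsi : s.im = |t.im| + 1 := by simp [hs]
    rw [← h1 l s _ (by rw [hsi]; positivity), ← h1 l (t + s) z, add_smul, add_assoc]
    rw [Complex.add_im, hsi]
    linarith [neg_abs_le t.im]
  have h3 : ∀ (s : Finset (Fin r)) (z : Fin r → ℂ),
      f (Complex.I, ∑ i ∈ s, z i • intC (Pi.single i 1), ω₀ (∑ i ∈ s, z i • intC (Pi.single i 1)))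
        = f (Complex.I, 0, ω₀ 0) := by
    intro s z
    induction s using Finset.induction_on with
    | empty => rw [Finset.sum_empty]
    | insert a s ha ih => rw [Finset.sum_insert ha, add_comm, h2, ih]
  have h4 : ∀ z : Fin r → ℂ, f (Complex.I, z, ω₀ z) = f (Complex.I, 0, ω₀ 0) := by
    intro z
    have : ∑ i, z i • intC (Pi.single i 1) = z := by
      ext j
      simp [intC, Pi.single_apply]
    rw [← h3 Finset.univ z, this]
  rw [hval p hp, hval p' hp', h4, h4 p'.2.1]

variable {ε : ℤ} {F : (Fin (2 + (2 + r)) → ℂ) → ℂ}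

lemma det_M2U_ne_zero (hL : IsEvenPosDef L) : (M2U L).det ≠ 0 := by
  intro h0
  obtain ⟨v, hv, h1⟩ := exists_mulVec_eq_zero_iff.2 h0
  have h2 : ∀ x, zpair (M2U L) x v = 0 := fun x => by rw [zpair, h1, dotProduct_zero]
  obtain ⟨a, b, c, d, z, rfl⟩ := vec_induction v
  have ha := h2 (vec 0 1 0 0 0)
  have hb := h2 (vec 1 0 0 0 0)
  have hc := h2 (vec 0 0 0 1 0)
  have hd := h2 (vec 0 0 1 0 0)
  have hz := h2 (vec 0 0 0 0 z)
  rw [zpair_vec] at ha hb hc hd hz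
  simp only [zpair_zero_left] at ha hb hc hd
  have hz' : z = 0 := qnorm_eq_zero hL (by rw [← zpair_self]; linarith)
  apply hv
  subst hz'
  have ha' : a = 0 := by linarith
  have hb' : b = 0 := by linarith
  have hc' : c = 0 := by linarith
  have hd' : d = 0 := by linarith
  subst ha' hb' hc' hd'
  ext i
  refine Fin.addCases (fun i => ?_) (fun i => Fin.addCases (fun i => ?_) (fun i => ?_) i) i
  · fin_cases i <;> simp [vec]
  · fin_cases i <;> simp [vec]
  · simp [vec]

lemma smul_mem_part {t : ℂ} (ht : t ≠ 0) {Z} (hZ : Z ∈ Part L ε) : t • Z ∈ Part L ε := by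
  obtain ⟨s, p, hs, hp, rfl⟩ := hZ
  exact ⟨t * s, p, mul_ne_zero ht hs, hp, smul_smul _ _ _⟩

lemma isPreconnected_slice : IsPreconnected
    {Z | ∃ τ ω : ℂ, 0 < τ.im ∧ 0 < ω.im ∧ Z = phi L ε (τ, 0, ω)} := by
  have h1 : Convex ℝ {τ : ℂ | 0 < τ.im} := convex_halfSpace_im_gt 0
  have h2 := (h1.prod h1).isPreconnected.image (fun q : ℂ × ℂ => phi L ε (q.1, 0, q.2))
    (by have := continuous_phi (L := L) (ε := ε); fun_prop)
  convert h2 using 1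
  ext Z
  constructor
  · rintro ⟨τ, ω, hτ, hω, rfl⟩
    exact ⟨(τ, ω), ⟨hτ, hω⟩, rfl⟩
  · rintro ⟨⟨τ, ω⟩, ⟨hτ, hω⟩, rfl⟩
    exact ⟨τ, ω, hτ, hω, rfl⟩

theorem InvForm.const (hF : InvForm (M2U L) (Part L ε) 0 F) (hL : IsEvenPosDef L)
    (hε : ε * ε = 1) (hD : IsComponent (M2U L) (Part L ε)) {l : Fin r → ℤ} (hl : l ≠ 0)
    {Z W} (hZ : Z ∈ Part L ε) (hW : W ∈ Part L ε) : F Z = F W := by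
  have hf := hF.jac hL hε hD
  have hrat : ∀ (b : Fin r → ℤ) (N : ℕ), N ≠ 0 → ∀ τ τ' ω ω' : ℂ, 0 < τ.im → 0 < τ'.im →
      0 < ω.im → 0 < ω'.im → F (phi L ε (τ, ofR ((1 / (N : ℝ)) • intR b), ω)) =
        F (phi L ε (τ', ofR ((1 / (N : ℝ)) • intR b), ω')) := by
    intro b N hN τ τ' ω ω' hτ hτ' hω hω'
    have h1 := hF.transv_const (det_M2U_ne_zero hL) hD (fun t ht Z hZ => smul_mem_part ht hZ)
      (isEichler_trans (ε := ε) hL b) (N := N) (by exact_mod_cast hN)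
      (Y := {Z | ∃ τ ω : ℂ, 0 < τ.im ∧ 0 < ω.im ∧ Z = phi L ε (τ, 0, ω)})
      (by rintro _ ⟨τ, ω, hτ, hω, rfl⟩; exact (phi_mem_part_iff hε).2 (mem_tube_zero hτ hω))
      isPreconnected_slice (by
        rintro E hE _ ⟨τ, ω, hτ, hω, rfl⟩ _ ⟨τ', ω', hτ', hω', rfl⟩
        exact (hE.jac hL hε hD).const_slice hL hl hτ hτ' hω hω')
      ⟨τ, ω, hτ, hω, rfl⟩ ⟨τ', ω', hτ', hω', rfl⟩
    have h2 : ofR ((1 / (N : ℝ)) • intR b) =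
        (0 : Fin r → ℂ) + ((1 / ((N : ℤ) : ℝ) : ℝ) : ℂ) • intC b := by
      ext i; simp [ofR, intR, intC]
    rw [transv_trans hL hε, transv_trans hL hε] at h1
    rwa [h2]
  have hreal := fun x τ τ' ω ω' h1 h2 h3 h4 =>
    hf.const_real hrat x (τ := τ) (τ' := τ') (ω := ω) (ω' := ω') h1 h2 h3 h4
  obtain ⟨t, p, ht, hp, rfl⟩ := hZ
  obtain ⟨s, p', hs, hp', rfl⟩ := hW
  rw [hF.homogeneous t ht _ ((phi_mem_part_iff hε).2 hp),
    hF.homogeneous s hs _ ((phi_mem_part_iff hε).2 hp'), neg_zero, zpow_zero, zpow_zero,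
    one_mul, one_mul]
  exact hf.const_of_fibre hL (fun z τ τ' ω ω' h h' => hf.const_fibre hL hreal h h') hp hp'

end WeightZero

section Assembly
variable {n : ℕ} {B : Matrix (Fin n) (Fin n) ℤ} {D : Set (Fin n → ℂ)}

lemma IsModularForm.indicator_equivariant {Γ : Set (Matrix (Fin n) (Fin n) ℤ)}
    {χ : Matrix (Fin n) (Fin n) ℤ → ℂ} {k : ℤ} {F : (Fin n → ℂ) → ℂ}
    (hF : IsModularForm B D Γ χ k F) (hB : B.det ≠ 0) (hΓ : Γ ⊆ OPlus B D) {γ} (hγ : γ ∈ Γ) (Z) :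
    D.indicator F (actC γ Z) = χ γ * D.indicator F Z := by
  by_cases hZ : Z ∈ D
  · rw [Set.indicator_of_mem hZ, Set.indicator_of_mem ((OPlus.mem_iff hB (hΓ hγ) Z).2 hZ),
      hF.equivariant γ hγ Z hZ]
  · rw [Set.indicator_of_notMem hZ,
      Set.indicator_of_notMem fun h => hZ ((OPlus.mem_iff hB (hΓ hγ) Z).1 h), mul_zero]

lemma IsModularForm.finite_orbit {Γ : Set (Matrix (Fin n) (Fin n) ℤ)}
    {χ : Matrix (Fin n) (Fin n) ℤ → ℂ} {k : ℤ} {F : (Fin n → ℂ) → ℂ}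
    (hF : IsModularForm B D Γ χ k F) (hB : B.det ≠ 0) (hΓ : IsFiniteIndexSubgroup B D Γ)
    (hχ : IsCharacter Γ χ) :
    ((fun g Z => D.indicator F (actC g Z)) '' OPlus B D).Finite := by
  obtain ⟨S, hS⟩ := hΓ.finite_index
  refine ((hχ.finite_image.image2 (fun c s Z => c * D.indicator F (actC s⁻¹ Z))
    S.finite_toSet)).subset ?_
  rintro _ ⟨g, hg, rfl⟩
  obtain ⟨i, hi, h1, h2⟩ := OPlus.exists_inv hB hg
  obtain ⟨s, hs, γ, hγ, rfl⟩ := hS i hi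
  obtain ⟨γ', hγ', h3, h4⟩ := hΓ.inv_mem γ hγ
  rw [Matrix.mul_assoc] at h2
  have h5 : γ' * s⁻¹ = g := by
    rw [inv_eq_right_inv h2, ← Matrix.mul_assoc, h4, Matrix.one_mul]
  refine ⟨χ γ', ⟨γ', hγ', rfl⟩, s, hs, ?_⟩
  ext Z
  beta_reduce
  rw [← hF.indicator_equivariant hB hΓ.subset hγ', ← actC_mul, h5]

end Assembly

section Span
variable {r : ℕ} {L : Matrix (Fin r) (Fin r) ℤ}

lemma intQ_span_le (R : Set (Fin r → ℤ)) {x : Fin r → ℚ}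
    (hx : x ∈ Submodule.span ℚ (intQ '' R)) : ratR x ∈ Submodule.span ℝ (intR '' R) := by
  induction hx using Submodule.span_induction with
  | mem x h =>
    obtain ⟨v, hv, rfl⟩ := h
    refine Submodule.subset_span ⟨v, hv, ?_⟩
    ext i; simp [ratR, intQ, intR]
  | zero =>
    convert Submodule.zero_mem _
    ext i; simp [ratR]
  | add x y _ _ hx hy =>
    convert Submodule.add_mem _ hx hy using 1
    ext i; simp [ratR]
  | smul a x _ hx =>
    convert Submodule.smul_mem _ (a : ℝ) hx using 1
    ext i; simp [ratR]

lemma exists_orthogonal (hL : IsEvenPosDef L) (R : Set (Fin r → ℤ))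
    (h : Submodule.span ℝ (intR '' R) ≠ ⊤) : ∃ w ≠ 0, ∀ l ∈ R, zpair L l w = 0 := by
  have hQ : Submodule.span ℚ (intQ '' R) ≠ ⊤ := by
    intro hQ
    apply h
    rw [eq_top_iff]
    rintro x -
    rw [pi_eq_sum_univ' x]
    refine Submodule.sum_mem _ fun i _ => Submodule.smul_mem _ _ ?_
    convert intQ_span_le R (x := Pi.single i 1) (hQ ▸ Submodule.mem_top) using 1
    ext j
    simp only [ratR, Pi.single_apply]
    split_ifs <;> simp_all
  obtain ⟨φ, hφ, hle⟩ := Submodule.exists_le_ker_of_lt_top _ (lt_top_iff_ne_top.2 hQ)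
  obtain ⟨b, hb⟩ := IsLocalization.exist_integer_multiples_of_finite (nonZeroDivisors ℤ)
    (fun i : Fin r => φ (Pi.single i 1))
  choose g hg using hb
  have hb0 : ((b : ℤ) : ℚ) ≠ 0 := by exact_mod_cast nonZeroDivisors.coe_ne_zero b
  have hg' : ∀ i, (g i : ℚ) = (b : ℤ) * φ (Pi.single i 1) := fun i => by
    have := hg i
    simpa [Submonoid.smul_def] using this
  have hg0 : g ≠ 0 := by
    rintro rfl
    apply hφ
    ext i
    have := hg' i
    simp only [Pi.zero_apply, Int.cast_zero, zero_eq_mul, hb0, false_or] at this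
    simpa using this
  have hdot : ∀ l ∈ R, l ⬝ᵥ g = 0 := by
    intro l hl
    have h1 : φ (intQ l) = 0 := hle (Submodule.subset_span ⟨l, hl, rfl⟩)
    rw [pi_eq_sum_univ' (intQ l), map_sum] at h1
    have h2 : ((l ⬝ᵥ g : ℤ) : ℚ) = (b : ℤ) * 0 := by
      rw [← h1, dotProduct, Finset.mul_sum]
      push_cast
      refine Finset.sum_congr rfl fun i _ => ?_
      rw [hg', map_smul, smul_eq_mul, intQ]
      ring
    rw [mul_zero] at h2
    exact_mod_cast h2
  have hdet : L.det ≠ 0 := by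
    intro h0
    have h1 := hL.2.2.det_pos
    have h2 : (L.map (Int.cast : ℤ → ℝ)).det = (L.det : ℝ) :=
      ((Int.castRingHom ℝ).map_det L).symm
    rw [h2, h0] at h1
    simp at h1
  have hw : L *ᵥ (L.adjugate *ᵥ g) = L.det • g := by
    rw [mulVec_mulVec, mul_adjugate, smul_mulVec, one_mulVec]
  refine ⟨L.adjugate *ᵥ g, fun h0 => ?_, fun l hl => ?_⟩
  · rw [h0, mulVec_zero] at hw
    exact (smul_ne_zero hdet hg0) hw.symm
  · rw [zpair, hw, dotProduct_smul, hdot l hl, smul_zero]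

theorem span_of_reflective (hL : IsEvenPosDef L) (h2 : Is2Reflective (M2U L))
    {l : Fin r → ℤ} (hl : qnorm L l = 2) :
    Submodule.span ℝ (intR '' {v | qnorm L v = 2}) = ⊤ := by
  by_contra hspan
  obtain ⟨w, hw, hort⟩ := exists_orthogonal hL _ hspan
  obtain ⟨D, hD, Γ, χ, k, F, hΓ, hχ, hF, hne, hzero⟩ := h2
  obtain ⟨ε, hε, rfl⟩ := exists_sign hL hD
  have hB := det_M2U_ne_zero hL
  have hl0 : l ≠ 0 := by rintro rfl; rw [qnorm_zero] at hl; norm_num at hl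
  have hsmul : ∀ t : ℂ, t ≠ 0 → ∀ Z ∈ Part L ε, t • Z ∈ Part L ε := fun t ht Z => smul_mem_part ht
  set D := Part L ε
  set S := (fun g Z => D.indicator F (actC g Z)) '' OPlus (M2U L) D
  have hfin : S.Finite := hF.finite_orbit hB hΓ hχ
  have hF' : ∀ g ∈ OPlus (M2U L) D, ∀ Z ∈ D, D.indicator F (actC g Z) = F (actC g Z) :=
    fun g hg Z hZ => Set.indicator_of_mem ((OPlus.mem_iff hB hg Z).2 hZ) F
  have hS : ∀ g ∈ OPlus (M2U L) D, ∀ Φ ∈ S, (fun Z => Φ (actC g Z)) ∈ S := by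
    rintro g hg _ ⟨g', hg', rfl⟩
    exact ⟨g' * g, OPlus.mul_mem hg' hg, by ext Z; simp only [actC_mul]⟩
  have hd : ∀ Φ ∈ S, DifferentiableOn ℂ Φ D := by
    rintro _ ⟨g, hg, rfl⟩
    exact (hF.holo.comp (differentiable_actC g).differentiableOn fun Z hZ =>
      (OPlus.mem_iff hB hg Z).2 hZ).congr fun Z hZ => hF' g hg Z hZ
  have hh : ∀ Φ ∈ S, ∀ t : ℂ, t ≠ 0 → ∀ Z ∈ D, Φ (t • Z) = t ^ (-k) * Φ Z := by
    rintro _ ⟨g, hg, rfl⟩ t ht Z hZ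
    beta_reduce
    rw [hF' g hg _ (hsmul t ht Z hZ), hF' g hg Z hZ, actC_smul,
      hF.homogeneous t ht _ ((OPlus.mem_iff hB hg Z).2 hZ)]
  have hmem : D.indicator F ∈ S := ⟨1, OPlus.one_mem, by ext Z; simp only [actC_one]⟩
  have hk : k = 0 := by
    obtain ⟨T, hT⟩ := hfin.exists_finset_coe
    rw [← hT] at hS hd hh hmem
    have hE := prodForm_invForm hB hsmul (S := T) (G := id) hS differentiable_id hd hh
    have hZ : ∀ Z ∈ D, prodForm D T id Z = 0 →
        ∃ v, qnorm (M2U L) v = -2 ∧ OrthZ (M2U L) Z v := by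
      intro Z hZ h0
      rw [prodForm_of_mem hZ] at h0
      obtain ⟨Φ, hΦ, h1⟩ := Finset.prod_eq_zero_iff.1 h0
      have hΦ' : Φ ∈ S := by rw [← hT]; exact hΦ
      obtain ⟨g, hg, rfl⟩ := hΦ'
      replace h1 : F (actC g Z) = 0 := (hF' g hg Z hZ).symm.trans h1
      obtain ⟨v, hv, ho⟩ := hzero _ ((OPlus.mem_iff hB hg Z).2 hZ) h1
      obtain ⟨i, hi, h3, -⟩ := OPlus.exists_inv hB hg
      have h4 : cpair (M2U L) (intC (i *ᵥ v)) (intC (i *ᵥ v)) =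
          cpair (M2U L) (intC v) (intC v) := by
        rw [← actC_intC, cpair_actC hi.1]
      rw [cpair_intC_self, cpair_intC_self, hv] at h4
      refine ⟨i *ᵥ v, by exact_mod_cast h4, ?_⟩
      rw [OrthZ, ← cpair_actC hg.1, ← actC_intC, ← actC_mul, h3, actC_one]
      exact ho
    have h5 := weight_eq_zero hL (hE.jac hL hε hD) (zerosNormTwo hL hε hZ) hw
      (fun l hl => hort l hl) hl
    rcases mul_eq_zero.1 h5 with h6 | h6
    · exact h6
    · rw [Nat.cast_eq_zero, Finset.card_eq_zero] at h6
      subst h6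
      simp at hmem
  subst hk
  have hconst : ∀ x ∈ D, ∀ y ∈ D, D.indicator F x = D.indicator F y := fun x hx y hy =>
    const_of_finite_orbit hB hsmul subset_rfl hD.isPreconnected
      (fun E hE x hx y hy => hE.const hL hε hD hl0 hx hy) hfin hS hd
      (fun Φ hΦ t ht Z hZ => by simpa using hh Φ hΦ t ht Z hZ) hmem hx hy
  apply hne
  rcases D.eq_empty_or_nonempty with h0 | ⟨x, hx⟩
  · exact ⟨0, fun Z hZ => by simp [h0] at hZ⟩
  · refine ⟨F x, fun Z hZ => ?_⟩
    simpa [hx, hZ] using hconst Z hZ x hx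

end Span

end Refl

namespace Refl

/-- If L is even positive-definite, 2U ⊕ L(−1) is 2-reflective and L has a
2-root, then the 2-roots of L span L ⊗ ℝ. -/
theorem two_roots_span {r : ℕ} (L : Matrix (Fin r) (Fin r) ℤ) (hL : IsEvenPosDef L)
    (h2 : Is2Reflective (M2U L)) (hroot : ∃ v : Fin r → ℤ, qnorm L v = 2) :
    Submodule.span ℝ {x : Fin r → ℝ | ∃ v : Fin r → ℤ, qnorm L v = 2 ∧ x = intR v} = ⊤ := by
  obtain ⟨l, hl⟩ := hroot
  convert span_of_reflective hL h2 hl using 2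
  ext x
  simp only [Set.mem_ofPred_eq, Set.mem_image, eq_comm]

end Refl
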